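/- Let f_1, …, f_r be restricted power series over ℤ_p in m variables (power series with coefficients in ℤ_p tending to 0, hence converging on ℤ_p^m). For k ≥ 0 let N_k be the number of elements x of (ℤ/p^kℤ)^m such that f_i(y) ≡ 0 (mod p^k) for all i = 1,…,r and some (equivalently, any) lift y ∈ ℤ_p^m of x. Then the Poincaré series P(T) = ∑_{k≥0} N_k p^{−km} T^k is a rational function of T, i.e., there exist polynomials g, h ∈ ℚ[T] with h ≠ 0 such that h(T)·P(T) = g(T) as formal power series. -/

import Mathlib

open Filter MeasureTheory
open scoped ENNReal

namespace PadicSub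

variable (p : ℕ) [Fact p.Prime]

/-- The coefficients (indexed by multi-indices) of a restricted power series:
they tend to `0` along the cofinite filter. -/
def IsRestrictedCoeffs {m : ℕ} (a : (Fin m → ℕ) → ℚ_[p]) : Prop :=
  Filter.Tendsto a Filter.cofinite (nhds 0)

/-- The restricted analytic function associated to a family of coefficients:
the sum of the power series on `ℤ_p^m`, and `0` outside `ℤ_p^m`. -/
noncomputable def ranalFn {m : ℕ} (a : (Fin m → ℕ) → ℚ_[p]) (x : Fin m → ℚ_[p]) : ℚ_[p] :=
  if ∀ j, ‖x j‖ ≤ 1 then ∑' i : (Fin m → ℕ), a i * ∏ j, x j ^ i j else 0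

/-- `D`-functions: the functions obtained from restricted analytic functions, polynomial
maps, and the inverse function (with the convention `0⁻¹ = 0`) by repeated composition. -/
inductive IsDFunction : {m : ℕ} → ((Fin m → ℚ_[p]) → ℚ_[p]) → Prop where
  | ranal {m : ℕ} (a : (Fin m → ℕ) → ℚ_[p]) (ha : IsRestrictedCoeffs p a) :
      IsDFunction (ranalFn p a)
  | poly {m : ℕ} (q : MvPolynomial (Fin m) ℚ_[p]) :
      IsDFunction (fun x => MvPolynomial.eval x q)
  | inv : IsDFunction (fun x : Fin 1 → ℚ_[p] => (x 0)⁻¹)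
  | comp {m n : ℕ} (f : (Fin n → ℚ_[p]) → ℚ_[p]) (g : Fin n → (Fin m → ℚ_[p]) → ℚ_[p]) :
      IsDFunction f → (∀ i, IsDFunction (g i)) →
      IsDFunction (fun x => f (fun i => g i x))

/-- `P_n`: the set of nonzero `n`-th powers in `ℚ_p`. -/
def Pset (n : ℕ) : Set ℚ_[p] := {x | ∃ y : ℚ_[p], y ≠ 0 ∧ y ^ n = x}

/-- The coset `μ P_n`. -/
def cosetP (μ : ℚ_[p]) (n : ℕ) : Set ℚ_[p] := {x | ∃ y ∈ Pset p n, x = μ * y}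

/-- A (globally) subanalytic subset of `ℚ_p^m`: a finite union of finite intersections of
sets of the form `{x | f x = 0}` and `{x | f x ∈ P_n}`, `f` a `D`-function, `n > 0`. -/
def IsSubanalytic {m : ℕ} (X : Set (Fin m → ℚ_[p])) : Prop :=
  ∃ (r s : ℕ) (F : Fin r → Fin s → Set (Fin m → ℚ_[p])),
    (∀ i j, (∃ f, IsDFunction p f ∧ F i j = {x | f x = 0}) ∨
            (∃ f n, IsDFunction p f ∧ 0 < n ∧ F i j = {x | f x ∈ Pset p n})) ∧
    X = ⋃ i, ⋂ j, F i j

/-- A semialgebraic subset of `ℚ_p^m`: a finite union of finite intersections of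
sets of the form `{x | f x = 0}` and `{x | f x ∈ P_n}`, `f` a polynomial, `n > 0`. -/
def IsSemialgebraic {m : ℕ} (X : Set (Fin m → ℚ_[p])) : Prop :=
  ∃ (r s : ℕ) (F : Fin r → Fin s → Set (Fin m → ℚ_[p])),
    (∀ i j, (∃ f : MvPolynomial (Fin m) ℚ_[p], F i j = {x | MvPolynomial.eval x f = 0}) ∨
            (∃ (f : MvPolynomial (Fin m) ℚ_[p]) (n : ℕ), 0 < n ∧
              F i j = {x | MvPolynomial.eval x f ∈ Pset p n})) ∧
    X = ⋃ i, ⋂ j, F i j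

/-- The graph of the restriction to `X` of a map `ℚ_p^m → ℚ_p^n`, inside `ℚ_p^(m+n)`. -/
def graphMap {m n : ℕ} (X : Set (Fin m → ℚ_[p])) (F : (Fin m → ℚ_[p]) → (Fin n → ℚ_[p])) :
    Set (Fin (m + n) → ℚ_[p]) :=
  {z | (fun i => z (Fin.castAdd n i)) ∈ X ∧
    F (fun i => z (Fin.castAdd n i)) = fun j => z (Fin.natAdd m j)}

/-- The graph of the restriction to `X` of a function `ℚ_p^m → ℚ_p`, inside `ℚ_p^(m+1)`. -/
def graphFun {m : ℕ} (X : Set (Fin m → ℚ_[p])) (f : (Fin m → ℚ_[p]) → ℚ_[p]) :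
    Set (Fin (m + 1) → ℚ_[p]) :=
  {z | (fun i : Fin m => z i.castSucc) ∈ X ∧ f (fun i : Fin m => z i.castSucc) = z (Fin.last m)}

/-- A function `ℚ_p^m → ℚ_p` is subanalytic on `X` if its graph over `X` is subanalytic. -/
def IsSubanalyticFnOn {m : ℕ} (X : Set (Fin m → ℚ_[p])) (f : (Fin m → ℚ_[p]) → ℚ_[p]) : Prop :=
  IsSubanalytic p (graphFun p X f)

/-- A (totally defined) subanalytic function `ℚ_p^m → ℚ_p`. -/
def IsSubanalyticFn {m : ℕ} (f : (Fin m → ℚ_[p]) → ℚ_[p]) : Prop :=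
  IsSubanalyticFnOn p Set.univ f

/-- A function `ℚ_p^m → ℚ_p` is semialgebraic on `X` if its graph over `X` is
semialgebraic. -/
def IsSemialgebraicFnOn {m : ℕ} (X : Set (Fin m → ℚ_[p])) (f : (Fin m → ℚ_[p]) → ℚ_[p]) :
    Prop :=
  IsSemialgebraic p (graphFun p X f)

/-- A subanalytic subset of `ℚ_p` (one-variable version). -/
def IsSubanalytic1 (X : Set ℚ_[p]) : Prop :=
  IsSubanalytic p {z : Fin 1 → ℚ_[p] | z 0 ∈ X}

/-- A semialgebraic subset of `ℚ_p` (one-variable version). -/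
def IsSemialgebraic1 (X : Set ℚ_[p]) : Prop :=
  IsSemialgebraic p {z : Fin 1 → ℚ_[p] | z 0 ∈ X}

/-- A function `ℚ_p → ℚ_p` subanalytic on `X ⊆ ℚ_p`: its graph over `X` is a subanalytic
subset of `ℚ_p²`. -/
def IsSubanalyticFnOn1 (X : Set ℚ_[p]) (f : ℚ_[p] → ℚ_[p]) : Prop :=
  IsSubanalytic p {z : Fin 2 → ℚ_[p] | z 0 ∈ X ∧ f (z 0) = z 1}

/-- A function `ℚ_p → ℚ_p` semialgebraic on `X ⊆ ℚ_p`: its graph over `X` is a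
semialgebraic subset of `ℚ_p²`. -/
def IsSemialgebraicFnOn1 (X : Set ℚ_[p]) (f : ℚ_[p] → ℚ_[p]) : Prop :=
  IsSemialgebraic p {z : Fin 2 → ℚ_[p] | z 0 ∈ X ∧ f (z 0) = z 1}

/-- Interpretation of the symbols `□ᵢ` in the definition of cells: `true` means `<` and
`false` means "no condition". -/
def sqRel (b : Bool) (x y : ℝ) : Prop := b = true → x < y

/-- A cell in `ℚ_p`, presented with its center `γ` and coset data `μ`, `n`. -/
def IsCell1 (A : Set ℚ_[p]) (γ μ : ℚ_[p]) (n : ℕ) : Prop :=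
  0 < n ∧ A.Nonempty ∧
  ∃ (α β : ℚ_[p]) (b₁ b₂ : Bool), α ≠ 0 ∧ β ≠ 0 ∧
    A = {t | sqRel b₁ ‖α‖ ‖t - γ‖ ∧ sqRel b₂ ‖t - γ‖ ‖β‖ ∧ t - γ ∈ cosetP p μ n}

/-- Subanalytic cells in `ℚ_p^(m+1)`, defined inductively, presented with their center
`γ : ℚ_p^m → ℚ_p` and coset data `μ`, `n`.  The projection of the cell onto the first `m`
coordinates is required to be a cell. -/
inductive IsCell : {m : ℕ} → Set (Fin (m + 1) → ℚ_[p]) →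
    ((Fin m → ℚ_[p]) → ℚ_[p]) → ℚ_[p] → ℕ → Prop where
  | base (n : ℕ) (hn : 0 < n) (μ γ0 α β : ℚ_[p]) (hα : α ≠ 0) (hβ : β ≠ 0)
      (b₁ b₂ : Bool) (A : Set (Fin 1 → ℚ_[p])) (hne : A.Nonempty)
      (hA : A = {z | sqRel b₁ ‖α‖ ‖z 0 - γ0‖ ∧ sqRel b₂ ‖z 0 - γ0‖ ‖β‖ ∧
        z 0 - γ0 ∈ cosetP p μ n}) :
      IsCell A (fun _ => γ0) μ n
  | succ {m : ℕ} {D : Set (Fin (m + 1) → ℚ_[p])} {γD : (Fin m → ℚ_[p]) → ℚ_[p]}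
      {μD : ℚ_[p]} {nD : ℕ} (hD : IsCell D γD μD nD)
      (n : ℕ) (hn : 0 < n) (μ : ℚ_[p]) (α β γ : (Fin (m + 1) → ℚ_[p]) → ℚ_[p])
      (hα : IsSubanalyticFn p α) (hβ : IsSubanalyticFn p β) (hγ : IsSubanalyticFn p γ)
      (hα0 : ∀ x, α x ≠ 0) (hβ0 : ∀ x, β x ≠ 0)
      (b₁ b₂ : Bool) (A : Set (Fin (m + 2) → ℚ_[p]))
      (hA : A = {z | (fun i : Fin (m + 1) => z i.castSucc) ∈ D ∧
          sqRel b₁ ‖α (fun i : Fin (m + 1) => z i.castSucc)‖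
            ‖z (Fin.last (m + 1)) - γ (fun i : Fin (m + 1) => z i.castSucc)‖ ∧
          sqRel b₂ ‖z (Fin.last (m + 1)) - γ (fun i : Fin (m + 1) => z i.castSucc)‖
            ‖β (fun i : Fin (m + 1) => z i.castSucc)‖ ∧
          z (Fin.last (m + 1)) - γ (fun i : Fin (m + 1) => z i.castSucc) ∈ cosetP p μ n})
      (hproj : (fun (z : Fin (m + 2) → ℚ_[p]) (i : Fin (m + 1)) => z i.castSucc) '' A = D) :
      IsCell A γ μ n

/-- Analytic cells in `ℚ_p^(m+1)`: as subanalytic cells, but at each stage of the inductive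
definition the functions `α`, `β`, `γ` are moreover analytic on the projection of the cell. -/
inductive IsAnalyticCell : {m : ℕ} → Set (Fin (m + 1) → ℚ_[p]) →
    ((Fin m → ℚ_[p]) → ℚ_[p]) → ℚ_[p] → ℕ → Prop where
  | base (n : ℕ) (hn : 0 < n) (μ γ0 α β : ℚ_[p]) (hα : α ≠ 0) (hβ : β ≠ 0)
      (b₁ b₂ : Bool) (A : Set (Fin 1 → ℚ_[p])) (hne : A.Nonempty)
      (hA : A = {z | sqRel b₁ ‖α‖ ‖z 0 - γ0‖ ∧ sqRel b₂ ‖z 0 - γ0‖ ‖β‖ ∧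
        z 0 - γ0 ∈ cosetP p μ n}) :
      IsAnalyticCell A (fun _ => γ0) μ n
  | succ {m : ℕ} {D : Set (Fin (m + 1) → ℚ_[p])} {γD : (Fin m → ℚ_[p]) → ℚ_[p]}
      {μD : ℚ_[p]} {nD : ℕ} (hD : IsAnalyticCell D γD μD nD)
      (n : ℕ) (hn : 0 < n) (μ : ℚ_[p]) (α β γ : (Fin (m + 1) → ℚ_[p]) → ℚ_[p])
      (hα : IsSubanalyticFn p α) (hβ : IsSubanalyticFn p β) (hγ : IsSubanalyticFn p γ)
      (hαan : AnalyticOn ℚ_[p] α D) (hβan : AnalyticOn ℚ_[p] β D)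
      (hγan : AnalyticOn ℚ_[p] γ D)
      (hα0 : ∀ x, α x ≠ 0) (hβ0 : ∀ x, β x ≠ 0)
      (b₁ b₂ : Bool) (A : Set (Fin (m + 2) → ℚ_[p]))
      (hA : A = {z | (fun i : Fin (m + 1) => z i.castSucc) ∈ D ∧
          sqRel b₁ ‖α (fun i : Fin (m + 1) => z i.castSucc)‖
            ‖z (Fin.last (m + 1)) - γ (fun i : Fin (m + 1) => z i.castSucc)‖ ∧
          sqRel b₂ ‖z (Fin.last (m + 1)) - γ (fun i : Fin (m + 1) => z i.castSucc)‖
            ‖β (fun i : Fin (m + 1) => z i.castSucc)‖ ∧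
          z (Fin.last (m + 1)) - γ (fun i : Fin (m + 1) => z i.castSucc) ∈ cosetP p μ n})
      (hproj : (fun (z : Fin (m + 2) → ℚ_[p]) (i : Fin (m + 1)) => z i.castSucc) '' A = D) :
      IsAnalyticCell A γ μ n

/-- Generators of the algebra of subanalytic constructible functions on `ℚ_p^m`:
`ℤ`-valued valuations of nonvanishing subanalytic functions, and (`ℚ`-valued) norms of
subanalytic functions. -/
def constructibleGens (m : ℕ) : Set ((Fin m → ℚ_[p]) → ℚ) :=
  {g | ∃ h : (Fin m → ℚ_[p]) → ℚ_[p], IsSubanalyticFn p h ∧ (∀ x, h x ≠ 0) ∧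
        g = fun x => ((h x).valuation : ℚ)} ∪
  {g | ∃ h : (Fin m → ℚ_[p]) → ℚ_[p], IsSubanalyticFn p h ∧
        g = fun x => (padicNormE (h x) : ℚ)}

/-- The `ℚ`-algebra `C(ℚ_p^m)` of subanalytic constructible functions on `ℚ_p^m`. -/
noncomputable def ConstructibleAlg (m : ℕ) : Subalgebra ℚ ((Fin m → ℚ_[p]) → ℚ) :=
  Algebra.adjoin ℚ (constructibleGens p m)

/-- `ℤ_p^m` as a subset of `ℚ_p^m`. -/
def ZpSet (m : ℕ) : Set (Fin m → ℚ_[p]) := {x | ∀ j, ‖x j‖ ≤ 1}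

/-- A simple subset of `ℤ^n × ℚ_p^m`. -/
def IsSimpleSet (n m : ℕ) (A : Set ((Fin n → ℤ) × (Fin m → ℚ_[p]))) : Prop :=
  IsSubanalytic p {z : Fin (n + m) → ℚ_[p] |
    (∀ i : Fin n, z (Fin.castAdd m i) ≠ 0) ∧
    ((fun i : Fin n => (z (Fin.castAdd m i)).valuation),
      fun j : Fin m => z (Fin.natAdd n j)) ∈ A}

/-- A simple function `ℤ^n × ℚ_p^m → ℤ`: one whose graph is a simple set. -/
def IsSimpleFn (n m : ℕ) (h : (Fin n → ℤ) × (Fin m → ℚ_[p]) → ℤ) : Prop :=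
  IsSimpleSet p (n + 1) m
    {w | w.1 (Fin.last n) = h (fun i : Fin n => w.1 i.castSucc, w.2)}

/-- Generators of `C_simple(ℤ^n × ℚ_p^m)`: simple functions, and `p^h` for `h` simple. -/
def simpleGens (n m : ℕ) : Set ((Fin n → ℤ) × (Fin m → ℚ_[p]) → ℚ) :=
  {g | ∃ h, IsSimpleFn p n m h ∧ g = fun w => (h w : ℚ)} ∪
  {g | ∃ h, IsSimpleFn p n m h ∧ g = fun w => (p : ℚ) ^ (h w)}

/-- The `ℚ`-algebra `C_simple(ℤ^n × ℚ_p^m)`. -/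
noncomputable def SimpleAlg (n m : ℕ) : Subalgebra ℚ ((Fin n → ℤ) × (Fin m → ℚ_[p]) → ℚ) :=
  Algebra.adjoin ℚ (simpleGens p n m)

noncomputable instance : MeasurableSpace ℚ_[p] := borel _
instance : BorelSpace ℚ_[p] := ⟨rfl⟩

end PadicSub

namespace PR

/-- Tate functions. -/
inductive Tate (p : ℕ) [Fact p.Prime] (n : ℕ) : ((Fin n → ℤ_[p]) → ℤ_[p]) → Prop
  | const (c : ℤ_[p]) : Tate p n (fun _ => c)
  | coord (l : Fin n) : Tate p n (fun x => x l)
  | add {f g} : Tate p n f → Tate p n g → Tate p n (fun x => f x + g x)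
  | mul {f g} : Tate p n f → Tate p n g → Tate p n (fun x => f x * g x)
  | psum (f : ℕ → (Fin n → ℤ_[p]) → ℤ_[p]) : (∀ k, Tate p n (f k)) →
      Tate p n (fun x => ∑' k, (p : ℤ_[p]) ^ k * f k x)

variable {p : ℕ} [hp : Fact p.Prime] {n : ℕ}

lemma norm_p_pow_mul_le (k : ℕ) (a : ℤ_[p]) : ‖(p : ℤ_[p]) ^ k * a‖ ≤ ((p : ℝ)⁻¹) ^ k := by
  rw [norm_mul, norm_pow, PadicInt.norm_p]
  exact mul_le_of_le_one_right (by positivity) (PadicInt.norm_le_one a)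

lemma pinv_lt_one : ((p : ℝ)⁻¹) < 1 := by
  have : (1 : ℝ) < p := by exact_mod_cast hp.out.one_lt
  exact inv_lt_one_of_one_lt₀ this

lemma summable_geo : Summable (fun k : ℕ => ((p : ℝ)⁻¹) ^ k) :=
  summable_geometric_of_lt_one (by positivity) pinv_lt_one

lemma summable_p (a : ℕ → ℤ_[p]) : Summable (fun k => (p : ℤ_[p]) ^ k * a k) :=
  Summable.of_norm_bounded summable_geo (fun k => norm_p_pow_mul_le k _)

lemma summable_norm_p (a : ℕ → ℤ_[p]) : Summable (fun k => ‖(p : ℤ_[p]) ^ k * a k‖) :=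
  Summable.of_nonneg_of_le (fun _ => norm_nonneg _) (fun k => norm_p_pow_mul_le k _) summable_geo

lemma Tate.comp {m : ℕ} {f : (Fin m → ℤ_[p]) → ℤ_[p]} (hf : Tate p m f)
    {g : (Fin n → ℤ_[p]) → (Fin m → ℤ_[p])} (hg : ∀ i, Tate p n (fun x => g x i)) :
    Tate p n (fun x => f (g x)) := by
  induction hf with
  | const c => exact .const c
  | coord l => exact hg l
  | add _ _ h1 h2 => exact .add h1 h2
  | mul _ _ h1 h2 => exact .mul h1 h2
  | psum f _ h => exact .psum _ h

lemma Tate.continuous {f : (Fin n → ℤ_[p]) → ℤ_[p]} (hf : Tate p n f) : Continuous f := by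
  induction hf with
  | const c => exact continuous_const
  | coord l => exact continuous_apply l
  | add _ _ h1 h2 => exact h1.add h2
  | mul _ _ h1 h2 => exact h1.mul h2
  | psum f _ h =>
    exact continuous_tsum (fun k => continuous_const.mul (h k)) summable_geo
      (fun k x => norm_p_pow_mul_le k _)

lemma Tate.congr {f g : (Fin n → ℤ_[p]) → ℤ_[p]} (hf : Tate p n f) (h : ∀ x, g x = f x) :
    Tate p n g := by
  have : g = f := funext h
  rwa [this]

lemma Tate.neg {f : (Fin n → ℤ_[p]) → ℤ_[p]} (hf : Tate p n f) : Tate p n (fun x => - f x) :=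
  ((Tate.const (-1)).mul hf).congr (by intro x; ring)

lemma Tate.sub {f g : (Fin n → ℤ_[p]) → ℤ_[p]} (hf : Tate p n f) (hg : Tate p n g) :
    Tate p n (fun x => f x - g x) :=
  (hf.add hg.neg).congr (by intro x; ring)

lemma Tate.pow {f : (Fin n → ℤ_[p]) → ℤ_[p]} (hf : Tate p n f) (k : ℕ) :
    Tate p n (fun x => f x ^ k) := by
  induction k with
  | zero => exact (Tate.const 1).congr (by intro x; simp)
  | succ k ih => exact (ih.mul hf).congr (by intro x; ring)

lemma Tate.sum {ι : Type*} (s : Finset ι) {f : ι → (Fin n → ℤ_[p]) → ℤ_[p]}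
    (hf : ∀ i ∈ s, Tate p n (f i)) : Tate p n (fun x => ∑ i ∈ s, f i x) := by
  classical
  induction s using Finset.induction_on with
  | empty => exact (Tate.const 0).congr (by intro x; simp)
  | insert a s ha ih =>
    exact ((hf a (by simp)).add (ih (fun i hi => hf i (by simp [hi])))).congr
      (by intro x; rw [Finset.sum_insert ha])

lemma Tate.prod {ι : Type*} (s : Finset ι) {f : ι → (Fin n → ℤ_[p]) → ℤ_[p]}
    (hf : ∀ i ∈ s, Tate p n (f i)) : Tate p n (fun x => ∏ i ∈ s, f i x) := by
  classical
  induction s using Finset.induction_on with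
  | empty => exact (Tate.const 1).congr (by intro x; simp)
  | insert a s ha ih =>
    exact ((hf a (by simp)).mul (ih (fun i hi => hf i (by simp [hi])))).congr
      (by intro x; rw [Finset.prod_insert ha])

/-- psum with larger steps -/
lemma Tate.psum' (M : ℕ) (hM : 1 ≤ M) (f : ℕ → (Fin n → ℤ_[p]) → ℤ_[p])
    (hf : ∀ k, Tate p n (f k)) :
    Tate p n (fun x => ∑' k, (p : ℤ_[p]) ^ (M * k) * f k x) := by
  refine (Tate.psum (fun k x => (p : ℤ_[p]) ^ ((M - 1) * k) * f k x)
    (fun k => (Tate.const _).mul (hf k))).congr ?_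
  intro x
  congr 1; ext1 k
  rw [← mul_assoc, ← pow_add]
  congr 2
  obtain ⟨M, rfl⟩ := Nat.exists_eq_add_of_le hM
  simp; ring

lemma Tate.diff {f : (Fin n → ℤ_[p]) → ℤ_[p]} (hf : Tate p n f) (x0 : Fin n → ℤ_[p]) (e : ℕ) :
    ∃ g, Tate p n g ∧ ∀ x : Fin n → ℤ_[p],
      f (fun i => x0 i + (p : ℤ_[p]) ^ e * x i) = f x0 + (p : ℤ_[p]) ^ e * g x := by
  induction hf with
  | const c => exact ⟨_, .const 0, by simp⟩
  | coord l => exact ⟨_, .coord l, by simp⟩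
  | @add f g _ _ h1 h2 =>
    obtain ⟨a, ha, ha'⟩ := h1
    obtain ⟨b, hb, hb'⟩ := h2
    exact ⟨_, ha.add hb, fun x => by
      beta_reduce
      rw [ha', hb']; ring⟩
  | @mul f g _ _ h1 h2 =>
    obtain ⟨a, ha, ha'⟩ := h1
    obtain ⟨b, hb, hb'⟩ := h2
    exact ⟨_, (((Tate.const (f x0)).mul hb).add ((Tate.const (g x0)).mul ha)).add
      ((Tate.const ((p : ℤ_[p]) ^ e)).mul (ha.mul hb)), fun x => by
      beta_reduce
      rw [ha', hb']; ring⟩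
  | psum f _ h =>
    choose g hg hg' using h
    refine ⟨_, .psum g hg, fun x => ?_⟩
    beta_reduce
    rw [← (summable_p _).tsum_mul_left, ← Summable.tsum_add (summable_p _)]
    · refine tsum_congr fun k => ?_
      rw [hg']; ring
    · exact (summable_p _).mul_left _

lemma Tate.lipschitz {f : (Fin n → ℤ_[p]) → ℤ_[p]} (hf : Tate p n f) (x y : Fin n → ℤ_[p]) (e : ℕ)
    (h : ∀ i, (p : ℤ_[p]) ^ e ∣ y i - x i) : (p : ℤ_[p]) ^ e ∣ f y - f x := by
  choose z hz using h
  obtain ⟨g, -, hg⟩ := hf.diff x e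
  have : y = fun i => x i + (p : ℤ_[p]) ^ e * z i := by
    ext1 i; rw [← hz]; ring
  rw [this, hg]
  exact ⟨g z, by ring⟩

/-- The ring of Tate functions. -/
def TR (p : ℕ) [Fact p.Prime] (n : ℕ) : Subring ((Fin n → ℤ_[p]) → ℤ_[p]) where
  carrier := {f | Tate p n f}
  mul_mem' h1 h2 := Tate.mul h1 h2
  one_mem' := Tate.const 1
  add_mem' h1 h2 := Tate.add h1 h2
  zero_mem' := Tate.const 0
  neg_mem' h := Tate.neg h

lemma p_pow_ne_zero (e : ℕ) : (p : ℤ_[p]) ^ e ≠ 0 :=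
  pow_ne_zero _ (by exact_mod_cast hp.out.ne_zero)

lemma norm_p_lt_one' : ‖(p : ℤ_[p])‖ < 1 := by
  rw [PadicInt.norm_p]; exact pinv_lt_one

/-- `1 + p r` has a Tate inverse -/
lemma Tate.inv_one_add {r : (Fin n → ℤ_[p]) → ℤ_[p]} (hr : Tate p n r) :
    ∃ s, Tate p n s ∧ ∀ x, (1 + p * r x) * s x = 1 := by
  refine ⟨_, .psum (fun k x => (- r x) ^ k) (fun k => hr.neg.pow k), fun x => ?_⟩
  have h1 : ‖-(p * r x)‖ < 1 := by
    rw [norm_neg, norm_mul]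
    calc _ ≤ ‖(p : ℤ_[p])‖ * 1 := by gcongr; exact PadicInt.norm_le_one _
      _ < 1 := by rw [mul_one]; exact norm_p_lt_one'
  have := mul_neg_geom_series (-(p * r x)) h1
  convert this using 1
  rw [sub_neg_eq_add]
  congr 2
  ext1 k
  rw [← mul_pow]; congr 1; ring

lemma eq_zero_of_forall_dvd {a : ℤ_[p]} (h : ∀ k : ℕ, (p : ℤ_[p]) ^ k ∣ a) : a = 0 := by
  by_contra ha
  have h0 := norm_pos_iff.mpr ha
  obtain ⟨k, hk⟩ := exists_pow_lt_of_lt_one h0 (pinv_lt_one (p := p))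
  obtain ⟨b, hb⟩ := h k
  have := norm_p_pow_mul_le k b
  rw [← hb] at this
  linarith

instance TR_adic (M : ℕ) [NeZero M] :
    IsAdicComplete (Ideal.span {(p : TR p n) ^ M}) (TR p n) where
  haus' x hx := by
    apply Subtype.ext
    funext y
    show x.1 y = 0
    apply eq_zero_of_forall_dvd
    intro k
    have := hx k
    rw [SModEq.zero, smul_eq_mul, Ideal.mul_top, Ideal.span_singleton_pow,
      Ideal.mem_span_singleton] at this
    obtain ⟨g, hg⟩ := this
    have h2 : x.1 y = ((p : ℤ_[p]) ^ M) ^ k * g.1 y := by rw [hg]; simp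
    rw [h2, ← pow_mul]
    refine Dvd.dvd.mul_right (pow_dvd_pow _ ?_) _
    exact Nat.le_mul_of_pos_left k (Nat.pos_of_ne_zero (NeZero.ne M))
  prec' f hf := by
    have hM : 1 ≤ M := Nat.pos_of_ne_zero (NeZero.ne M)
    have key : ∀ k, ∃ g : TR p n, f (k + 1) = f k + ((p : TR p n) ^ M) ^ k * g := by
      intro k
      have := (hf (Nat.le_succ k)).symm
      rw [SModEq.sub_mem, smul_eq_mul, Ideal.mul_top, Ideal.span_singleton_pow,
        Ideal.mem_span_singleton] at this
      obtain ⟨g, hg⟩ := this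
      exact ⟨g, by rw [← hg]; ring⟩
    choose g hg using key
    have hfk : ∀ k y, (f k).1 y = (f 0).1 y + ∑ i ∈ Finset.range k, (p : ℤ_[p]) ^ (M * i) * (g i).1 y := by
      intro k y
      induction k with
      | zero => simp
      | succ k ih => rw [hg, Finset.sum_range_succ, ← add_assoc, ← ih, pow_mul]; simp
    have hs : ∀ (u : ℕ → TR p n) (y), Summable (fun i => (p : ℤ_[p]) ^ (M * i) * (u i).1 y) := by
      intro u y
      refine (summable_p (fun i => (p : ℤ_[p]) ^ ((M - 1) * i) * (u i).1 y)).congr ?_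
      intro i
      rw [← mul_assoc, ← pow_add]
      congr 2
      obtain ⟨M, rfl⟩ := Nat.exists_eq_add_of_le hM
      simp; ring
    refine ⟨f 0 + ⟨_, Tate.psum' M hM (fun k => (g k).1) (fun k => (g k).2)⟩, fun k => ?_⟩
    symm
    rw [SModEq.sub_mem, smul_eq_mul, Ideal.mul_top, Ideal.span_singleton_pow,
        Ideal.mem_span_singleton]
    refine ⟨⟨_, Tate.psum' M hM (fun i => (g (i + k)).1) (fun i => (g _).2)⟩, ?_⟩
    apply Subtype.ext
    funext y
    show (f 0).1 y + (∑' i, (p : ℤ_[p]) ^ (M * i) * (g i).1 y) - (f k).1 y =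
      ((((p : TR p n) ^ M) ^ k : TR p n) : (Fin n → ℤ_[p]) → ℤ_[p]) y * _
    rw [hfk k, ← (hs g y).sum_add_tsum_nat_add k]
    have : ((((p : TR p n) ^ M) ^ k : TR p n) : (Fin n → ℤ_[p]) → ℤ_[p]) y = (p : ℤ_[p]) ^ (M * k) := by
      rw [pow_mul]; simp
    rw [this]
    show _ = (p : ℤ_[p]) ^ (M * k) * ∑' i, (p : ℤ_[p]) ^ (M * i) * (g (i + k)).1 y
    rw [← (hs (fun i => g (i + k)) y).tsum_mul_left]
    rw [add_sub_add_left_eq_sub, add_sub_cancel_left]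
    congr 1; ext1 i
    rw [← mul_assoc, ← pow_add]; congr 2; ring

end PR

namespace PR
variable {p : ℕ} [hp : Fact p.Prime] {n : ℕ}

open PowerSeries in
/-- evaluation of a power series at `p t`, ring hom for fixed point -/
noncomputable def evh (z : Fin (n + 1) → ℤ_[p]) : PowerSeries (TR p n) →+* ℤ_[p] where
  toFun F := ∑' j, (p : ℤ_[p]) ^ j * ((coeff j F).1 (Fin.tail z) * z 0 ^ j)
  map_zero' := by simp
  map_one' := by
    rw [tsum_eq_single 0]
    · simp
    · intro j hj
      simp [coeff_one, hj]
  map_add' F G := by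
    rw [← (summable_p _).tsum_add (summable_p _)]
    refine tsum_congr fun j => ?_
    simp; ring
  map_mul' F G := by
    rw [tsum_mul_tsum_eq_tsum_sum_antidiagonal_of_summable_norm (summable_norm_p _)
      (summable_norm_p _)]
    refine tsum_congr fun j => ?_
    rw [coeff_mul]
    have : ((∑ x ∈ Finset.HasAntidiagonal.antidiagonal j, coeff x.1 F * coeff x.2 G : TR p n) :
      (Fin n → ℤ_[p]) → ℤ_[p]) (Fin.tail z) =
      ∑ x ∈ Finset.HasAntidiagonal.antidiagonal j, (coeff x.1 F).1 (Fin.tail z) * (coeff x.2 G).1 (Fin.tail z) := by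
      simp
    rw [this, Finset.sum_mul, Finset.mul_sum]
    refine Finset.sum_congr rfl fun x hx => ?_
    rw [← Finset.HasAntidiagonal.mem_antidiagonal.mp hx]
    ring

lemma evh_apply (z : Fin (n + 1) → ℤ_[p]) (F : PowerSeries (TR p n)) : evh z F =
   ∑' j, (p : ℤ_[p]) ^ j * ((PowerSeries.coeff j F).1 (Fin.tail z) * z 0 ^ j) := rfl

lemma evh_C (z : Fin (n + 1) → ℤ_[p]) (a : TR p n) : evh z (PowerSeries.C a) = a.1 (Fin.tail z) := by
  rw [evh_apply, tsum_eq_single 0]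
  · simp
  · intro j hj
    simp [PowerSeries.coeff_C, hj]

lemma evh_X (z : Fin (n + 1) → ℤ_[p]) : evh z (PowerSeries.X : PowerSeries (TR p n)) = p * z 0 := by
  rw [evh_apply, tsum_eq_single 1]
  · simp
  · intro j hj
    simp [PowerSeries.coeff_X, hj]

lemma tate_tail {f : (Fin n → ℤ_[p]) → ℤ_[p]} (hf : Tate p n f) :
    Tate p (n + 1) (fun z => f (Fin.tail z)) :=
  hf.comp (g := fun z => Fin.tail z) (fun i => Tate.coord i.succ)

lemma tate_evh (F : PowerSeries (TR p n)) : Tate p (n + 1) (fun z => evh z F) :=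
  Tate.psum _ (fun k => (tate_tail (PowerSeries.coeff k F).2).mul ((Tate.coord 0).pow k))

lemma summable_double (a : ℕ → ℕ → ℤ_[p]) :
    Summable (fun x : ℕ × ℕ => (p : ℤ_[p]) ^ x.1 * ((p : ℤ_[p]) ^ x.2 * a x.1 x.2)) := by
  refine Summable.of_norm_bounded (g := fun x : ℕ × ℕ => ((p : ℝ)⁻¹) ^ x.1 * ((p : ℝ)⁻¹) ^ x.2)
    (summable_geo.mul_of_nonneg summable_geo (fun _ => by positivity) (fun _ => by positivity)) ?_
  rintro ⟨i, j⟩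
  rw [norm_mul, norm_pow, PadicInt.norm_p]
  gcongr
  exact norm_p_pow_mul_le _ _

lemma expansion {f : (Fin (n + 1) → ℤ_[p]) → ℤ_[p]} (hf : Tate p (n + 1) f) :
    ∃ F : PowerSeries (TR p n), ∀ z : Fin (n + 1) → ℤ_[p],
      f (Fin.cons (p * z 0) (Fin.tail z)) = evh z F := by
  induction hf with
  | const c => exact ⟨PowerSeries.C ⟨_, Tate.const c⟩, fun z => by rw [evh_C]⟩
  | coord l =>
    refine Fin.cases ?_ (fun l => ?_) l
    · exact ⟨PowerSeries.X, fun z => by rw [evh_X]; simp⟩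
    · exact ⟨PowerSeries.C ⟨_, Tate.coord l⟩, fun z => by rw [evh_C]; simp⟩
  | add _ _ h1 h2 =>
    obtain ⟨F, hF⟩ := h1
    obtain ⟨G, hG⟩ := h2
    exact ⟨F + G, fun z => by beta_reduce; rw [map_add, hF, hG]⟩
  | mul _ _ h1 h2 =>
    obtain ⟨F, hF⟩ := h1
    obtain ⟨G, hG⟩ := h2
    exact ⟨F * G, fun z => by beta_reduce; rw [map_mul, hF, hG]⟩
  | psum f _ h =>
    choose F hF using h
    refine ⟨PowerSeries.mk fun j => ⟨_, Tate.psum (fun k => (PowerSeries.coeff j (F k)).1)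
      (fun k => (PowerSeries.coeff j (F k)).2)⟩, fun z => ?_⟩
    simp only [hF, evh_apply, PowerSeries.coeff_mk]
    have e1 : ∀ k, (p : ℤ_[p]) ^ k * ∑' j, (p : ℤ_[p]) ^ j *
        ((PowerSeries.coeff j (F k)).1 (Fin.tail z) * z 0 ^ j) =
        ∑' j, (p : ℤ_[p]) ^ k * ((p : ℤ_[p]) ^ j *
        ((PowerSeries.coeff j (F k)).1 (Fin.tail z) * z 0 ^ j)) := by
      intro k
      rw [(summable_p _).tsum_mul_left]
    have hs := summable_double (p := p)
      (fun k j => (PowerSeries.coeff j (F k)).1 (Fin.tail z) * z 0 ^ j)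
    simp_rw [e1]
    have := Summable.tsum_comm (f := fun k j => (p : ℤ_[p]) ^ k * ((p : ℤ_[p]) ^ j *
        ((PowerSeries.coeff j (F k)).1 (Fin.tail z) * z 0 ^ j))) hs
    rw [← this]
    refine tsum_congr fun j => ?_
    rw [← (summable_p _).tsum_mul_right, ← ((summable_p _).mul_right _).tsum_mul_left]
    refine tsum_congr fun k => ?_
    ring

/-- evaluation at a point -/
noncomputable def evalAt (x : Fin n → ℤ_[p]) : TR p n →+* ℤ_[p] :=
  (Pi.evalRingHom _ x).comp (TR p n).subtype

@[simp] lemma evalAt_apply (x : Fin n → ℤ_[p]) (f : TR p n) : evalAt x f = f.1 x := rfl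

/-- evaluation of a polynomial with Tate coefficients. -/
noncomputable def pev (P : Polynomial (TR p n)) (z : Fin (n + 1) → ℤ_[p]) : ℤ_[p] :=
  P.eval₂ (evalAt (Fin.tail z)) (z 0)

lemma tate_pev (P : Polynomial (TR p n)) : Tate p (n + 1) (pev P) := by
  have : pev P = fun z => ∑ i ∈ P.support, (P.coeff i).1 (Fin.tail z) * z 0 ^ i := by
    funext z
    rw [pev, Polynomial.eval₂_eq_sum]
    rfl
  rw [this]
  exact Tate.sum _ fun i _ => (tate_tail (P.coeff i).2).mul ((Tate.coord 0).pow i)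

lemma evh_coe (P : Polynomial (TR p n)) (z : Fin (n + 1) → ℤ_[p]) :
    evh z (P : PowerSeries (TR p n)) = P.eval₂ (evalAt (Fin.tail z)) (p * z 0) := by
  have : ((evh z).comp (Polynomial.coeToPowerSeries.ringHom)) =
      Polynomial.eval₂RingHom (evalAt (Fin.tail z)) (p * z 0) := by
    apply Polynomial.ringHom_ext
    · intro a; simp [evh_C]
    · simp [evh_X]
  exact congrArg (fun φ => φ P) this

lemma not_unit_p_pow (M : ℕ) (hM : 1 ≤ M) : Ideal.span {(p : TR p n) ^ M} ≠ ⊤ := by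
  rw [Ne, Ideal.span_singleton_eq_top]
  intro h
  have h2 := (h.map (evalAt (fun _ => 0)))
  rw [map_pow, map_natCast, isUnit_pow_iff (by omega)] at h2
  exact (PadicInt.irreducible_p).not_isUnit h2

lemma isUnit_TR_iff (f : TR p n) (h : ∃ g : TR p n, ∃ r : TR p n, f * g = 1 + p * r) : IsUnit f := by
  obtain ⟨g, r, h⟩ := h
  obtain ⟨s, hs, hs'⟩ := r.2.inv_one_add
  refine IsUnit.of_mul_eq_one (g * ⟨s, hs⟩) ?_
  rw [← mul_assoc, h]
  apply Subtype.ext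
  funext x
  simpa using hs' x

open PowerSeries in
lemma weier1 (G : PowerSeries (TR p n)) (d M : ℕ) (hM : 1 ≤ M) (hdM : d ≤ M)
    (h1 : ∀ j < d, (p : TR p n) ^ M ∣ coeff j G) (h2 : IsUnit (coeff d G)) :
    ∃ (u : (Fin (n + 1) → ℤ_[p]) → ℤ_[p]) (P : Polynomial (TR p n)),
      Tate p (n + 1) u ∧ (∀ z, ‖u z‖ = 1) ∧ P.Monic ∧ P.natDegree = d ∧
      ∀ z, evh z G = (p : ℤ_[p]) ^ d * u z * pev P z := by
  have : NeZero M := ⟨by omega⟩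
  set I := Ideal.span {(p : TR p n) ^ M} with hI
  have hne := not_unit_p_pow (p := p) (n := n) M hM
  have : Nontrivial (TR p n ⧸ I) := Ideal.Quotient.nontrivial_iff.mpr hne
  have hord : (G.map (Ideal.Quotient.mk I)).order = d := by
    rw [order_eq_nat]
    constructor
    · rw [coeff_map]
      exact (h2.map _).ne_zero
    · intro i hi
      rw [coeff_map, Ideal.Quotient.eq_zero_iff_mem, Ideal.mem_span_singleton]
      exact h1 i hi
  have H : G.IsWeierstrassDivisorAt I := by
    unfold IsWeierstrassDivisorAt
    rw [hord]; exact h2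
  have hdiv := H.isWeierstrassDivisionAt_div_mod ((X : PowerSeries (TR p n)) ^ d)
  set q := H.div (X ^ d)
  set r := H.mod (X ^ d)
  have hdeg : r.degree < d := by simpa [hord] using hdiv.degree_lt
  have hr : ∀ i < d, (p : TR p n) ^ M ∣ r.coeff i := by
    intro i hi
    have := hdiv.coeff_f_sub_r_mem (i := i) (by rw [hord]; simpa using hi)
    rw [map_sub, coeff_X_pow, if_neg (by omega), zero_sub, neg_mem_iff, Polynomial.coeff_coe,
      Ideal.mem_span_singleton] at this
    exact this
  have hq : IsUnit q := by
    rw [isUnit_iff_constantCoeff]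
    apply isUnit_TR_iff
    have h3 := congrArg (coeff d) hdiv.eq_mul_add
    rw [coeff_X_pow_self, map_add, Polynomial.coeff_coe,
      Polynomial.coeff_eq_zero_of_degree_lt hdeg, add_zero, coeff_mul,
      ← Finset.sum_sdiff (s₁ := {(d, 0)}) (by simp), Finset.sum_singleton] at h3
    have h4 : (p : TR p n) ∣ ∑ x ∈ Finset.HasAntidiagonal.antidiagonal d \ {(d, 0)}, coeff x.1 G * coeff x.2 q := by
      apply Finset.dvd_sum
      rintro ⟨i, j⟩ hx
      simp at hx
      have : i < d := by
        rcases Nat.lt_or_ge i d with h | h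
        · exact h
        · exact absurd (by omega : j = 0) (hx.2 (by omega))
      exact Dvd.dvd.mul_right ((dvd_pow_self _ (by omega)).trans (h1 i this)) _
    obtain ⟨s, hs⟩ := h4
    rw [hs] at h3
    refine ⟨coeff d G, -s, ?_⟩
    simp only [coeff_zero_eq_constantCoeff] at h3
    linear_combination - h3
  obtain ⟨w, hw⟩ := hq.exists_right_inv
  have hrc : ∀ i, ∃ s : TR p n, i < d → r.coeff i = (p : TR p n) ^ M * s := by
    intro i
    by_cases hi : i < d
    · obtain ⟨s, hs⟩ := hr i hi
      exact ⟨s, fun _ => hs⟩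
    · exact ⟨0, fun h => absurd h hi⟩
  choose s hs using hrc
  set S : Polynomial (TR p n) := ∑ i ∈ Finset.range d,
    Polynomial.C ((p : TR p n) ^ (M + i - d) * s i) * Polynomial.X ^ i with hS
  have hSdeg : S.degree < d := by
    rw [hS]
    refine lt_of_le_of_lt (Polynomial.degree_sum_le _ _) ?_
    refine (Finset.sup_lt_iff (WithBot.bot_lt_coe d)).mpr ?_
    intro i hi
    refine lt_of_le_of_lt (Polynomial.degree_C_mul_X_pow_le _ _) ?_
    exact WithBot.coe_lt_coe.mpr (Finset.mem_range.mp hi)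
  refine ⟨fun z => evh z w, Polynomial.X ^ d - S, tate_evh w, fun z => ?_, ?_, ?_, fun z => ?_⟩
  · have := congrArg (evh z) hw
    rw [map_mul, map_one] at this
    exact PadicInt.isUnit_iff.mp (IsUnit.of_mul_eq_one_right _ this)
  · exact Polynomial.monic_X_pow_sub hSdeg
  · rw [sub_eq_add_neg]
    rw [Polynomial.natDegree_add_eq_left_of_degree_lt, Polynomial.natDegree_X_pow]
    rw [Polynomial.degree_neg, Polynomial.degree_X_pow]; exact hSdeg
  · have hG : G = w * (X ^ d - (r : PowerSeries (TR p n))) := by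
      linear_combination -w * hdiv.eq_mul_add - G * hw
    rw [hG, map_mul, map_sub, map_pow, evh_X, evh_coe]
    have e1 : r.eval₂ (evalAt (Fin.tail z)) (p * z 0) = (p : ℤ_[p]) ^ d * pev S z := by
      rcases Nat.eq_zero_or_pos d with hd0 | hd0
      · have hr0 : r = 0 := by
          rw [hd0] at hdeg
          exact Polynomial.degree_eq_bot.mp (WithBot.lt_coe_bot.mp hdeg)
        rw [hr0, hS, hd0]; simp [pev]
      rw [pev, hS, Polynomial.eval₂_finsetSum, Polynomial.eval₂_eq_sum_range' (n := d), Finset.mul_sum]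
      · refine Finset.sum_congr rfl fun i hi => ?_
        have hi' := Finset.mem_range.mp hi
        rw [hs i hi']
        simp only [map_mul, map_pow, map_natCast, Polynomial.eval₂_mul, Polynomial.eval₂_C,
          Polynomial.eval₂_pow, Polynomial.eval₂_X, Polynomial.eval₂_natCast]
        have : (p : ℤ_[p]) ^ M * (p : ℤ_[p]) ^ i = (p : ℤ_[p]) ^ d * (p : ℤ_[p]) ^ (M + i - d) := by
          rw [← pow_add, ← pow_add]; congr 1; omega
        rw [mul_pow]
        linear_combination (evalAt (Fin.tail z)) (s i) * z 0 ^ i * this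
      · rcases eq_or_ne r 0 with h0 | h0
        · rw [h0]; simpa using hd0
        · rwa [Polynomial.natDegree_lt_iff_degree_lt h0]
    rw [e1]
    have e2 : pev (Polynomial.X ^ d - S) z = z 0 ^ d - pev S z := by
      simp [pev]
    rw [e2]
    ring

/-- pullback of Tate functions by scaling -/
lemma Tate.scale {f : (Fin n → ℤ_[p]) → ℤ_[p]} (hf : Tate p n f) (e : ℕ) :
    Tate p n (fun x => f (fun i => (p : ℤ_[p]) ^ e * x i)) :=
  hf.comp (g := fun x i => (p : ℤ_[p]) ^ e * x i) (fun i => (Tate.const _).mul (Tate.coord i))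

open PowerSeries in
lemma weier {f : (Fin (n + 1) → ℤ_[p]) → ℤ_[p]} (F : PowerSeries (TR p n))
    (hF : ∀ z : Fin (n + 1) → ℤ_[p], f (Fin.cons (p * z 0) (Fin.tail z)) = evh z F) (d : ℕ)
    (h0 : ∀ j < d, (coeff j F).1 (fun _ => 0) = 0) (hd : (coeff d F).1 (fun _ => 0) ≠ 0) :
    ∃ e0, ∀ e ≥ e0, ∃ e1_0, ∀ e1 ≥ e1_0,
    ∃ (c : ℤ_[p]) (u : (Fin (n + 1) → ℤ_[p]) → ℤ_[p]) (P : Polynomial (TR p n)),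
      c ≠ 0 ∧ Tate p (n + 1) u ∧ (∀ z, ‖u z‖ = 1) ∧ P.Monic ∧ P.natDegree = d ∧
      ∀ z : Fin (n + 1) → ℤ_[p],
        f (Fin.cons ((p : ℤ_[p]) ^ e * z 0) (fun i => (p : ℤ_[p]) ^ e1 * Fin.tail z i)) =
        c * u z * pev P z := by
  set v := ((coeff d F).1 (fun _ => 0)).valuation with hv
  set ε := PadicInt.unitCoeff hd
  have hε : (coeff d F).1 (fun _ => 0) = ε * (p : ℤ_[p]) ^ v := PadicInt.unitCoeff_spec hd
  refine ⟨v + 1, fun e he => ?_⟩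
  obtain ⟨k, rfl⟩ := Nat.exists_eq_add_of_le he
  set e' := v + k with he'
  refine ⟨v + e' * d + (d + 1), fun e1 he1 => ?_⟩
  obtain ⟨k', rfl⟩ := Nat.exists_eq_add_of_le he1
  set e1 := v + e' * d + (d + 1) + k' with he1'
  have hg := fun j => (coeff j F).2.diff (fun _ => 0) e1
  choose g hg hg' using hg
  simp only [zero_add] at hg'
  have hsc := fun j => (coeff j F).2.scale e1
  set G : PowerSeries (TR p n) := mk fun j =>
    if j < d then (p : TR p n) ^ (d + 1 + k' + e' * j) * ⟨g j, hg j⟩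
    else if j = d then ⟨_, (Tate.const (ε : ℤ_[p])).add ((Tate.const ((p : ℤ_[p]) ^ (e1 - v))).mul (hg d))⟩
    else (p : TR p n) ^ (e' * (j - d) - v) * ⟨_, hsc j⟩ with hG
  have key : ∀ j x, (coeff j F).1 (fun i => (p : ℤ_[p]) ^ e1 * x i) * (p : ℤ_[p]) ^ (e' * j) =
      (p : ℤ_[p]) ^ (v + e' * d) * (coeff j G).1 x := by
    intro j x
    rw [hG, coeff_mk]
    rcases lt_trichotomy j d with h | h | h
    · rw [if_pos h, hg', h0 j h]
      have : (p : ℤ_[p]) ^ e1 * (p : ℤ_[p]) ^ (e' * j) = (p : ℤ_[p]) ^ (v + e' * d) *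
        (p : ℤ_[p]) ^ (d + 1 + k' + e' * j) := by
        rw [← pow_add, ← pow_add]; congr 1; rw [he1']; ring
      simp
      linear_combination g j x * this
    · subst h
      rw [if_neg (lt_irrefl _), if_pos rfl, hg', hε]
      have : (p : ℤ_[p]) ^ e1 = (p : ℤ_[p]) ^ v * (p : ℤ_[p]) ^ (e1 - v) := by
        rw [← pow_add]; congr 1; omega
      rw [this, pow_add]
      ring
    · rw [if_neg (by omega), if_neg (by omega)]
      have : (p : ℤ_[p]) ^ (e' * j) = (p : ℤ_[p]) ^ (v + e' * d) *
        (p : ℤ_[p]) ^ (e' * (j - d) - v) := by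
        rw [← pow_add]; congr 1
        obtain ⟨i, rfl⟩ := Nat.exists_eq_add_of_lt h
        have : v ≤ e' * (i + 1) := by rw [he']; nlinarith
        have h3 : d + i + 1 - d = i + 1 := by omega
        rw [h3]
        have : e' * (d + i + 1) = e' * d + e' * (i + 1) := by ring
        omega
      simp only [Subring.coe_mul, Subring.coe_pow, Pi.mul_apply, Pi.pow_apply, Subring.coe_natCast,
        Pi.natCast_apply]
      rw [this]; ring
  obtain ⟨u, P, hu, hu1, hP, hPd, hev⟩ := weier1 G d (d + 1) (by omega) (by omega) (by
    intro j hj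
    rw [hG, coeff_mk, if_pos hj]
    refine Dvd.dvd.mul_right (pow_dvd_pow _ ?_) _
    omega) (by
    rw [hG, coeff_mk, if_neg (lt_irrefl _), if_pos rfl]
    apply isUnit_TR_iff
    refine ⟨⟨_, Tate.const ((ε⁻¹ : ℤ_[p]ˣ) : ℤ_[p])⟩, ⟨_, (Tate.const (((ε⁻¹ : ℤ_[p]ˣ) : ℤ_[p]) *
      (p : ℤ_[p]) ^ (e1 - v - 1))).mul (hg d)⟩, ?_⟩
    apply Subtype.ext
    funext x
    have : (p : ℤ_[p]) ^ (e1 - v) = p * (p : ℤ_[p]) ^ (e1 - v - 1) := by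
      rw [← pow_succ']; congr 1; omega
    show ((ε : ℤ_[p]) + (p : ℤ_[p]) ^ (e1 - v) * g d x) * ((ε⁻¹ : ℤ_[p]ˣ) : ℤ_[p]) =
      1 + p * (((ε⁻¹ : ℤ_[p]ˣ) : ℤ_[p]) * (p : ℤ_[p]) ^ (e1 - v - 1) * g d x)
    rw [this, add_mul, Units.mul_inv]
    ring)
  refine ⟨(p : ℤ_[p]) ^ (v + e' * d) * (p : ℤ_[p]) ^ d, u, P,
    mul_ne_zero (p_pow_ne_zero _) (p_pow_ne_zero _), hu, hu1, hP, hPd, fun z => ?_⟩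
  have := hF (Fin.cons ((p : ℤ_[p]) ^ e' * z 0) (fun i => (p : ℤ_[p]) ^ e1 * Fin.tail z i))
  simp only [Fin.cons_zero, Fin.tail_cons] at this
  have e2 : (p : ℤ_[p]) ^ (v + 1 + k) * z 0 = p * ((p : ℤ_[p]) ^ e' * z 0) := by
    rw [← mul_assoc, ← pow_succ']; congr 2; omega
  rw [e2, this, mul_assoc, mul_assoc, ← mul_assoc _ (u z), ← hev, evh_apply, evh_apply,
    ← (summable_p _).tsum_mul_left]
  refine tsum_congr fun j => ?_
  simp only [Fin.cons_zero, Fin.tail_cons]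
  rw [mul_pow, ← pow_mul]
  linear_combination (p : ℤ_[p]) ^ j * z 0 ^ j * key j (Fin.tail z)

end PR

namespace PR
variable {p : ℕ} [hp : Fact p.Prime] {n : ℕ}

lemma tate_restricted {m : ℕ} (a : (Fin m → ℕ) → ℤ_[p])
    (ha : Filter.Tendsto a Filter.cofinite (nhds 0)) :
    Tate p m (fun y => ∑' ι : Fin m → ℕ, a ι * ∏ j, y j ^ ι j) := by
  classical
  have hfin : ∀ ε : ℝ, 0 < ε → {ι | ε ≤ ‖a ι‖}.Finite := by
    intro ε hε
    have := (Metric.tendsto_nhds.mp ha) ε hε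
    rw [Filter.eventually_cofinite] at this
    refine this.subset ?_
    intro ι hι
    simp at hι ⊢
    exact hι
  have hS : ∀ K : ℕ, {ι | a ι ≠ 0 ∧ (a ι).valuation = K}.Finite := by
    intro K
    refine (hfin ((p : ℝ) ^ (-K : ℤ)) (by have := hp.out.pos; positivity)).subset ?_
    rintro ι ⟨h1, h2⟩
    simp only [Set.mem_ofPred_eq]
    rw [PadicInt.norm_eq_zpow_neg_valuation h1, h2]
  set S := fun K => (hS K).toFinset with hSdef
  have hb : ∀ ι, ∃ b : ℤ_[p], a ι = (p : ℤ_[p]) ^ (a ι).valuation * b := by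
    intro ι
    by_cases h : a ι = 0
    · exact ⟨0, by simp [h]⟩
    · exact ⟨_, (PadicInt.unitCoeff_spec h).trans (mul_comm _ _)⟩
  choose b hb using hb
  have hnorm : ∀ (ι : Fin m → ℕ) (y : Fin m → ℤ_[p]), ‖a ι * ∏ j, y j ^ ι j‖ ≤ ‖a ι‖ := by
    intro ι y
    rw [norm_mul]
    exact mul_le_of_le_one_right (norm_nonneg _) (PadicInt.norm_le_one _)
  refine (Tate.psum (fun K y => ∑ ι ∈ S K, b ι * ∏ j, y j ^ ι j) (fun K => Tate.sum _ fun ι _ =>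
    (Tate.const _).mul (Tate.prod _ fun j _ => (Tate.coord j).pow _))).congr ?_
  intro y
  set g : ℕ → (Fin m → ℕ) → ℤ_[p] := fun K ι => if a ι ≠ 0 ∧ (a ι).valuation = K then
    a ι * ∏ j, y j ^ ι j else 0 with hg
  have hsum : Summable (Function.uncurry g) := by
    apply NonarchimedeanAddGroup.summable_of_tendsto_cofinite_zero
    rw [Metric.tendsto_nhds]
    intro ε hε
    rw [Filter.eventually_cofinite]
    refine ((hfin ε hε).image (fun ι => ((a ι).valuation, ι))).subset ?_
    rintro ⟨K, ι⟩ h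
    simp only [Set.mem_ofPred_eq, not_lt, dist_zero_right, Function.uncurry, hg] at h
    split_ifs at h with h1
    · exact ⟨ι, h.trans (hnorm ι y), by simp [h1.2]⟩
    · simp at h; linarith
  have h1 : ∀ K, ∑' ι, g K ι = (p : ℤ_[p]) ^ K * ∑ ι ∈ S K, b ι * ∏ j, y j ^ ι j := by
    intro K
    rw [tsum_eq_sum (s := S K), Finset.mul_sum]
    · refine Finset.sum_congr rfl fun ι hι => ?_
      simp [hSdef] at hι
      simp only [hg]
      rw [if_pos hι]
      conv_lhs => rw [hb ι, hι.2]
      ring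
    · intro ι hι
      simp [hSdef] at hι
      simp only [hg]
      rw [if_neg]
      rintro ⟨h1, h2⟩
      exact hι h1 h2
  have h2 : ∀ ι, ∑' K, g K ι = a ι * ∏ j, y j ^ ι j := by
    intro ι
    rw [tsum_eq_single (a ι).valuation]
    · simp only [hg]
      by_cases h : a ι = 0 <;> simp [h]
    · intro K hK
      simp only [hg]
      rw [if_neg]
      rintro ⟨-, h⟩
      exact hK h.symm
  calc _ = ∑' ι, ∑' K, g K ι := (tsum_congr h2).symm
    _ = ∑' K, ∑' ι, g K ι := (Summable.tsum_comm hsum)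
    _ = _ := tsum_congr h1

/-- pullback of Tate functions -/
noncomputable def pull {m : ℕ} (g : (Fin n → ℤ_[p]) → (Fin m → ℤ_[p]))
    (hg : ∀ i, Tate p n (fun x => g x i)) : TR p m →+* TR p n where
  toFun f := ⟨fun x => f.1 (g x), f.2.comp hg⟩
  map_zero' := rfl
  map_one' := rfl
  map_add' _ _ := rfl
  map_mul' _ _ := rfl

lemma pev_map {g : (Fin n → ℤ_[p]) → (Fin n → ℤ_[p])}
    (hg : ∀ i, Tate p n (fun x => g x i)) (P : Polynomial (TR p n)) (z : Fin (n + 1) → ℤ_[p]) :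
    pev (P.map (pull g hg)) z = pev P (Fin.cons (z 0) (g (Fin.tail z))) := by
  rw [pev, pev, Polynomial.eval₂_map]
  simp only [Fin.cons_zero, Fin.tail_cons]
  rfl

lemma pev_taylor (σ : TR p n) (P : Polynomial (TR p n)) (z : Fin (n + 1) → ℤ_[p]) :
    pev (P.taylor σ) z = pev P (Fin.cons (z 0 + σ.1 (Fin.tail z)) (Fin.tail z)) := by
  rw [pev, pev, Polynomial.taylor_apply, Polynomial.eval₂_comp]
  simp

lemma pev_expansion (P : Polynomial (TR p n)) (z : Fin (n + 1) → ℤ_[p]) :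
    pev P (Fin.cons (p * z 0) (Fin.tail z)) = evh z (P : PowerSeries (TR p n)) := by
  rw [evh_coe, pev]; simp

lemma coeff_zero_ne {f : (Fin (n + 1) → ℤ_[p]) → ℤ_[p]} (F : PowerSeries (TR p n))
    (hF : ∀ z : Fin (n + 1) → ℤ_[p], f (Fin.cons (p * z 0) (Fin.tail z)) = evh z F)
    (s : ℤ_[p]) (h : f (Fin.cons (p * s) (fun _ => 0)) ≠ 0) :
    ∃ d, (∀ j < d, (PowerSeries.coeff j F).1 (fun _ => 0) = 0) ∧
      (PowerSeries.coeff d F).1 (fun _ => 0) ≠ 0 := by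
  classical
  have : ∃ d, (PowerSeries.coeff d F).1 (fun _ => 0) ≠ 0 := by
    by_contra! hc
    apply h
    have := hF (Fin.cons s (fun _ => 0))
    simp only [Fin.cons_zero, Fin.tail_cons] at this
    rw [this, evh_apply]
    simp [hc]
  exact ⟨Nat.find this, fun j hj => not_not.mp (Nat.find_min this hj), Nat.find_spec this⟩

lemma nonvanish {f g : (Fin n → ℤ_[p]) → ℤ_[p]} (hf : Tate p n f) (hg : Tate p n g)
    (h1 : ∃ x : Fin n → ℤ_[p], f (fun i => p * x i) ≠ 0)
    (h2 : ∃ x : Fin n → ℤ_[p], g (fun i => p * x i) ≠ 0) :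
    ∃ x : Fin n → ℤ_[p], f (fun i => p * x i) * g (fun i => p * x i) ≠ 0 := by
  obtain ⟨x1, h1⟩ := h1
  obtain ⟨x2, h2⟩ := h2
  have hline : ∀ i, Tate p 1 (fun σ => p * x1 i + σ 0 * (x2 i - x1 i)) := fun i =>
    (Tate.const _).add ((Tate.coord 0).mul (Tate.const _))
  have hf' := hf.comp hline
  have hg' := hg.comp hline
  obtain ⟨F, hF⟩ := expansion (n := 0) hf'
  obtain ⟨G, hG⟩ := expansion (n := 0) hg'
  obtain ⟨a, -, ha⟩ := coeff_zero_ne (f := fun σ : Fin 1 → ℤ_[p] => f (fun i => p * x1 i + σ 0 * (x2 i - x1 i)))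
    F hF 0 (by
    beta_reduce
    simpa using h1)
  obtain ⟨b, -, hb⟩ := coeff_zero_ne
    (f := fun σ : Fin 1 → ℤ_[p] => g (fun i => p * x1 i + σ 0 * (x2 i - x1 i))) G hG 1 (by
    simp only [Fin.cons_zero, mul_one]
    convert h2 using 3
    ring)
  set Φ := PowerSeries.map (evalAt (p := p) (n := 0) (fun _ => 0)) with hΦ
  have hne : Φ (F * G) ≠ 0 := by
    rw [map_mul]
    apply mul_ne_zero
    · intro h
      apply ha
      have := congrArg (PowerSeries.coeff a) h
      rwa [hΦ, PowerSeries.coeff_map] at this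
    · intro h
      apply hb
      have := congrArg (PowerSeries.coeff b) h
      rwa [hΦ, PowerSeries.coeff_map] at this
  classical
  have hex : ∃ d, (PowerSeries.coeff d (F * G)).1 (fun _ => 0) ≠ 0 := by
    by_contra! hc
    apply hne
    ext d
    rw [hΦ, PowerSeries.coeff_map]
    simpa using hc d
  obtain ⟨e0, he0⟩ := weier (n := 0) (f := fun σ : Fin 1 → ℤ_[p] => f (fun i => p * x1 i + σ 0 * (x2 i - x1 i)) *
    g (fun i => p * x1 i + σ 0 * (x2 i - x1 i))) (F * G) (fun z => by rw [map_mul, ← hF, ← hG])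
    (Nat.find hex) (fun j hj => not_not.mp (Nat.find_min hex hj)) (Nat.find_spec hex)
  obtain ⟨e1, he1⟩ := he0 (e0 + 1) (by omega)
  obtain ⟨c, u, P, hc, -, hu, hP, -, hev⟩ := he1 e1 le_rfl
  have hQ : P.map (evalAt (p := p) (n := 0) (fun _ => 0)) ≠ 0 := (hP.map _).ne_zero
  obtain ⟨t, ht⟩ : ∃ t, (P.map (evalAt (p := p) (n := 0) (fun _ => 0))).eval t ≠ 0 := by
    by_contra! hc
    exact hQ (Polynomial.funext (by simpa using hc))
  have := hev (Fin.cons t (fun _ => 0))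
  refine ⟨fun i => x1 i + (p : ℤ_[p]) ^ e0 * t * (x2 i - x1 i), ?_⟩
  have e3 : ∀ i, p * x1 i + (p : ℤ_[p]) ^ (e0 + 1) * t * (x2 i - x1 i) =
    p * (x1 i + (p : ℤ_[p]) ^ e0 * t * (x2 i - x1 i)) := fun i => by ring
  simp only [Fin.cons_zero, e3] at this
  rw [this]
  refine mul_ne_zero (mul_ne_zero hc ?_) ?_
  · intro h
    have := hu (Fin.cons t (fun _ => 0))
    rw [h] at this; simp at this
  · rw [Polynomial.eval_map] at ht
    simpa [pev] using ht

lemma nonvanish_prod {ι : Type*} (s : Finset ι) (f : ι → (Fin n → ℤ_[p]) → ℤ_[p])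
    (hf : ∀ i ∈ s, Tate p n (f i))
    (h1 : ∀ i ∈ s, ∃ x : Fin n → ℤ_[p], f i (fun i => p * x i) ≠ 0) :
    ∃ x : Fin n → ℤ_[p], ∀ i ∈ s, f i (fun j => p * x j) ≠ 0 := by
  classical
  suffices ∃ x : Fin n → ℤ_[p], ∏ i ∈ s, f i (fun j => p * x j) ≠ 0 by
    obtain ⟨x, hx⟩ := this
    exact ⟨x, Finset.prod_ne_zero_iff.mp hx⟩
  induction s using Finset.induction_on with
  | empty => exact ⟨0, by simp⟩
  | insert a s ha ih =>
    obtain ⟨x, hx⟩ := nonvanish (hf a (by simp)) (Tate.prod s fun i hi => hf i (by simp [hi]))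
      (h1 a (by simp)) (ih (fun i hi => hf i (by simp [hi])) (fun i hi => h1 i (by simp [hi])))
    exact ⟨x, by rwa [Finset.prod_insert ha]⟩

end PR

namespace PR
variable {p : ℕ} [hp : Fact p.Prime] {n : ℕ}

noncomputable instance instMeasZp : MeasurableSpace ℤ_[p] := borel _
instance instBorelZp : BorelSpace ℤ_[p] := ⟨rfl⟩
noncomputable instance instVolZp : MeasureSpace ℤ_[p] := ⟨Measure.addHaarMeasure ⊤⟩
instance instHaarZp : Measure.IsAddHaarMeasure (volume : Measure ℤ_[p]) :=
  inferInstanceAs (Measure.IsAddHaarMeasure (Measure.addHaarMeasure ⊤))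
instance instProbZp : IsProbabilityMeasure (volume : Measure ℤ_[p]) :=
  ⟨by
    have := Measure.addHaarMeasure_self (G := ℤ_[p]) (K₀ := ⊤)
    rw [TopologicalSpace.PositiveCompacts.coe_top] at this
    exact this⟩

lemma lintegral_range {E : Type*} [AddCommGroup E] [TopologicalSpace E] [IsTopologicalAddGroup E]
    [CompactSpace E] [T2Space E] [SecondCountableTopology E] [MeasurableSpace E] [BorelSpace E]
    (μ : Measure E) [μ.IsAddHaarMeasure]
    [IsProbabilityMeasure μ] (T : E →+ E) (hT : Continuous T) (hi : Function.Injective T)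
    (G : E → ℝ≥0∞) :
    ∫⁻ x in Set.range T, G x ∂μ = μ (Set.range T) * ∫⁻ x, G (T x) ∂μ := by
  have hce : Topology.IsClosedEmbedding T := hT.isClosedEmbedding hi
  have hme : MeasurableEmbedding T := hce.measurableEmbedding
  set ν := Measure.comap T μ with hν
  have hν' : ∀ s, ν s = μ (T '' s) := fun s => hme.comap_apply μ s
  have : ν.IsAddLeftInvariant := by
    refine ⟨fun g => ?_⟩
    ext s hs
    rw [Measure.map_apply (measurable_const_add g) hs, hν', hν']
    have : T '' ((fun x => g + x) ⁻¹' s) = (fun x => T g + x) ⁻¹' (T '' s) := by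
      ext y
      constructor
      · rintro ⟨x, hx, rfl⟩
        exact ⟨g + x, hx, by simp⟩
      · rintro ⟨x, hx, hxy⟩
        refine ⟨x - g, by simpa using hx, ?_⟩
        rw [map_sub, hxy]; exact add_sub_cancel_left _ _
    rw [this, measure_preimage_add]
  have : IsFiniteMeasure ν := ⟨by rw [hν']; exact measure_lt_top _ _⟩
  have h1 := Measure.isAddInvariant_eq_smul_of_compactSpace ν μ
  set c := Measure.addHaarScalarFactor ν μ
  have h2 : (c : ℝ≥0∞) = μ (Set.range T) := by
    have : ν Set.univ = c • μ Set.univ := by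
      conv_lhs => rw [h1]
      rfl
    rw [hν', Set.image_univ, measure_univ] at this
    rw [this]; simp [ENNReal.smul_def]
  rw [← hme.map_comap, hme.lintegral_map, ← hν, h1, lintegral_smul_measure, ← h2]
  rfl

lemma lintegral_reps {E : Type*} [AddCommGroup E] [TopologicalSpace E] [IsTopologicalAddGroup E]
    [CompactSpace E] [T2Space E] [SecondCountableTopology E] [MeasurableSpace E] [BorelSpace E]
    (μ : Measure E) [μ.IsAddHaarMeasure]
    [IsProbabilityMeasure μ] (T : E →+ E) (hT : Continuous T) (hi : Function.Injective T)
    {ι : Type*} [Fintype ι] (b : ι → E) (hb : ∀ x, ∃ i, x - b i ∈ Set.range T)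
    (hu : ∀ i j, b i - b j ∈ Set.range T → i = j) :
    μ (Set.range T) = (Fintype.card ι : ℝ≥0∞)⁻¹ ∧
    (∀ G : E → ℝ≥0∞, ∫⁻ x in Set.range T, G x ∂μ =
      (Fintype.card ι : ℝ≥0∞)⁻¹ * ∫⁻ x, G (T x) ∂μ) ∧
    ∀ G : E → ℝ≥0∞, ∫⁻ x, G x ∂μ = ∑ i, (Fintype.card ι : ℝ≥0∞)⁻¹ * ∫⁻ x, G (b i + T x) ∂μ := by
  have hce : Topology.IsClosedEmbedding T := hT.isClosedEmbedding hi
  have hms : MeasurableSet (Set.range T) := hce.isClosed_range.measurableSet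
  set S : ι → Set E := fun i => {x | x - b i ∈ Set.range T}
  have hS : ∀ i, MeasurableSet (S i) := fun i =>
    (measurable_id.sub_const (b i)) hms
  have hd : Pairwise (Function.onFun Disjoint S) := by
    intro i j hij
    rw [Function.onFun, Set.disjoint_left]
    rintro x ⟨y, hy⟩ ⟨z, hz⟩
    exact hij (hu i j ⟨z - y, by rw [map_sub, hy, hz]; abel⟩)
  have key : ∀ G : E → ℝ≥0∞, ∫⁻ x, G x ∂μ = ∑ i, μ (Set.range T) * ∫⁻ x, G (b i + T x) ∂μ := by
    intro G
    have hU : (⋃ i, S i) = Set.univ := by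
      ext x; simpa [S] using hb x
    rw [← setLIntegral_univ, ← hU, lintegral_iUnion hS hd, tsum_fintype]
    refine Finset.sum_congr rfl fun i _ => ?_
    rw [← lintegral_range μ T hT hi (fun x => G (b i + x))]
    rw [← lintegral_indicator (hS i), ← lintegral_indicator hms]
    rw [← lintegral_add_left_eq_self _ (b i)]
    refine lintegral_congr fun x => ?_
    by_cases hx : x ∈ Set.range T <;> simp [Set.indicator, S, hx, -Set.mem_range]
  have h1 : μ (Set.range T) = (Fintype.card ι : ℝ≥0∞)⁻¹ := by
    have := key (fun _ => 1)
    simp at this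
    exact ENNReal.eq_inv_of_mul_eq_one_left (by rw [mul_comm]; exact this.symm)
  refine ⟨h1, fun G => by rw [lintegral_range μ T hT hi, h1], fun G => by rw [key, h1]⟩

lemma exists_rep (e : ℕ) (x : ℤ_[p]) : ∃ b : Fin (p ^ e), (p : ℤ_[p]) ^ e ∣ x - ((b : ℕ) : ℤ_[p]) := by
  refine ⟨⟨x.appr e, PadicInt.appr_lt x e⟩, ?_⟩
  have := PadicInt.appr_spec e x
  rwa [Ideal.mem_span_singleton] at this

lemma rep_unique (e : ℕ) (b c : Fin (p ^ e))
    (h : (p : ℤ_[p]) ^ e ∣ ((b : ℕ) : ℤ_[p]) - ((c : ℕ) : ℤ_[p])) : b = c := by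
  have h2 : ((p ^ e : ℕ) : ℤ) ∣ ((b : ℕ) : ℤ) - ((c : ℕ) : ℤ) := by
    have := (PadicInt.pow_p_dvd_int_iff (p := p) e (((b : ℕ) : ℤ) - ((c : ℕ) : ℤ))).1 (by push_cast; exact h)
    push_cast; exact this
  have h3 : (c : ℕ) ≡ b [MOD p ^ e] := (Nat.modEq_iff_dvd).2 h2
  have := Nat.ModEq.eq_of_lt_of_lt h3 c.2 b.2
  exact Fin.ext this.symm

/-- diagonal scaling -/
noncomputable def dl (k : Fin n → ℕ) (x : Fin n → ℤ_[p]) : Fin n → ℤ_[p] := fun i => (p : ℤ_[p]) ^ k i * x i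

lemma dl_inj (k : Fin n → ℕ) : Function.Injective (dl (p := p) k) := by
  intro x y h
  ext1 i
  have := congrFun h i
  exact mul_left_cancel₀ (p_pow_ne_zero _) this

lemma dl_cont (k : Fin n → ℕ) : Continuous (dl (p := p) k) := by
  unfold dl; fun_prop

lemma mem_range_dl (k : Fin n → ℕ) (x : Fin n → ℤ_[p]) :
    x ∈ Set.range (dl (p := p) k) ↔ ∀ i, (p : ℤ_[p]) ^ k i ∣ x i := by
  constructor
  · rintro ⟨y, rfl⟩ i
    exact ⟨y i, rfl⟩
  · intro h
    choose y hy using h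
    exact ⟨y, by ext1 i; exact (hy i).symm⟩

/-- integer representative point -/
noncomputable def rp {k : Fin n → ℕ} (b : ∀ i, Fin (p ^ k i)) : Fin n → ℤ_[p] := fun i => ((b i : ℕ) : ℤ_[p])

lemma lint_dl (k : Fin n → ℕ) :
    (∀ G : (Fin n → ℤ_[p]) → ℝ≥0∞, ∫⁻ x in Set.range (dl (p := p) k), G x =
      ((p ^ (∑ i, k i) : ℕ) : ℝ≥0∞)⁻¹ * ∫⁻ x, G (dl k x)) ∧
    ∀ G : (Fin n → ℤ_[p]) → ℝ≥0∞, ∫⁻ x, G x =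
      ∑ b : (∀ i, Fin (p ^ k i)), ((p ^ (∑ i, k i) : ℕ) : ℝ≥0∞)⁻¹ * ∫⁻ x, G (rp b + dl k x) := by
  have h := lintegral_reps (volume : Measure (Fin n → ℤ_[p]))
    (T := { toFun := dl k, map_zero' := by ext; simp [dl], map_add' := by intro x y; ext; simp [dl, mul_add] })
    (dl_cont k) (dl_inj k) (b := fun b : (∀ i, Fin (p ^ k i)) => rp b)
    (by
      intro x
      choose b hb using fun i => exists_rep (k i) (x i)
      exact ⟨b, (mem_range_dl k _).2 hb⟩)
    (by
      intro b c hbc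
      have := (mem_range_dl k _).1 hbc
      ext1 i
      exact rep_unique _ _ _ (this i))
  have hc : Fintype.card (∀ i, Fin (p ^ k i)) = p ^ (∑ i, k i) := by
    simp [Fintype.card_pi, Finset.prod_pow_eq_pow_sum]
  rw [hc] at h
  exact ⟨h.2.1, h.2.2⟩

lemma enorm_eq (x : ℤ_[p]) (hx : x ≠ 0) : ‖x‖ₑ = ((p ^ x.valuation : ℕ) : ℝ≥0∞)⁻¹ := by
  rw [← ofReal_norm, PadicInt.norm_eq_zpow_neg_valuation hx, zpow_neg, ENNReal.ofReal_inv_of_pos]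
  · congr 1
    rw [zpow_natCast, ← Nat.cast_pow, ENNReal.ofReal_natCast]
  · have := hp.out.pos; positivity

lemma pval_assoc (x : ℤ_[p]) (hx : x ≠ 0) :
    ∃ u : ℤ_[p]ˣ, (p : ℤ_[p]) ^ x.valuation = x * u := by
  refine ⟨(PadicInt.unitCoeff hx)⁻¹, ?_⟩
  have := PadicInt.unitCoeff_spec hx
  rw [Units.eq_mul_inv_iff_mul_eq, mul_comm]
  exact this.symm

lemma lint_one (e : ℕ) (G : ℤ_[p] → ℝ≥0∞) :
  ∫⁻ s, G s = ∑ b : Fin (p ^ e), ((p ^ e : ℕ) : ℝ≥0∞)⁻¹ * ∫⁻ s, G (((b : ℕ) : ℤ_[p]) + (p : ℤ_[p]) ^ e * s) := by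
  have h := lintegral_reps (volume : Measure ℤ_[p]) (T := AddMonoidHom.mulLeft ((p : ℤ_[p]) ^ e))
    (by simp only [AddMonoidHom.coe_mulLeft]; fun_prop) (mul_right_injective₀ (p_pow_ne_zero _))
    (b := fun b : Fin (p ^ e) => ((b : ℕ) : ℤ_[p]))
    (by
      intro y
      obtain ⟨b, hb⟩ := exists_rep e y
      exact ⟨b, by obtain ⟨z, hz⟩ := hb; exact ⟨z, hz.symm⟩⟩)
    (by
      intro b c ⟨z, hz⟩
      exact rep_unique _ _ _ ⟨z, hz.symm⟩)
  rw [Fintype.card_fin] at h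
  exact h.2.2 G

lemma vol_range_mul (x : ℤ_[p]) (hx : x ≠ 0) :
    volume (Set.range (fun s => x * s)) = ‖x‖ₑ := by
  have h := lintegral_reps (volume : Measure ℤ_[p]) (T := AddMonoidHom.mulLeft x)
    (by simp only [AddMonoidHom.coe_mulLeft]; fun_prop) (mul_right_injective₀ hx)
    (b := fun b : Fin (p ^ x.valuation) => ((b : ℕ) : ℤ_[p]))
    (by
      intro y
      obtain ⟨b, hb⟩ := exists_rep x.valuation y
      refine ⟨b, ?_⟩
      obtain ⟨z, hz⟩ := hb
      obtain ⟨u, hu⟩ := pval_assoc x hx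
      refine ⟨u * z, ?_⟩
      simp only [AddMonoidHom.coe_mulLeft]
      rw [hz, hu, mul_assoc])
    (by
      intro b c ⟨z, hz⟩
      refine rep_unique _ _ _ (Dvd.dvd.trans ?_ ⟨z, hz.symm⟩)
      obtain ⟨u, hu⟩ := pval_assoc x hx
      rw [hu]
      exact (Units.mul_right_dvd).2 dvd_rfl)
  rw [Fintype.card_fin] at h
  rw [enorm_eq x hx, ← h.1]
  rfl

lemma mem_range_mul (x s : ℤ_[p]) : s ∈ Set.range (fun s => x * s) ↔ ‖s‖ ≤ ‖x‖ := by
  constructor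
  · rintro ⟨y, rfl⟩
    simp only [norm_mul]
    exact mul_le_of_le_one_right (norm_nonneg _) (PadicInt.norm_le_one _)
  · intro h
    by_cases hx : x = 0
    · subst hx
      have : s = 0 := by simpa using h
      exact ⟨0, by simp [this]⟩
    · by_cases hs : s = 0
      · exact ⟨0, by simp [hs]⟩
      have hv : x.valuation ≤ s.valuation := by
        rw [PadicInt.norm_eq_zpow_neg_valuation hx, PadicInt.norm_eq_zpow_neg_valuation hs] at h
        have h1 : (1 : ℝ) < p := by exact_mod_cast hp.out.one_lt
        have := (zpow_le_zpow_iff_right₀ h1).1 h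
        omega
      obtain ⟨u, hu⟩ := pval_assoc x hx
      obtain ⟨w, hw⟩ := pval_assoc s hs
      have : s = x * u * (p : ℤ_[p]) ^ (s.valuation - x.valuation) * (w⁻¹ : ℤ_[p]ˣ) := by
        rw [← hu, ← pow_add, Nat.add_sub_cancel' hv, hw, Units.mul_inv_cancel_right]
      exact ⟨u * (p : ℤ_[p]) ^ (s.valuation - x.valuation) * (w⁻¹ : ℤ_[p]ˣ), by
        simp only; rw [← mul_assoc, ← mul_assoc]; exact this.symm⟩

instance instNoAtoms : NullSingletonClass (volume : Measure ℤ_[p]) := by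
  refine ⟨fun x => ?_⟩
  have h0 : volume ({0} : Set ℤ_[p]) = 0 := by
    have : ∀ k : ℕ, volume ({0} : Set ℤ_[p]) ≤ ((p : ℝ≥0∞)⁻¹) ^ k := by
      intro k
      have h1 := vol_range_mul ((p : ℤ_[p]) ^ k) (p_pow_ne_zero _)
      have h2 : ‖(p : ℤ_[p]) ^ k‖ₑ = ((p : ℝ≥0∞)⁻¹) ^ k := by
        rw [enorm_eq _ (p_pow_ne_zero _)]
        simp [ENNReal.inv_pow]
      rw [← h2, ← h1]
      apply measure_mono
      rintro _ rfl
      exact ⟨0, by simp⟩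
    refine le_antisymm ?_ zero_le
    refine ge_of_tendsto (ENNReal.tendsto_pow_atTop_nhds_zero_of_lt_one ?_) (Eventually.of_forall this)
    rw [ENNReal.inv_lt_one]
    exact_mod_cast hp.out.one_lt
  have := measure_preimage_add (volume : Measure ℤ_[p]) (-x) {0}
  rw [h0] at this
  rw [← this]
  congr 1
  ext y
  simp only [Set.mem_preimage, Set.mem_singleton_iff, neg_add_eq_zero, eq_comm]

lemma lint_mul (x : ℤ_[p]) (G : ℤ_[p] → ℝ≥0∞) :
    ∫⁻ s in {s | ‖s‖ ≤ ‖x‖}, G s = ‖x‖ₑ * ∫⁻ s, G (x * s) := by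
  by_cases hx : x = 0
  · subst hx
    have : {s : ℤ_[p] | ‖s‖ ≤ ‖(0 : ℤ_[p])‖} = {0} := by ext; simp
    rw [this]
    simp
  · rw [← vol_range_mul x hx]
    have := lintegral_range (volume : Measure ℤ_[p]) (AddMonoidHom.mulLeft x)
      (by simp only [AddMonoidHom.coe_mulLeft]; fun_prop) (mul_right_injective₀ hx) G
    have h2 : {s | ‖s‖ ≤ ‖x‖} = Set.range (fun s => x * s) := by
      ext s; rw [mem_range_mul]; rfl
    rw [h2]
    exact this

lemma fubini (l : Fin (n+1)) (H : (Fin (n+1) → ℤ_[p]) → ℝ≥0∞) (hH : Measurable H) :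
    ∫⁻ z, H z = ∫⁻ x : Fin n → ℤ_[p], ∫⁻ s : ℤ_[p], H (l.insertNth s x) := by
  have h := (volume_preserving_piFinSuccAbove (fun _ : Fin (n+1) => ℤ_[p]) l).symm
  rw [← h.lintegral_comp hH]
  rw [Measure.volume_eq_prod, lintegral_prod_symm]
  · rfl
  · exact (hH.comp h.measurable).aemeasurable

/-- continuous additive automorphisms preserve integrals -/
lemma lint_auto (T : (Fin n → ℤ_[p]) ≃+ (Fin n → ℤ_[p])) (hT : Continuous T)
    (G : (Fin n → ℤ_[p]) → ℝ≥0∞) : ∫⁻ x, G (T x) = ∫⁻ x, G x := by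
  have := lintegral_range (volume : Measure (Fin n → ℤ_[p])) T.toAddMonoidHom hT T.injective G
  have h2 : Set.range (T.toAddMonoidHom) = Set.univ := T.surjective.range_eq
  rw [h2, setLIntegral_univ, measure_univ, one_mul] at this
  exact this.symm

end PR

namespace PR
variable {p : ℕ} [hp : Fact p.Prime] {n : ℕ}

/-- units -/
def UU (p : ℕ) [Fact p.Prime] : Set ℤ_[p] := {s | ‖s‖ = 1}

lemma meas_UU : MeasurableSet (UU p) :=
  (isClosed_eq continuous_norm continuous_const).measurableSet

lemma unit_inv_full (c : ℤ_[p]) (hc : ‖c‖ = 1) (H : ℤ_[p] → ℝ≥0∞) :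
    ∫⁻ s, H (c * s) = ∫⁻ s, H s := by
  have h := lint_mul c H
  have h2 : {s : ℤ_[p] | ‖s‖ ≤ ‖c‖} = Set.univ := by
    ext s; simp [hc, PadicInt.norm_le_one]
  have h3 : ‖c‖ₑ = 1 := by rw [← ofReal_norm, hc]; simp
  rw [h2, setLIntegral_univ, h3, one_mul] at h
  exact h.symm

lemma unit_inv (c : ℤ_[p]) (hc : ‖c‖ = 1) (H : ℤ_[p] → ℝ≥0∞) :
    ∫⁻ s in UU p, H (c * s) = ∫⁻ s in UU p, H s := by
  rw [← lintegral_indicator meas_UU, ← lintegral_indicator meas_UU]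
  rw [← unit_inv_full c hc ((UU p).indicator H)]
  refine lintegral_congr fun s => ?_
  have : c * s ∈ UU p ↔ s ∈ UU p := by simp [UU, hc]
  by_cases h : s ∈ UU p
  · rw [Set.indicator_of_mem h, Set.indicator_of_mem (this.2 h)]
  · rw [Set.indicator_of_notMem h, Set.indicator_of_notMem (fun h' => h (this.1 h'))]

lemma enorm_p_pow (k : ℕ) : ‖(p : ℤ_[p]) ^ k‖ₑ = ((p ^ k : ℕ) : ℝ≥0∞)⁻¹ := by
  rw [enorm_eq _ (p_pow_ne_zero _)]
  simp

lemma norm_p_pow' (k : ℕ) : ‖(p : ℤ_[p]) ^ k‖ = (p : ℝ) ^ (-k : ℤ) := by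
  simp

lemma shell (G : ℤ_[p] → ℝ≥0∞) :
    ∫⁻ s, G s = ∑' k : ℕ, ‖(p : ℤ_[p]) ^ k‖ₑ * ∫⁻ s in UU p, G ((p : ℤ_[p]) ^ k * s) := by
  set S : ℕ → Set ℤ_[p] := fun k => {s | ‖s‖ = ‖(p : ℤ_[p]) ^ k‖} with hS
  have hm : ∀ k, MeasurableSet (S k) := fun k =>
    (isClosed_eq continuous_norm continuous_const).measurableSet
  have h1 : (1 : ℝ) < p := by exact_mod_cast hp.out.one_lt
  have hd : Pairwise (Function.onFun Disjoint S) := by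
    intro i j hij
    rw [Function.onFun, Set.disjoint_left]
    intro x hx hy
    simp only [hS, Set.mem_ofPred_eq] at hx hy
    rw [hx, norm_p_pow', norm_p_pow'] at hy
    have := zpow_right_injective₀ (by linarith) (ne_of_gt h1) hy
    exact hij (by simpa using this)
  have hU : (⋃ k, S k) = {0}ᶜ := by
    ext x
    simp only [hS, Set.mem_iUnion, Set.mem_ofPred_eq, Set.mem_compl_iff, Set.mem_singleton_iff]
    constructor
    · rintro ⟨k, hk⟩ rfl
      rw [norm_zero] at hk
      exact p_pow_ne_zero k (norm_eq_zero.1 hk.symm)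
    · intro hx
      exact ⟨x.valuation, by rw [norm_p_pow', PadicInt.norm_eq_zpow_neg_valuation hx]⟩
  have h0 : ∫⁻ s, G s = ∫⁻ s in {0}ᶜ, G s := by
    rw [restrict_compl_singleton]
  rw [h0, ← hU, lintegral_iUnion hm hd]
  refine tsum_congr fun k => ?_
  have h2 := lint_mul ((p : ℤ_[p]) ^ k) ((S k).indicator G)
  rw [← lintegral_indicator meas_UU]
  have h3 : ∀ s, (S k).indicator G ((p : ℤ_[p]) ^ k * s) =
      (UU p).indicator (fun s => G ((p : ℤ_[p]) ^ k * s)) s := by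
    intro s
    have : ((p : ℤ_[p]) ^ k * s) ∈ S k ↔ s ∈ UU p := by
      simp only [hS, UU, Set.mem_ofPred_eq]
      rw [norm_mul, mul_eq_left₀ (norm_ne_zero_iff.2 (p_pow_ne_zero _))]
    by_cases h : s ∈ UU p
    · rw [Set.indicator_of_mem h, Set.indicator_of_mem (this.2 h)]
    · rw [Set.indicator_of_notMem h, Set.indicator_of_notMem (fun h' => h (this.1 h'))]
  simp_rw [h3] at h2
  rw [← h2, ← lintegral_indicator (hm k)]
  have hms : MeasurableSet {s : ℤ_[p] | ‖s‖ ≤ ‖(p : ℤ_[p]) ^ k‖} :=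
    (isClosed_le continuous_norm continuous_const).measurableSet
  rw [← lintegral_indicator hms]
  refine lintegral_congr fun s => ?_
  by_cases hs : s ∈ S k
  · have : s ∈ {s : ℤ_[p] | ‖s‖ ≤ ‖(p : ℤ_[p]) ^ k‖} := le_of_eq hs
    rw [Set.indicator_of_mem this]
  · rw [Set.indicator_of_notMem hs]
    by_cases h : s ∈ {s : ℤ_[p] | ‖s‖ ≤ ‖(p : ℤ_[p]) ^ k‖}
    · rw [Set.indicator_of_mem h, Set.indicator_of_notMem hs]
    · rw [Set.indicator_of_notMem h]

lemma norm_one_add (y : ℤ_[p]) (hy : ‖y‖ < 1) : ‖1 + y‖ = 1 := by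
  rw [PadicInt.norm_add_eq_max_of_ne]
  · rw [norm_one]; exact max_eq_left hy.le
  · rw [norm_one]; exact hy.ne'

lemma norm_p_mul_lt (z : ℤ_[p]) : ‖(p : ℤ_[p]) * z‖ < 1 := by
  rw [norm_mul, PadicInt.norm_p]
  exact lt_of_le_of_lt (mul_le_of_le_one_right (by positivity) (PadicInt.norm_le_one _)) pinv_lt_one

lemma exists_root (N : ℕ) (hN : 0 < N) : ∃ M : ℕ, 0 < M ∧ ∀ z : ℤ_[p], ∃ η : ℤ_[p], ‖η‖ = 1 ∧
    η ^ N = 1 + (p : ℤ_[p]) ^ M * z := by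
  have hN0 : ((N : ℕ) : ℤ_[p]) ≠ 0 := by exact_mod_cast hN.ne'
  have hpos : 0 < ‖(N : ℤ_[p])‖ ^ 2 := by positivity
  obtain ⟨M, hM⟩ := exists_pow_lt_of_lt_one hpos (pinv_lt_one (p := p))
  refine ⟨M + 1, Nat.succ_pos _, fun z => ?_⟩
  have hn : ‖(p : ℤ_[p]) ^ (M + 1) * z‖ < ‖(N : ℤ_[p])‖ ^ 2 := by
    refine lt_of_le_of_lt ?_ hM
    rw [norm_mul, norm_pow, PadicInt.norm_p]
    calc _ ≤ ((p : ℝ)⁻¹) ^ (M + 1) * 1 := by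
            gcongr; exact PadicInt.norm_le_one _
      _ ≤ _ := by
        rw [mul_one]
        exact pow_le_pow_of_le_one (by positivity) pinv_lt_one.le (Nat.le_succ _)
  obtain ⟨η, h1, -⟩ := hensels_lemma (p := p)
    (F := (Polynomial.X ^ N - Polynomial.C (1 + (p : ℤ_[p]) ^ (M + 1) * z) : Polynomial ℤ_[p])) (a := 1)
    (by
      have e1 : Polynomial.aeval (1 : ℤ_[p]) (Polynomial.X ^ N - Polynomial.C (1 + (p : ℤ_[p]) ^ (M + 1) * z) : Polynomial ℤ_[p]) = -((p : ℤ_[p]) ^ (M + 1) * z) := by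
        rw [map_sub, map_pow, Polynomial.aeval_X, Polynomial.aeval_C]
        simp only [one_pow, Algebra.algebraMap_self, RingHom.id_apply]
        ring
      have e2 : Polynomial.aeval (1 : ℤ_[p]) (Polynomial.derivative (Polynomial.X ^ N - Polynomial.C (1 + (p : ℤ_[p]) ^ (M + 1) * z) : Polynomial ℤ_[p])) = N := by
        rw [Polynomial.derivative_sub, Polynomial.derivative_C, Polynomial.derivative_X_pow]
        simp
      rw [e1, e2, norm_neg]
      exact hn)
  have h2 : η ^ N = 1 + (p : ℤ_[p]) ^ (M + 1) * z := by
    simpa [sub_eq_zero] using h1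
  refine ⟨η, ?_, h2⟩
  have h3 : ‖η‖ ^ N = 1 := by
    rw [← norm_pow, h2]
    refine norm_one_add _ ?_
    rw [pow_succ', mul_assoc]
    exact norm_p_mul_lt _
  exact (pow_eq_one_iff_of_nonneg (norm_nonneg _) hN.ne').1 h3

lemma lint_UU (M : ℕ) (hM : 0 < M) (K : ℤ_[p] → ℝ≥0∞) :
    ∫⁻ v in UU p, K v = ∑ u ∈ Finset.univ.filter (fun u : Fin (p ^ M) => ‖((u : ℕ) : ℤ_[p])‖ = 1),
      ((p ^ M : ℕ) : ℝ≥0∞)⁻¹ * ∫⁻ z, K (((u : ℕ) : ℤ_[p]) * (1 + (p : ℤ_[p]) ^ M * z)) := by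
  classical
  rw [← lintegral_indicator meas_UU, lint_one M, Finset.sum_filter]
  refine Finset.sum_congr rfl fun u _ => ?_
  obtain ⟨M', rfl⟩ : ∃ M', M = M' + 1 := ⟨M - 1, by omega⟩
  split_ifs with hu
  · congr 1
    rw [← unit_inv_full _ hu]
    refine lintegral_congr fun s => ?_
    have e1 : (((u : ℕ) : ℤ_[p]) + (p : ℤ_[p]) ^ (M' + 1) * (((u : ℕ) : ℤ_[p]) * s)) =
      ((u : ℕ) : ℤ_[p]) * (1 + (p : ℤ_[p]) ^ (M' + 1) * s) := by ring
    rw [e1, Set.indicator_of_mem]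
    simp only [UU, Set.mem_ofPred_eq]
    rw [norm_mul, hu, one_mul]
    refine norm_one_add _ ?_
    rw [pow_succ', mul_assoc]
    exact norm_p_mul_lt _
  · have : ∀ s, (UU p).indicator K (((u : ℕ) : ℤ_[p]) + (p : ℤ_[p]) ^ (M' + 1) * s) = 0 := by
      intro s
      rw [Set.indicator_of_notMem]
      simp only [UU, Set.mem_ofPred_eq]
      intro h
      have hu' : ‖((u : ℕ) : ℤ_[p])‖ < 1 := lt_of_le_of_ne (PadicInt.norm_le_one _) hu
      have h2 : ‖(p : ℤ_[p]) ^ (M' + 1) * s‖ < 1 := by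
        rw [pow_succ', mul_assoc]
        exact norm_p_mul_lt _
      exact absurd h (ne_of_lt (lt_of_le_of_lt (PadicInt.nonarchimedean _ _) (max_lt hu' h2)))
    simp_rw [this]
    simp

lemma pow_avg (N : ℕ) (hN : 0 < N) : ∃ S : Finset ℤ_[p], 0 < S.card ∧ (∀ u ∈ S, ‖u‖ = 1) ∧
    ∀ H : ℤ_[p] → ℝ≥0∞, Measurable H →
      ∫⁻ v in UU p, H v = (S.card : ℝ≥0∞)⁻¹ * ∑ u ∈ S, ∫⁻ w in UU p, H (u * w ^ N) := by
  classical
  obtain ⟨M, hM, hroot⟩ := exists_root (p := p) N hN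
  have hinj : Function.Injective (fun u : Fin (p ^ M) => ((u : ℕ) : ℤ_[p])) := by
    intro a b h
    exact Fin.ext (Nat.cast_injective (R := ℤ_[p]) h)
  set S0 := Finset.univ.filter (fun u : Fin (p ^ M) => ‖((u : ℕ) : ℤ_[p])‖ = 1)
  set S := S0.image (fun u : Fin (p ^ M) => ((u : ℕ) : ℤ_[p])) with hS
  have hUU : ∀ K : ℤ_[p] → ℝ≥0∞, ∫⁻ v in UU p, K v = ∑ u ∈ S,
      ((p ^ M : ℕ) : ℝ≥0∞)⁻¹ * ∫⁻ z, K (u * (1 + (p : ℤ_[p]) ^ M * z)) := by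
    intro K
    rw [lint_UU M hM, hS, Finset.sum_image (fun a _ b _ h => hinj h)]
  have hvol : volume (UU p) = S.card * ((p ^ M : ℕ) : ℝ≥0∞)⁻¹ := by
    have := hUU (fun _ => 1)
    simpa using this
  have hp0 : ((p ^ M : ℕ) : ℝ≥0∞) ≠ 0 := by exact_mod_cast (pow_pos hp.out.pos M).ne'
  have hpt : ((p ^ M : ℕ) : ℝ≥0∞) ≠ ⊤ := ENNReal.natCast_ne_top _
  have hSn : ∀ u ∈ S, ‖u‖ = 1 := by
    intro u hu
    rw [hS, Finset.mem_image] at hu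
    obtain ⟨a, ha, rfl⟩ := hu
    exact (Finset.mem_filter.1 ha).2
  have hSc : 0 < S.card := by
    rw [Finset.card_pos]
    refine ⟨1, ?_⟩
    rw [hS, Finset.mem_image]
    refine ⟨⟨1, Nat.one_lt_pow hM.ne' hp.out.one_lt⟩, ?_, by simp⟩
    simp [S0]
  refine ⟨S, hSc, hSn, fun H hH => ?_⟩
  have h1 : ∫⁻ v in UU p, ∫⁻ w in UU p, H (v * w ^ N) = 
      ∑ u ∈ S, ((p ^ M : ℕ) : ℝ≥0∞)⁻¹ * ∫⁻ w in UU p, H (u * w ^ N) := by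
    rw [hUU]
    refine Finset.sum_congr rfl fun u _ => ?_
    congr 1
    have : ∀ z, ∫⁻ w in UU p, H (u * (1 + (p : ℤ_[p]) ^ M * z) * w ^ N) =
        ∫⁻ w in UU p, H (u * w ^ N) := by
      intro z
      obtain ⟨η, hη, hz⟩ := hroot z
      rw [← hz, ← unit_inv η hη (fun w => H (u * w ^ N))]
      simp only [mul_pow, mul_assoc]
    simp_rw [this]
    simp
  have h2 : ∫⁻ v in UU p, ∫⁻ w in UU p, H (v * w ^ N) = volume (UU p) * ∫⁻ v in UU p, H v := by
    rw [lintegral_lintegral_swap]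
    · have : ∀ w ∈ UU p, ∫⁻ v in UU p, H (v * w ^ N) = ∫⁻ v in UU p, H v := by
        intro w hw
        rw [← unit_inv (w ^ N) (by rw [norm_pow, hw, one_pow]) H]
        simp only [mul_comm]
      rw [setLIntegral_congr_fun meas_UU this]
      simp [mul_comm]
    · apply Measurable.aemeasurable
      apply hH.comp
      fun_prop
  rw [h1, hvol, ← Finset.mul_sum, mul_comm (S.card : ℝ≥0∞), mul_assoc] at h2
  have h3 := (ENNReal.mul_right_inj (ENNReal.inv_ne_zero.2 hpt) (ENNReal.inv_ne_top.2 hp0)).1 h2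
  rw [h3, ← mul_assoc, ENNReal.inv_mul_cancel, one_mul]
  · exact_mod_cast hSc.ne'
  · exact ENNReal.natCast_ne_top _

lemma pow_cover (N : ℕ) (hN : 0 < N) : ∃ (c : ℕ) (A : List ℤ_[p]), 0 < c ∧ (∀ a ∈ A, a ≠ 0) ∧
    ∀ G : ℤ_[p] → ℝ≥0∞, Measurable G →
      ∫⁻ s, G s = (A.map fun a => (c : ℝ≥0∞)⁻¹ * ∫⁻ y, G (a * y ^ N) * ‖a * y ^ (N - 1)‖ₑ).sum := by
  classical
  obtain ⟨S, hc, hS, h⟩ := pow_avg (p := p) N hN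
  have : NeZero N := ⟨hN.ne'⟩
  refine ⟨S.card, (Finset.univ ×ˢ S : Finset (Fin N × ℤ_[p])).toList.map
    (fun q => (p : ℤ_[p]) ^ (q.1 : ℕ) * q.2), hc, ?_, fun G hG => ?_⟩
  · intro a ha
    simp only [List.mem_map, Finset.mem_toList, Finset.mem_product] at ha
    obtain ⟨q, hq, rfl⟩ := ha
    refine mul_ne_zero (p_pow_ne_zero _) ?_
    rw [← norm_ne_zero_iff, hS _ hq.2]
    exact one_ne_zero
  · rw [List.map_map, Finset.sum_map_toList, Finset.sum_product_right]
    simp only [Function.comp_apply]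
    have e1 : ∀ u ∈ S, ∀ r : Fin N, ∫⁻ y, G ((p : ℤ_[p]) ^ (r : ℕ) * u * y ^ N) *
        ‖(p : ℤ_[p]) ^ (r : ℕ) * u * y ^ (N - 1)‖ₑ =
        ∑' q : ℕ, ‖(p : ℤ_[p]) ^ (q * N + r)‖ₑ *
          ∫⁻ w in UU p, G ((p : ℤ_[p]) ^ (q * N + r) * (u * w ^ N)) := by
      intro u hu r
      rw [shell]
      refine tsum_congr fun q => ?_
      have e2 : ∀ w ∈ UU p, G ((p : ℤ_[p]) ^ (r : ℕ) * u * ((p : ℤ_[p]) ^ q * w) ^ N) *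
          ‖(p : ℤ_[p]) ^ (r : ℕ) * u * ((p : ℤ_[p]) ^ q * w) ^ (N - 1)‖ₑ =
          ‖(p : ℤ_[p]) ^ (r + q * (N - 1))‖ₑ *
            G ((p : ℤ_[p]) ^ (q * N + r) * (u * w ^ N)) := by
        intro w hw
        rw [mul_comm]
        congr 1
        · rw [← ofReal_norm, ← ofReal_norm]
          congr 1
          have hw' : ‖w‖ = 1 := hw
          rw [norm_mul, norm_mul, norm_pow _ (N - 1), norm_mul, hw', hS u hu, mul_one, mul_one,
            ← norm_pow, ← norm_mul, ← pow_mul, ← pow_add]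
        · congr 1; ring
      rw [setLIntegral_congr_fun meas_UU e2, lintegral_const_mul, ← mul_assoc]
      · congr 1
        rw [← enorm_mul, ← pow_add]
        congr 2
        obtain ⟨N', rfl⟩ : ∃ N', N = N' + 1 := ⟨N - 1, by omega⟩
        simp only [Nat.add_sub_cancel]
        ring
      · apply hG.comp; fun_prop
    have e3 : ∀ u ∈ S, ∑ r : Fin N, (S.card : ℝ≥0∞)⁻¹ * ∫⁻ y, G ((p : ℤ_[p]) ^ (r : ℕ) * u * y ^ N) *
        ‖(p : ℤ_[p]) ^ (r : ℕ) * u * y ^ (N - 1)‖ₑ = (S.card : ℝ≥0∞)⁻¹ *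
        ∑' k : ℕ, ‖(p : ℤ_[p]) ^ k‖ₑ * ∫⁻ w in UU p, G ((p : ℤ_[p]) ^ k * (u * w ^ N)) := by
      intro u hu
      rw [← Finset.mul_sum]
      congr 1
      rw [Finset.sum_congr rfl fun r _ => e1 u hu r]
      rw [← (Nat.divModEquiv N).symm.tsum_eq, ENNReal.tsum_prod', ENNReal.tsum_comm, tsum_fintype]
      refine Finset.sum_congr rfl fun r _ => tsum_congr fun q => ?_
      simp [Nat.divModEquiv]
    rw [Finset.sum_congr rfl e3, ← Finset.mul_sum, ← Summable.tsum_finsetSum (fun _ _ => ENNReal.summable), shell,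
      ← ENNReal.tsum_mul_left]
    refine tsum_congr fun k => ?_
    rw [← Finset.mul_sum, h (fun v => G ((p : ℤ_[p]) ^ k * v)) (by fun_prop), mul_left_comm]

end PR

namespace PR
variable {p : ℕ} [hp : Fact p.Prime] {n : ℕ}

/-- positive rational weights -/
def RatW (w : ℝ≥0∞) : Prop := ∃ a b : ℕ, 0 < b ∧ w = a / b

lemma RatW.mul {v w : ℝ≥0∞} (hv : RatW v) (hw : RatW w) : RatW (v * w) := by
  obtain ⟨a, b, hb, rfl⟩ := hv
  obtain ⟨c, d, hd, rfl⟩ := hw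
  refine ⟨a * c, b * d, Nat.mul_pos hb hd, ?_⟩
  push_cast
  rw [div_eq_mul_inv, div_eq_mul_inv, div_eq_mul_inv,
    ENNReal.mul_inv (Or.inr (ENNReal.natCast_ne_top _)) (Or.inl (ENNReal.natCast_ne_top _))]
  ring

lemma RatW.nat (a : ℕ) : RatW a := ⟨a, 1, one_pos, by simp⟩
lemma RatW.one : RatW 1 := by simpa using RatW.nat 1
lemma RatW.inv {a : ℕ} (ha : 0 < a) : RatW (a : ℝ≥0∞)⁻¹ := ⟨1, a, ha, by simp⟩
lemma RatW.ne_top {w : ℝ≥0∞} (hw : RatW w) : w ≠ ⊤ := by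
  obtain ⟨a, b, hb, rfl⟩ := hw
  exact ENNReal.div_ne_top (ENNReal.natCast_ne_top _) (by exact_mod_cast hb.ne')

structure Leaf (p : ℕ) [Fact p.Prime] (n : ℕ) where
  w : ℝ≥0∞
  π : (Fin n → ℤ_[p]) → (Fin n → ℤ_[p])
  J : (Fin n → ℤ_[p]) → ℤ_[p]
  hw : RatW w
  hπ : ∀ i, Tate p n (fun x => π x i)
  hJ : Tate p n J

noncomputable def Leaf.int (l : Leaf p n) (G : (Fin n → ℤ_[p]) → ℝ≥0∞) : ℝ≥0∞ :=
  l.w * ∫⁻ x, G (l.π x) * ‖l.J x‖ₑ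

lemma Leaf.meas (l : Leaf p n) : Measurable l.π :=
  (continuous_pi fun i => (l.hπ i).continuous).measurable

lemma Leaf.measJ (l : Leaf p n) : Measurable (fun x => ‖l.J x‖ₑ) :=
  (l.hJ.continuous.enorm).measurable

noncomputable def Leaf.comp (l k : Leaf p n) : Leaf p n where
  w := l.w * k.w
  π := fun x => l.π (k.π x)
  J := fun x => l.J (k.π x) * k.J x
  hw := l.hw.mul k.hw
  hπ := fun i => (l.hπ i).comp k.hπ
  hJ := (l.hJ.comp k.hπ).mul k.hJ

def IsCover (C : List (Leaf p n)) : Prop :=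
  ∀ G : (Fin n → ℤ_[p]) → ℝ≥0∞, Measurable G → ∫⁻ x, G x = (C.map fun l => l.int G).sum

lemma sum_flatMap {α β : Type*} (C : List α) (D : α → List β) (F : β → ℝ≥0∞) :
    ((C.flatMap D).map F).sum = (C.map fun l => ((D l).map F).sum).sum := by
  induction C with
  | nil => simp
  | cons a C ih => simp [ih]

lemma list_sum_mul_left {α : Type*} (C : List α) (F : α → ℝ≥0∞) (c : ℝ≥0∞) :
    (C.map fun l => c * F l).sum = c * (C.map F).sum := by
  induction C with
  | nil => simp
  | cons a C ih => simp [ih, mul_add]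

lemma Leaf.int_comp (l k : Leaf p n) (G : (Fin n → ℤ_[p]) → ℝ≥0∞) :
    (l.comp k).int G = l.w * k.int (fun x => G (l.π x) * ‖l.J x‖ₑ) := by
  simp only [Leaf.int, Leaf.comp, enorm_mul, mul_assoc]

lemma IsCover.comp {C : List (Leaf p n)} (hC : IsCover C) {D : Leaf p n → List (Leaf p n)}
    (hD : ∀ l ∈ C, IsCover (D l)) : IsCover (C.flatMap fun l => (D l).map l.comp) := by
  intro G hG
  rw [hC G hG, sum_flatMap]
  congr 1
  refine List.map_congr_left fun l hl => ?_
  rw [List.map_map]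
  simp only [Function.comp_def, Leaf.int_comp]
  rw [list_sum_mul_left, ← hD l hl]
  · rfl
  · exact (hG.comp l.meas).mul l.measJ

noncomputable def Leaf.one : Leaf p n where
  w := 1
  π := fun x => x
  J := fun _ => 1
  hw := RatW.one
  hπ := fun i => Tate.coord i
  hJ := Tate.const 1

lemma cover_one : IsCover [(Leaf.one : Leaf p n)] := by
  intro G hG
  simp [Leaf.int, Leaf.one]

/-- level leaf -/
noncomputable def lev (k : Fin n → ℕ) (b : ∀ i, Fin (p ^ k i)) : Leaf p n where
  w := ((p ^ (∑ i, k i) : ℕ) : ℝ≥0∞)⁻¹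
  π := fun x => rp b + dl k x
  J := fun _ => 1
  hw := RatW.inv (pow_pos hp.out.pos _)
  hπ := fun i => (Tate.const _).add ((Tate.const _).mul (Tate.coord i))
  hJ := Tate.const 1

lemma cover_lev (k : Fin n → ℕ) :
    IsCover ((Finset.univ : Finset (∀ i, Fin (p ^ k i))).toList.map (lev k)) := by
  intro G hG
  rw [List.map_map, Finset.sum_map_toList, (lint_dl k).2]
  simp [Leaf.int, lev]

lemma tate_update (a : Fin n) {f : (Fin n → ℤ_[p]) → ℤ_[p]} (hf : Tate p n f) (i : Fin n) :
    Tate p n (fun x => Function.update x a (f x) i) := by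
  by_cases h : i = a
  · subst h; simpa using hf
  · simpa [Function.update_of_ne h] using Tate.coord i

/-- one coordinate power leaf -/
noncomputable def powLeaf (a : Fin n) (N c : ℕ) (hc : 0 < c) (q : ℤ_[p]) : Leaf p n where
  w := (c : ℝ≥0∞)⁻¹
  π := fun x => Function.update x a (q * x a ^ N)
  J := fun x => q * x a ^ (N - 1)
  hw := RatW.inv hc
  hπ := tate_update a ((Tate.const q).mul ((Tate.coord a).pow N))
  hJ := (Tate.const q).mul ((Tate.coord a).pow _)

lemma lintegral_list_sum {α β : Type*} [MeasurableSpace α] (μ : Measure α) (C : List β) (F : β → α → ℝ≥0∞)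
    (hF : ∀ b, Measurable (F b)) :
    ∫⁻ x, (C.map fun b => F b x).sum ∂μ = (C.map fun b => ∫⁻ x, F b x ∂μ).sum := by
  induction C with
  | nil => simp
  | cons a C ih =>
    simp only [List.map_cons, List.sum_cons]
    rw [lintegral_add_left (hF a), ih]

lemma meas_insertNth {l : Fin (n+1)} :
    Measurable (fun q : (Fin n → ℤ_[p]) × ℤ_[p] => (l.insertNth q.2 q.1 : Fin (n+1) → ℤ_[p])) := by
  have : Continuous (fun q : (Fin n → ℤ_[p]) × ℤ_[p] => (l.insertNth q.2 q.1 : Fin (n+1) → ℤ_[p])) := by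
    refine continuous_pi fun i => ?_
    cases i using l.succAboveCases with
    | x => simpa using continuous_snd
    | p j => simp only [Fin.insertNth_apply_succAbove]; fun_prop
  exact this.measurable

lemma cover_pow1 (a : Fin n) (N : ℕ) (hN : 0 < N) : ∃ (c : ℕ) (hc : 0 < c) (A : List ℤ_[p]),
    (∀ q ∈ A, q ≠ 0) ∧ IsCover (A.map fun q => powLeaf a N c hc q) := by
  obtain ⟨c, A, hc, hA, h⟩ := pow_cover (p := p) N hN
  refine ⟨c, hc, A, hA, fun G hG => ?_⟩
  cases n with
  | zero => exact a.elim0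
  | succ n =>
    rw [fubini a G hG, List.map_map]
    have e1 : ∀ x : Fin n → ℤ_[p], ∫⁻ s, G (a.insertNth s x) =
        (A.map fun q => (c : ℝ≥0∞)⁻¹ * ∫⁻ y, G (a.insertNth (q * y ^ N) x) * ‖q * y ^ (N - 1)‖ₑ).sum := by
      intro x
      exact h (fun s => G (a.insertNth s x)) (hG.comp (meas_insertNth.comp (by fun_prop : Measurable (fun s : ℤ_[p] => (x, s)))))
    simp_rw [e1]
    have hm : ∀ q, Measurable (fun z : (Fin n → ℤ_[p]) × ℤ_[p] => G (a.insertNth (q * z.2 ^ N) z.1) * ‖q * z.2 ^ (N - 1)‖ₑ) := by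
      intro q
      refine (hG.comp (meas_insertNth.comp (by fun_prop : Measurable (fun z : (Fin n → ℤ_[p]) × ℤ_[p] => (z.1, q * z.2 ^ N))))).mul ?_
      fun_prop
    rw [lintegral_list_sum]
    · congr 1
      refine List.map_congr_left fun q _ => ?_
      simp only [Function.comp, Leaf.int, powLeaf]
      rw [lintegral_const_mul]
      · congr 1
        rw [fubini a]
        · simp
        · have h1 := hG.comp (powLeaf a N c hc q).meas
          have h2 := (powLeaf a N c hc q).measJ
          exact h1.mul h2
      · exact (hm q).lintegral_prod_right'
    · intro q
      exact (hm q).lintegral_prod_right'.const_mul _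

lemma cover_pow (N : ℕ) (hN : 0 < N) (S : Finset (Fin n)) : ∃ C : List (Leaf p n), IsCover C ∧
    ∀ l ∈ C, (∃ q : ℤ_[p], q ≠ 0 ∧ ∃ α : Fin n → ℕ, ∀ x, l.J x = q * ∏ i, x i ^ α i) ∧
      (∀ i ∈ S, ∃ a : ℤ_[p], a ≠ 0 ∧ ∀ x, l.π x i = a * x i ^ N) ∧
      ∀ i ∉ S, ∀ x, l.π x i = x i := by
  classical
  induction S using Finset.induction_on with
  | empty =>
    refine ⟨[Leaf.one], cover_one, ?_⟩
    intro l hl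
    rw [List.mem_singleton] at hl
    subst hl
    exact ⟨⟨1, one_ne_zero, fun _ => 0, by simp [Leaf.one]⟩, by simp, by simp [Leaf.one]⟩
  | insert a S ha ih =>
    obtain ⟨C, hC, hl⟩ := ih
    obtain ⟨c, hc, A, hA, hcov⟩ := cover_pow1 (p := p) a N hN
    refine ⟨_, hC.comp (D := fun _ => A.map fun q => powLeaf a N c hc q) (fun _ _ => hcov), ?_⟩
    intro l hlC
    simp only [List.mem_flatMap, List.mem_map] at hlC
    obtain ⟨k, hk, _, ⟨q, hq, rfl⟩, rfl⟩ := hlC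
    obtain ⟨⟨q0, hq0, α, hα⟩, h1, h2⟩ := hl k hk
    refine ⟨⟨q0 * q ^ α a * q, mul_ne_zero (mul_ne_zero hq0 (pow_ne_zero _ (hA q hq))) (hA q hq),
      Function.update α a (N * α a + (N - 1)), fun x => ?_⟩, ?_, ?_⟩
    · simp only [Leaf.comp, powLeaf, hα]
      rw [← Finset.mul_prod_erase _ _ (Finset.mem_univ a), ← Finset.mul_prod_erase _ (fun i => x i ^ _) (Finset.mem_univ a)]
      simp only [Function.update_self]
      rw [Finset.prod_congr rfl (g := fun i => x i ^ α i), Finset.prod_congr rfl (f := fun i => x i ^ Function.update α a (N * α a + (N - 1)) i) (g := fun i => x i ^ α i)]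
      · rw [mul_pow, pow_add, ← pow_mul]; ring
      · intro i hi
        rw [Function.update_of_ne (Finset.ne_of_mem_erase hi)]
      · intro i hi
        rw [Function.update_of_ne (Finset.ne_of_mem_erase hi)]
    · intro i hi
      rcases Finset.mem_insert.1 hi with rfl | hi'
      · refine ⟨q, hA q hq, fun x => ?_⟩
        simp [Leaf.comp, powLeaf, h2 i ha]
      · obtain ⟨b, hb, hb'⟩ := h1 i hi'
        have : i ≠ a := fun h => ha (h ▸ hi')
        refine ⟨b, hb, fun x => ?_⟩
        simp [Leaf.comp, powLeaf, hb', this]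
    · intro i hi
      rw [Finset.mem_insert, not_or] at hi
      intro x
      simp [Leaf.comp, powLeaf, h2 i hi.2, hi.1]

/-- half blow-up leaf -/
noncomputable def blow (a b : Fin n) (q : ℤ_[p]) : Leaf p n where
  w := 1
  π := fun x => Function.update x a (q * x b * x a)
  J := fun x => q * x b
  hw := RatW.one
  hπ := tate_update a (((Tate.const q).mul (Tate.coord b)).mul (Tate.coord a))
  hJ := (Tate.const q).mul (Tate.coord b)

lemma lint_blow (a b : Fin (n+1)) (hab : a ≠ b) (q : ℤ_[p]) (G : (Fin (n+1) → ℤ_[p]) → ℝ≥0∞)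
    (hG : Measurable G) :
    ∫⁻ z in {z | ‖z a‖ ≤ ‖q * z b‖}, G z = (blow a b q).int G := by
  have hms : MeasurableSet {z : Fin (n+1) → ℤ_[p] | ‖z a‖ ≤ ‖q * z b‖} :=
    (isClosed_le (by fun_prop) (by fun_prop)).measurableSet
  rw [← lintegral_indicator hms, fubini a _ (hG.indicator hms)]
  obtain ⟨b', rfl⟩ := Fin.exists_succAbove_eq hab.symm
  simp only [Leaf.int, blow, one_mul]
  rw [fubini a]
  · simp only [Fin.insertNth_apply_succAbove, Fin.update_insertNth, Fin.insertNth_apply_same]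
    refine lintegral_congr fun x => ?_
    rw [lintegral_mul_const', mul_comm, ← lint_mul (q * x b') (fun s => G (a.insertNth s x))]
    · rw [← lintegral_indicator]
      · refine lintegral_congr fun s => ?_
        by_cases h : ‖s‖ ≤ ‖q * x b'‖
        · rw [Set.indicator_of_mem, Set.indicator_of_mem]
          · exact h
          · simpa using h
        · rw [Set.indicator_of_notMem, Set.indicator_of_notMem]
          · exact h
          · simpa using h
      · exact (isClosed_le (by fun_prop) (by fun_prop)).measurableSet
    · exact enorm_ne_top
  · have h1 := hG.comp (blow a (a.succAbove b') q).meas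
    have h2 := (blow a (a.succAbove b') q).measJ
    exact h1.mul h2

lemma ae_coord (a : Fin (n+1)) : ∀ᵐ z : Fin (n+1) → ℤ_[p], z a ≠ 0 := by
  have hms : MeasurableSet {z : Fin (n+1) → ℤ_[p] | z a = 0} :=
    (isClosed_eq (by fun_prop) (by fun_prop)).measurableSet
  rw [ae_iff]
  simp only [ne_eq, not_not]
  rw [← lintegral_indicator_one hms, fubini a _ (measurable_one.indicator hms)]
  have : ∀ x : Fin n → ℤ_[p], ∫⁻ s, ({z : Fin (n+1) → ℤ_[p] | z a = 0}).indicator (1 : (Fin (n+1) → ℤ_[p]) → ℝ≥0∞) (a.insertNth s x) = 0 := by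
    intro x
    have : ∀ s, ({z : Fin (n+1) → ℤ_[p] | z a = 0}).indicator (1 : (Fin (n+1) → ℤ_[p]) → ℝ≥0∞) (a.insertNth s x) = ({0} : Set ℤ_[p]).indicator 1 s := by
      intro s
      by_cases h : s = 0
      · rw [Set.indicator_of_mem, Set.indicator_of_mem]
        · rfl
        · exact h
        · simpa using h
      · rw [Set.indicator_of_notMem, Set.indicator_of_notMem]
        · exact h
        · simpa using h
    simp_rw [this]
    rw [lintegral_indicator_one (measurableSet_singleton _)]
    simp
  simp_rw [this]
  simp

lemma norm_lt_iff (s t : ℤ_[p]) (ht : t ≠ 0) : ‖s‖ < ‖t‖ ↔ ‖s‖ ≤ ‖(p : ℤ_[p]) * t‖ := by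
  constructor
  · intro h
    obtain ⟨y, hy⟩ := (mem_range_mul t s).2 h.le
    simp only at hy
    subst hy
    rw [norm_mul] at h
    have hy1 : ‖y‖ < 1 := by
      by_contra hc
      have : ‖y‖ = 1 := le_antisymm (PadicInt.norm_le_one _) (not_lt.1 hc)
      rw [this, mul_one] at h
      exact lt_irrefl _ h
    obtain ⟨w, rfl⟩ := PadicInt.norm_lt_one_iff_dvd y |>.1 hy1
    rw [mul_left_comm, ← mul_assoc, norm_mul]
    exact mul_le_of_le_one_right (norm_nonneg _) (PadicInt.norm_le_one _)
  · intro h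
    refine lt_of_le_of_lt h ?_
    rw [norm_mul, PadicInt.norm_p]
    exact mul_lt_of_lt_one_left (norm_pos_iff.2 ht) pinv_lt_one

lemma cover_blow (a b : Fin (n+1)) (hab : a ≠ b) : IsCover [blow a b (1 : ℤ_[p]), blow b a (p : ℤ_[p])] := by
  intro G hG
  simp only [List.map_cons, List.map_nil, List.sum_cons, List.sum_nil, add_zero]
  rw [← lint_blow a b hab 1 G hG, ← lint_blow b a hab.symm _ G hG]
  have hms : MeasurableSet {z : Fin (n+1) → ℤ_[p] | ‖z a‖ ≤ ‖1 * z b‖} :=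
    (isClosed_le (by fun_prop) (by fun_prop)).measurableSet
  rw [← lintegral_add_compl _ hms]
  congr 1
  refine setLIntegral_congr ?_
  filter_upwards [ae_coord (p := p) a] with z hz
  apply propext
  change ¬ (‖z a‖ ≤ ‖1 * z b‖) ↔ ‖z b‖ ≤ ‖(p : ℤ_[p]) * z a‖
  rw [not_le, one_mul]
  exact norm_lt_iff _ _ hz

/-- lifted leaf -/
noncomputable def Leaf.lift (l : Leaf p n) : Leaf p (n+1) where
  w := l.w
  π := fun z => Fin.cons (z 0) (l.π (Fin.tail z))
  J := fun z => l.J (Fin.tail z)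
  hw := l.hw
  hπ := by
    intro i
    refine Fin.cases ?_ (fun j => ?_) i
    · simpa using Tate.coord 0
    · simpa using tate_tail (l.hπ j)
  hJ := tate_tail l.hJ

lemma IsCover.lift {C : List (Leaf p n)} (hC : IsCover C) : IsCover (C.map Leaf.lift) := by
  intro G hG
  have hG' : Measurable (fun q : (Fin n → ℤ_[p]) × ℤ_[p] => G (Fin.insertNth 0 q.2 q.1)) := hG.comp meas_insertNth
  rw [fubini 0 G hG]
  rw [hC _ hG'.lintegral_prod_right', List.map_map]
  congr 1
  refine List.map_congr_left fun l hl => ?_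
  simp only [Function.comp, Leaf.int, Leaf.lift]
  congr 1
  rw [fubini 0]
  · refine lintegral_congr fun x => ?_
    rw [← lintegral_mul_const']
    · simp
    · exact enorm_ne_top
  · have h1 := hG.comp l.lift.meas
    have h2 := l.lift.measJ
    exact h1.mul h2

end PR

namespace PR
variable {p : ℕ} [hp : Fact p.Prime] {n : ℕ}

/-- zero or monomial times Tate function of constant nonzero norm -/
def MZ (f : (Fin n → ℤ_[p]) → ℤ_[p]) : Prop :=
  (∀ x, f x = 0) ∨ ∃ (α : Fin n → ℕ) (u : (Fin n → ℤ_[p]) → ℤ_[p]) (c : ℤ_[p]),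
    Tate p n u ∧ c ≠ 0 ∧ (∀ x, ‖u x‖ = ‖c‖) ∧ ∀ x, f x = (∏ i, x i ^ α i) * u x

lemma MZ.congr {f g : (Fin n → ℤ_[p]) → ℤ_[p]} (hf : MZ f) (h : ∀ x, g x = f x) : MZ g := by
  have : g = f := funext h
  rwa [this]

lemma MZ.unit {u : (Fin n → ℤ_[p]) → ℤ_[p]} (hu : Tate p n u) (c : ℤ_[p]) (hc : c ≠ 0)
    (h : ∀ x, ‖u x‖ = ‖c‖) : MZ u :=
  Or.inr ⟨fun _ => 0, u, c, hu, hc, h, by simp⟩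

lemma MZ.const (c : ℤ_[p]) : MZ (fun _ : Fin n → ℤ_[p] => c) := by
  by_cases hc : c = 0
  · exact Or.inl (fun _ => hc)
  · exact MZ.unit (Tate.const c) c hc (fun _ => rfl)

lemma MZ.coord (i : Fin n) : MZ (fun x : Fin n → ℤ_[p] => x i) := by
  classical
  refine Or.inr ⟨fun j => if j = i then 1 else 0, fun _ => 1, 1, Tate.const 1, one_ne_zero, by simp, ?_⟩
  intro x
  simp [pow_ite]

lemma MZ.mul {f g : (Fin n → ℤ_[p]) → ℤ_[p]} (hf : MZ f) (hg : MZ g) : MZ (fun x => f x * g x) := by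
  rcases hf with hf | ⟨α, u, c, hu, hc, hn, hf⟩
  · exact Or.inl (fun x => by simp [hf])
  rcases hg with hg | ⟨β, v, d, hv, hd, hn', hg⟩
  · exact Or.inl (fun x => by simp [hg])
  refine Or.inr ⟨fun i => α i + β i, fun x => u x * v x, c * d, hu.mul hv, mul_ne_zero hc hd, ?_, ?_⟩
  · intro x; rw [norm_mul, norm_mul, hn, hn']
  · intro x; simp only [hf, hg, pow_add, Finset.prod_mul_distrib]; ring

lemma MZ.pow {f : (Fin n → ℤ_[p]) → ℤ_[p]} (hf : MZ f) (k : ℕ) : MZ (fun x => f x ^ k) := by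
  induction k with
  | zero => simpa using MZ.const (n := n) (1 : ℤ_[p])
  | succ k ih => simpa [pow_succ] using ih.mul hf

lemma MZ.prod {ι : Type*} (s : Finset ι) {f : ι → (Fin n → ℤ_[p]) → ℤ_[p]} (hf : ∀ i ∈ s, MZ (f i)) :
    MZ (fun x => ∏ i ∈ s, f i x) := by
  classical
  induction s using Finset.induction_on with
  | empty => simpa using MZ.const (n := n) (1 : ℤ_[p])
  | insert a s ha ih =>
    simp only [Finset.prod_insert ha]
    exact (hf a (Finset.mem_insert_self _ _)).mul (ih fun i hi => hf i (Finset.mem_insert_of_mem hi))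

lemma MZ.comp {m : ℕ} {f : (Fin m → ℤ_[p]) → ℤ_[p]} (hf : MZ f) {g : (Fin n → ℤ_[p]) → Fin m → ℤ_[p]}
    (hg : ∀ i, Tate p n (fun x => g x i)) (hm : ∀ i, MZ (fun x => g x i)) : MZ (fun x => f (g x)) := by
  rcases hf with hf | ⟨α, u, c, hu, hc, hn, hf⟩
  · exact Or.inl (fun x => hf _)
  · refine MZ.congr ((MZ.prod Finset.univ fun i _ => (hm i).pow (α i)).mul
      (MZ.unit (hu.comp hg) c hc (fun x => hn _))) (fun x => hf _)

lemma MZ.tate {f : (Fin n → ℤ_[p]) → ℤ_[p]} (hf : MZ f) : Tate p n f := by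
  rcases hf with hf | ⟨α, u, c, hu, hc, hn, hf⟩
  · exact (Tate.const 0).congr hf
  · exact ((Tate.prod _ fun i _ => (Tate.coord i).pow (α i)).mul hu).congr hf

/-- all functions of the set become monomial after a suitable cover -/
def Res (L : Set ((Fin n → ℤ_[p]) → ℤ_[p])) : Prop :=
  ∃ C : List (Leaf p n), IsCover C ∧ ∀ l ∈ C, MZ l.J ∧ ∀ f ∈ L, MZ (fun x => f (l.π x))

lemma Res.of {L L' : Set ((Fin n → ℤ_[p]) → ℤ_[p])} (hL : Res L)
    (h : ∀ f ∈ L', ∀ π : (Fin n → ℤ_[p]) → Fin n → ℤ_[p], (∀ i, Tate p n (fun x => π x i)) →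
      (∀ g ∈ L, MZ (fun x => g (π x))) → MZ (fun x => f (π x))) : Res L' := by
  obtain ⟨C, hC, hl⟩ := hL
  exact ⟨C, hC, fun l hlC => ⟨(hl l hlC).1, fun f hf => h f hf l.π l.hπ (hl l hlC).2⟩⟩

lemma Res.mono {L L' : Set ((Fin n → ℤ_[p]) → ℤ_[p])} (hL : Res L) (h : L' ⊆ L) : Res L' :=
  hL.of fun f hf _ _ hg => hg f (h hf)

lemma Res.of_cover {L : Set ((Fin n → ℤ_[p]) → ℤ_[p])} {C : List (Leaf p n)} (hC : IsCover C)
    (h : ∀ l ∈ C, Res (insert l.J ((fun f x => f (l.π x)) '' L))) : Res L := by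
  have h' : ∀ l : Leaf p n, ∃ D : List (Leaf p n), l ∈ C → IsCover D ∧ ∀ k ∈ D, MZ k.J ∧
      ∀ f ∈ (insert l.J ((fun f x => f (l.π x)) '' L)), MZ (fun x => f (k.π x)) := by
    intro l
    by_cases hl : l ∈ C
    · obtain ⟨D, h1, h2⟩ := h l hl
      exact ⟨D, fun _ => ⟨h1, h2⟩⟩
    · exact ⟨[], fun h => absurd h hl⟩
  choose D hD using h'
  refine ⟨_, hC.comp (D := D) (fun l hl => (hD l hl).1), ?_⟩
  intro l hl
  simp only [List.mem_flatMap, List.mem_map] at hl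
  obtain ⟨l, hlC, k, hk, rfl⟩ := hl
  have h2 := (hD l hlC).2 k hk
  refine ⟨(h2.2 _ (Set.mem_insert _ _)).mul h2.1, fun f hf => ?_⟩
  exact h2.2 _ (Set.mem_insert_of_mem _ ⟨f, hf, rfl⟩)

lemma Res.insert_const {L : Set ((Fin n → ℤ_[p]) → ℤ_[p])} (hL : Res L) (c : ℤ_[p]) :
    Res (insert (fun _ => c) L) := by
  refine hL.of fun f hf π hπ hg => ?_
  rcases hf with rfl | hf
  · exact MZ.const c
  · exact hg f hf

lemma Res.of_lev {L : Set ((Fin n → ℤ_[p]) → ℤ_[p])} (k : Fin n → ℕ)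
    (h : ∀ b : (∀ i, Fin (p ^ k i)), Res ((fun f x => f (rp b + dl k x)) '' L)) : Res L := by
  refine Res.of_cover (cover_lev k) ?_
  intro l hl
  simp only [List.mem_map, Finset.mem_toList] at hl
  obtain ⟨b, -, rfl⟩ := hl
  exact (h b).insert_const 1

lemma mz_lev (k : Fin n → ℕ) (b : ∀ i, Fin (p ^ k i)) (i : Fin n) :
    MZ (fun x : Fin n → ℤ_[p] => (rp b + dl k x) i) := by
  by_cases hb : ((b i : ℕ) : ℤ_[p]) = 0
  · refine MZ.congr ((MZ.const ((p : ℤ_[p]) ^ k i)).mul (MZ.coord i)) fun x => ?_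
    simp [rp, dl, hb]
  · refine MZ.unit ((lev k b).hπ i) ((b i : ℕ) : ℤ_[p]) hb fun x => ?_
    have hlt : ‖(p : ℤ_[p]) ^ k i * x i‖ < ‖((b i : ℕ) : ℤ_[p])‖ := by
      by_contra hc
      rw [not_lt] at hc
      obtain ⟨y, hy⟩ := (mem_range_mul _ _).2 hc
      have h0 : b i = ⟨0, pow_pos hp.out.pos _⟩ := by
        refine rep_unique (k i) _ _ ?_
        simp only [Nat.cast_zero, sub_zero]
        exact ⟨x i * y, by rw [← hy]; ring⟩
      rw [h0] at hb
      simp at hb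
    change ‖((b i : ℕ) : ℤ_[p]) + (p : ℤ_[p]) ^ k i * x i‖ = _
    rw [PadicInt.norm_add_eq_max_of_ne hlt.ne', max_eq_left hlt.le]

lemma Res.dl {L : Set ((Fin n → ℤ_[p]) → ℤ_[p])} (hL : Res L) (k : Fin n → ℕ) :
    Res ((fun f x => f (dl k x)) '' L) := by
  classical
  obtain ⟨C, hC, hl⟩ := hL
  set M := ∑ i, k i with hM
  have hkM : ∀ i, k i ≤ M := fun i => Finset.single_le_sum (f := k) (fun _ _ => Nat.zero_le _) (Finset.mem_univ i)
  have hme : MeasurableEmbedding (PR.dl (p := p) k) := ((dl_cont k).isClosedEmbedding (dl_inj k)).measurableEmbedding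
  set K : Fin n → ℕ := fun _ => M with hK
  have step : ∀ (l : Leaf p n) (b : ∀ i, Fin (p ^ K i)), ∃ D : List (Leaf p n), l ∈ C →
      (∀ k' ∈ D, MZ k'.J ∧ ∀ f ∈ L, MZ (fun x => f (PR.dl k (k'.π x)))) ∧
      ∀ G : (Fin n → ℤ_[p]) → ℝ≥0∞, ((p ^ (∑ i, k i) : ℕ) : ℝ≥0∞) *
        (l.comp (lev K b)).int (Function.extend (PR.dl k) G 0) =
        (D.map fun k' => k'.int G).sum := by
    intro l b
    by_cases hlC : l ∈ C
    swap
    · exact ⟨[], fun h => absurd h hlC⟩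
    have hd : ∀ i, ∃ g, Tate p n g ∧ ∀ x, l.π (rp b + PR.dl K x) i = l.π (rp b) i + (p : ℤ_[p]) ^ M * g x :=
      fun i => (l.hπ i).diff (rp b) M
    choose g hg hg' using hd
    by_cases hdiv : ∀ i, (p : ℤ_[p]) ^ k i ∣ l.π (rp b) i
    · choose q hq using hdiv
      set π' : (Fin n → ℤ_[p]) → Fin n → ℤ_[p] := fun x i => q i + (p : ℤ_[p]) ^ (M - k i) * g i x with hπ'
      have hπ'T : ∀ i, Tate p n (fun x => π' x i) := fun i => (Tate.const _).add ((Tate.const _).mul (hg i))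
      have hdl : ∀ x, PR.dl k (π' x) = l.π (rp b + PR.dl K x) := by
        intro x
        ext1 i
        rw [hg', hq]
        simp only [PR.dl, hπ']
        rw [mul_add, ← mul_assoc, ← pow_add, Nat.add_sub_cancel' (hkM i)]
      refine ⟨[{ w := ((p ^ (∑ i, k i) : ℕ) : ℝ≥0∞) * (l.comp (lev K b)).w
                 π := π'
                 J := (l.comp (lev K b)).J
                 hw := (RatW.nat _).mul (l.comp (lev K b)).hw
                 hπ := hπ'T
                 hJ := (l.comp (lev K b)).hJ }], fun _ => ⟨?_, ?_⟩⟩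
      · intro k' hk'
        rw [List.mem_singleton] at hk'
        subst hk'
        constructor
        · exact ((hl l hlC).1.comp (lev K b).hπ (mz_lev K b)).mul (MZ.const 1)
        · intro f hf
          refine MZ.congr (((hl l hlC).2 f hf).comp (lev K b).hπ (mz_lev K b)) fun x => ?_
          simp only [hdl]
          rfl
      · intro G
        simp only [Leaf.int, List.map_cons, List.map_nil, List.sum_cons, List.sum_nil, add_zero]
        rw [← mul_assoc]
        congr 1
        refine lintegral_congr fun x => ?_
        congr 1
        have : (l.comp (lev K b)).π x = PR.dl k (π' x) := (hdl x).symm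
        rw [this, (dl_inj k).extend_apply]
    · refine ⟨[], fun _ => ⟨by simp, fun G => ?_⟩⟩
      have : ∀ x, Function.extend (PR.dl k) G 0 ((l.comp (lev K b)).π x) = 0 := by
        intro x
        rw [Function.extend_apply']
        · rfl
        · intro hc
          apply hdiv
          intro i
          have h1 := (mem_range_dl k _).1 hc i
          have h2 : (l.comp (lev K b)).π x i = l.π (rp b) i + (p : ℤ_[p]) ^ M * g i x := hg' i x
          rw [h2] at h1
          exact (dvd_add_left ((pow_dvd_pow _ (hkM i)).mul_right _)).1 h1
      simp [Leaf.int, this]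
  choose D hD using step
  refine ⟨C.flatMap fun l => (Finset.univ : Finset (∀ i, Fin (p ^ K i))).toList.flatMap (D l), ?_, ?_⟩
  · intro G hG
    have hext : Measurable (Function.extend (PR.dl k) G 0) := hme.measurable_extend hG measurable_zero
    have h1 : ∫⁻ x, G x = ((p ^ (∑ i, k i) : ℕ) : ℝ≥0∞) * ∫⁻ x, Function.extend (PR.dl k) G 0 x := by
      have h2 := (lint_dl k).1 (Function.extend (PR.dl k) G 0)
      simp only [(dl_inj k).extend_apply] at h2
      have h3 : ∫⁻ x in Set.range (PR.dl (p := p) k), Function.extend (PR.dl k) G 0 x = ∫⁻ x, Function.extend (PR.dl k) G 0 x := by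
        rw [← lintegral_indicator hme.measurableSet_range]
        refine lintegral_congr fun x => ?_
        by_cases hx : x ∈ Set.range (PR.dl (p := p) k)
        · rw [Set.indicator_of_mem hx]
        · rw [Set.indicator_of_notMem hx, Function.extend_apply' _ _ _ hx]; rfl
      rw [← h3, h2, ← mul_assoc, ENNReal.mul_inv_cancel, one_mul]
      · exact_mod_cast (pow_pos hp.out.pos _).ne'
      · exact ENNReal.natCast_ne_top _
    have h4 := (hC.comp (D := fun _ => (Finset.univ : Finset (∀ i, Fin (p ^ K i))).toList.map (lev K)) (fun _ _ => cover_lev K)) _ hext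
    rw [h1, h4, sum_flatMap, sum_flatMap, ← list_sum_mul_left]
    congr 1
    refine List.map_congr_left fun l hlC => ?_
    rw [List.map_map, List.map_map, sum_flatMap, ← list_sum_mul_left]
    congr 1
    refine List.map_congr_left fun b _ => ?_
    exact (hD l b hlC).2 G
  · intro k' hk'
    simp only [List.mem_flatMap, Finset.mem_toList] at hk'
    obtain ⟨l, hlC, b, -, hb⟩ := hk'
    have := (hD l b hlC).1 k' hb
    refine ⟨this.1, ?_⟩
    rintro _ ⟨f, hf, rfl⟩
    exact this.2 f hf

/-- postcompose a leaf with a Tate map -/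
def Leaf.post (l : Leaf p n) (ψ : (Fin n → ℤ_[p]) → Fin n → ℤ_[p]) (hψ : ∀ i, Tate p n (fun x => ψ x i)) :
    Leaf p n where
  w := l.w
  π := fun x => ψ (l.π x)
  J := l.J
  hw := l.hw
  hπ := fun i => (hψ i).comp l.hπ
  hJ := l.hJ

/-- measure preserving Tate automorphisms -/
lemma Res.auto {L : Set ((Fin n → ℤ_[p]) → ℤ_[p])} (hL : Res L)
    (φ ψ : (Fin n → ℤ_[p]) → Fin n → ℤ_[p]) (hψ : ∀ i, Tate p n (fun x => ψ x i))
    (hinv : ∀ x, φ (ψ x) = x)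
    (hmp : ∀ G : (Fin n → ℤ_[p]) → ℝ≥0∞, Measurable G → ∫⁻ x, G (ψ x) = ∫⁻ x, G x) :
    Res ((fun f x => f (φ x)) '' L) := by
  obtain ⟨C, hC, hl⟩ := hL
  have hψm : Measurable ψ := (continuous_pi fun i => (hψ i).continuous).measurable
  refine ⟨C.map fun l => l.post ψ hψ, ?_, ?_⟩
  · intro G hG
    rw [← hmp G hG, List.map_map]
    refine (hC (fun x => G (ψ x)) (hG.comp hψm)).trans ?_
    rfl
  · intro k hk
    rw [List.mem_map] at hk
    obtain ⟨l, hlC, rfl⟩ := hk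
    refine ⟨(hl l hlC).1, ?_⟩
    rintro _ ⟨f, hf, rfl⟩
    simp only [Leaf.post, hinv]
    exact (hl l hlC).2 f hf

lemma Res.translate {L : Set ((Fin n → ℤ_[p]) → ℤ_[p])} (hL : Res L) (y : Fin n → ℤ_[p]) :
    Res ((fun f x => f (y + x)) '' L) :=
  hL.auto (fun x => y + x) (fun x => -y + x) (fun i => (Tate.const _).add (Tate.coord i))
    (fun x => by simp) (fun G _ => lintegral_add_left_eq_self _ _)

lemma Res.loc {L : Set ((Fin n → ℤ_[p]) → ℤ_[p])}
    (h : ∀ y : Fin n → ℤ_[p], ∃ e : ℕ, Res ((fun f x => f (y + PR.dl (fun _ => e) x)) '' L)) : Res L := by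
  by_contra hbad
  set B : ℕ → (Fin n → ℤ_[p]) → Prop := fun e y => ¬ Res ((fun f x => f (y + PR.dl (fun _ => e) x)) '' L) with hB
  have h0 : B 0 0 := by
    intro hc
    apply hbad
    refine hc.mono ?_
    intro f hf
    exact ⟨f, hf, by funext x; simp only []; congr 1; ext1 i; simp [PR.dl]⟩
  have hs : ∀ e y, ∃ y', B e y → B (e + 1) y' ∧ ∀ i, (p : ℤ_[p]) ^ e ∣ y' i - y i := by
    intro e y
    by_cases hy : B e y
    swap
    · exact ⟨0, fun h => absurd h hy⟩
    by_contra hc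
    push Not at hc
    apply hy
    refine Res.of_lev (fun _ => 1) fun b => ?_
    by_contra hb
    obtain ⟨-, h3⟩ := hc (y + PR.dl (fun _ => e) (rp b))
    obtain ⟨i, hi⟩ := h3 (by
      intro hr
      apply hb
      refine hr.mono ?_
      rintro _ ⟨_, ⟨f, hf, rfl⟩, rfl⟩
      refine ⟨f, hf, ?_⟩
      ext x
      simp only
      congr 1
      ext1 i
      simp [PR.dl, pow_succ]
      ring)
    exact hi ⟨rp b i, by simp [PR.dl]⟩
  choose st hst using hs
  let sq : ∀ e : ℕ, {y // B e y} := fun e => Nat.rec ⟨0, h0⟩ (fun e y => ⟨st e y.1, (hst e y.1 y.2).1⟩) e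
  have hsq : ∀ e i, (p : ℤ_[p]) ^ e ∣ (sq (e+1)).1 i - (sq e).1 i := fun e => (hst e (sq e).1 (sq e).2).2
  set K : ℕ → Set (Fin n → ℤ_[p]) := fun e => {y | ∀ i, (p : ℤ_[p]) ^ e ∣ y i - (sq e).1 i} with hK
  have hKeq : ∀ e, K e = {y | ∀ i, ‖y i - (sq e).1 i‖ ≤ ‖(p : ℤ_[p]) ^ e‖} := by
    intro e
    ext y
    simp only [hK, Set.mem_ofPred_eq]
    refine forall_congr' fun i => ?_
    rw [← mem_range_mul]
    exact ⟨fun ⟨z, hz⟩ => ⟨z, hz.symm⟩, fun ⟨z, hz⟩ => ⟨z, hz.symm⟩⟩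
  have hcl : ∀ e, IsClosed (K e) := by
    intro e
    rw [hKeq, Set.ofPred_forall]
    exact isClosed_iInter fun i => isClosed_le (by fun_prop) (by fun_prop)
  obtain ⟨y, hy⟩ := IsCompact.nonempty_iInter_of_sequence_nonempty_isCompact_isClosed K
    (by
      intro e y hy i
      have h1 := (pow_dvd_pow (p : ℤ_[p]) (Nat.le_succ e)).trans (hy i)
      have := dvd_add h1 (hsq e i)
      simpa using this)
    (fun e => ⟨(sq e).1, by simp [hK]⟩) (hcl 0).isCompact hcl
  obtain ⟨e, he⟩ := h y
  apply (sq e).2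
  have hye : ∀ i, (p : ℤ_[p]) ^ e ∣ y i - (sq e).1 i := (Set.mem_iInter.1 hy) e
  choose w hw using hye
  refine (he.translate (fun i => - w i)).mono ?_
  rintro _ ⟨f, hf, rfl⟩
  refine ⟨_, ⟨f, hf, rfl⟩, ?_⟩
  ext x
  simp only
  congr 1
  ext1 i
  simp only [PR.dl, Pi.add_apply]
  linear_combination hw i

end PR

namespace PR
variable {p : ℕ} [hp : Fact p.Prime] {n : ℕ}

lemma Res.trivial {L : Set ((Fin n → ℤ_[p]) → ℤ_[p])} (h : ∀ f ∈ L, MZ f) : Res L := by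
  refine ⟨[Leaf.one], cover_one, ?_⟩
  intro l hl
  rw [List.mem_singleton] at hl
  subst hl
  exact ⟨MZ.const 1, h⟩

lemma pow_lt_aux {r A B : ℝ} (hr0 : 0 < r) (hr1 : r < 1) (hA : 0 < A) {k l : ℕ} (hkl : k < l) :
    ∃ a0 : ℕ, ∀ a ≥ a0, r ^ (a * l) * B < r ^ (a * k) * A := by
  have h1 : Tendsto (fun a : ℕ => r ^ a * |B|) atTop (nhds (0 * |B|)) :=
    (tendsto_pow_atTop_nhds_zero_of_lt_one hr0.le hr1).mul_const _
  rw [zero_mul] at h1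
  obtain ⟨a0, ha0⟩ := eventually_atTop.1 (h1.eventually (gt_mem_nhds hA))
  refine ⟨a0, fun a ha => ?_⟩
  have h2 := ha0 a ha
  obtain ⟨m, rfl⟩ := Nat.exists_eq_add_of_lt hkl
  have h3 : r ^ (a * (k + m + 1)) * B ≤ r ^ (a * k) * (r ^ a * |B|) := by
    rw [show a * (k + m + 1) = a * k + a + a * m by ring, pow_add, pow_add, mul_assoc, mul_assoc]
    refine mul_le_mul_of_nonneg_left ?_ (by positivity)
    refine mul_le_mul_of_nonneg_left ?_ (by positivity)
    calc r ^ (a * m) * B ≤ r ^ (a * m) * |B| := mul_le_mul_of_nonneg_left (le_abs_self _) (by positivity)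
      _ ≤ 1 * |B| := mul_le_mul_of_nonneg_right (pow_le_one₀ hr0.le hr1.le) (abs_nonneg _)
      _ = |B| := one_mul _
  exact h3.trans_lt (mul_lt_mul_of_pos_left h2 (by positivity))

lemma compare_real {r A B C : ℝ} (hr0 : 0 < r) (hr1 : r < 1) (hA : 0 < A) (hB : 0 < B)
    {α β γ α' β' γ' : ℕ} (h1 : α < β) (h2 : β' < α')
    (hx : ∀ a b : ℕ, r ^ (a * β) * r ^ (b * β') * B < r ^ (a * α) * r ^ (b * α') * A →
      r ^ (a * γ) * r ^ (b * γ') * C = r ^ (a * α) * r ^ (b * α') * A)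
    (hy : ∀ a b : ℕ, r ^ (a * α) * r ^ (b * α') * A < r ^ (a * β) * r ^ (b * β') * B →
      r ^ (a * γ) * r ^ (b * γ') * C = r ^ (a * β) * r ^ (b * β') * B) : False := by
  have key : ∀ {A C : ℝ} {α γ : ℕ} (a : ℕ), 0 < A → r ^ (a * γ) * C = r ^ (a * α) * A →
      r ^ ((a + 1) * γ) * C = r ^ ((a + 1) * α) * A → γ = α ∧ C = A := by
    intro A C α γ a hA h1 h2
    rw [add_mul, add_mul, pow_add, pow_add, one_mul, one_mul] at h2
    have h3 : r ^ (a * α) * A * (r ^ γ - r ^ α) = 0 := by linear_combination h2 - r ^ γ * h1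
    have h4 : r ^ γ = r ^ α := by
      have : r ^ (a * α) * A ≠ 0 := by positivity
      have := (mul_eq_zero.1 h3).resolve_left this
      linarith
    have h5 : γ = α := (pow_right_injective₀ hr0 hr1.ne) h4
    subst h5
    exact ⟨rfl, mul_left_cancel₀ (by positivity) h1⟩
  obtain ⟨a0, ha0⟩ := pow_lt_aux (B := B) hr0 hr1 hA h1
  obtain ⟨b0, hb0⟩ := pow_lt_aux (B := A) hr0 hr1 hB h2
  obtain ⟨a1, ha1⟩ := pow_lt_aux (B := r ^ β' * B) hr0 hr1 (A := r ^ α' * A) (by positivity) h1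
  have e1 := hx a0 0 (by simpa using ha0 a0 le_rfl)
  have e2 := hx (a0 + 1) 0 (by simpa using ha0 (a0 + 1) (Nat.le_succ _))
  have e3 := hy 0 b0 (by simpa using hb0 b0 le_rfl)
  have e4 := hy 0 (b0 + 1) (by simpa using hb0 (b0 + 1) (Nat.le_succ _))
  have e5 := hx a1 1 (by simpa [mul_assoc] using ha1 a1 le_rfl)
  simp only [zero_mul, pow_zero, mul_one, one_mul] at e1 e2 e3 e4 e5
  obtain ⟨rfl, rfl⟩ := key _ hA e1 e2
  obtain ⟨rfl, rfl⟩ := key _ hB e3 e4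
  rw [mul_assoc, mul_assoc] at e5
  have e6 := mul_left_cancel₀ (by positivity) e5
  have e7 := mul_right_cancel₀ hA.ne' e6
  have := (pow_right_injective₀ hr0 hr1.ne) e7
  omega

lemma norm_mon_test (α : Fin n → ℕ) {i j : Fin n} (hij : i ≠ j) (a b : ℕ) :
    ‖∏ k, (Function.update (Function.update (fun _ => (1 : ℤ_[p])) i ((p : ℤ_[p]) ^ a)) j ((p : ℤ_[p]) ^ b)) k ^ α k‖
      = (p : ℝ)⁻¹ ^ (a * α i) * (p : ℝ)⁻¹ ^ (b * α j) := by
  classical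
  rw [Finset.prod_eq_mul i j hij]
  · simp [Function.update_of_ne hij, pow_mul]
  · intro c _ hc
    simp [Function.update_of_ne hc.1, Function.update_of_ne hc.2]
  · simp
  · simp

lemma compare {α β : Fin n → ℕ} {u v : (Fin n → ℤ_[p]) → ℤ_[p]} {c d : ℤ_[p]} (hc : c ≠ 0) (hd : d ≠ 0)
    (hu : ∀ x, ‖u x‖ = ‖c‖) (hv : ∀ x, ‖v x‖ = ‖d‖)
    (h : MZ (fun x => (∏ i, x i ^ α i) * u x - (∏ i, x i ^ β i) * v x)) :
    (∀ i, α i ≤ β i) ∨ ∀ i, β i ≤ α i := by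
  by_contra hcon
  push Not at hcon
  obtain ⟨⟨j, hj⟩, ⟨i, hi⟩⟩ := hcon
  have hij : i ≠ j := by rintro rfl; omega
  have hr0 : 0 < (p : ℝ)⁻¹ := by have := hp.out.pos; positivity
  have hr1 := pinv_lt_one (p := p)
  have hcp : 0 < ‖c‖ := norm_pos_iff.2 hc
  have hdp : 0 < ‖d‖ := norm_pos_iff.2 hd
  rcases h with h | ⟨γ, w, e, -, -, hw, h⟩
  · obtain ⟨a0, ha0⟩ := pow_lt_aux (B := ‖d‖) hr0 hr1 hcp hi
    have h1 := ha0 a0 le_rfl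
    have h2 := congrArg norm (sub_eq_zero.1 (h (Function.update (Function.update (fun _ => (1 : ℤ_[p])) i ((p : ℤ_[p]) ^ a0)) j ((p : ℤ_[p]) ^ 0))))
    rw [norm_mul, norm_mul, norm_mon_test _ hij, norm_mon_test _ hij, hu, hv] at h2
    simp only [zero_mul, pow_zero, mul_one] at h2
    exact h1.ne' h2
  · refine compare_real (γ := γ i) (γ' := γ j) (C := ‖e‖) hr0 hr1 hcp hdp hi hj ?_ ?_
    all_goals
      intro a b hab
      set x := (Function.update (Function.update (fun _ => (1 : ℤ_[p])) i ((p : ℤ_[p]) ^ a)) j ((p : ℤ_[p]) ^ b)) with hx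
      have h2 := congrArg norm (h x)
      have n1 : ‖(∏ i, x i ^ α i) * u x‖ = (p : ℝ)⁻¹ ^ (a * α i) * (p : ℝ)⁻¹ ^ (b * α j) * ‖c‖ := by rw [norm_mul, norm_mon_test _ hij, hu]
      have n2 : ‖(∏ i, x i ^ β i) * v x‖ = (p : ℝ)⁻¹ ^ (a * β i) * (p : ℝ)⁻¹ ^ (b * β j) * ‖d‖ := by rw [norm_mul, norm_mon_test _ hij, hv]
      have n3 : ‖(∏ i, x i ^ γ i) * w x‖ = (p : ℝ)⁻¹ ^ (a * γ i) * (p : ℝ)⁻¹ ^ (b * γ j) * ‖e‖ := by rw [norm_mul, norm_mon_test _ hij, hw]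
      rw [n3] at h2
      rw [← n1, ← n2] at hab
      rw [← h2]
      simp only []
      rw [sub_eq_add_neg, PadicInt.norm_add_eq_max_of_ne (by rw [norm_neg]; first | exact hab.ne' | exact hab.ne), norm_neg]
    · rw [max_eq_left hab.le, n1]
    · rw [max_eq_right hab.le, n2]

/-- finite set of Tate functions -/
def TF (L : Set ((Fin n → ℤ_[p]) → ℤ_[p])) : Prop := L.Finite ∧ ∀ f ∈ L, Tate p n f

/-- main property -/
def MM (p : ℕ) [Fact p.Prime] (n : ℕ) : Prop := ∀ L : Set ((Fin n → ℤ_[p]) → ℤ_[p]), TF L → Res L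

/-- lifts of functions of the last variables -/
def lft (H : Set ((Fin n → ℤ_[p]) → ℤ_[p])) : Set ((Fin (n+1) → ℤ_[p]) → ℤ_[p]) :=
  (fun h z => h (Fin.tail z)) '' H

lemma MZ.tail {f : (Fin n → ℤ_[p]) → ℤ_[p]} (hf : MZ f) : MZ (fun z : Fin (n+1) → ℤ_[p] => f (Fin.tail z)) :=
  hf.comp (g := fun z => Fin.tail z) (fun i => Tate.coord i.succ) (fun i => MZ.coord i.succ)

lemma Res.lift {H : Set ((Fin n → ℤ_[p]) → ℤ_[p])} (h : Res H) : Res (lft H) := by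
  obtain ⟨C, hC, hl⟩ := h
  refine ⟨_, hC.lift, ?_⟩
  intro k hk
  rw [List.mem_map] at hk
  obtain ⟨l, hlC, rfl⟩ := hk
  refine ⟨(hl l hlC).1.tail, ?_⟩
  rintro _ ⟨f, hf, rfl⟩
  refine MZ.congr ((hl l hlC).2 f hf).tail fun z => ?_
  simp [Leaf.lift]

/-- resolution of monic polynomial families of total degree D -/
def QQ (p : ℕ) [Fact p.Prime] (n D : ℕ) : Prop :=
  ∀ (ι : Type) [Fintype ι] (H : Set ((Fin n → ℤ_[p]) → ℤ_[p])) (P : ι → Polynomial (TR p n)), TF H →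
    (∀ i, (P i).Monic) → ∑ i, (P i).natDegree = D → Res (lft H ∪ Set.range (fun i => pev (P i)))

lemma Res.dl_le {L : Set ((Fin n → ℤ_[p]) → ℤ_[p])} {k k' : Fin n → ℕ} (hk : ∀ i, k i ≤ k' i)
    (h : Res ((fun f x => f (PR.dl k x)) '' L)) : Res ((fun f x => f (PR.dl k' x)) '' L) := by
  refine (h.dl (fun i => k' i - k i)).mono ?_
  rintro _ ⟨f, hf, rfl⟩
  refine ⟨_, ⟨f, hf, rfl⟩, ?_⟩
  funext x
  simp only []
  congr 1
  ext1 i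
  simp only [PR.dl]
  rw [← mul_assoc, ← pow_add, Nat.add_sub_cancel' (hk i)]

lemma dl_cons (e e1 : ℕ) (z : Fin (n+1) → ℤ_[p]) :
    dl (Fin.cons e fun _ => e1) z = Fin.cons ((p : ℤ_[p]) ^ e * z 0) (fun i => (p : ℤ_[p]) ^ e1 * Fin.tail z i) := by
  ext1 i
  refine Fin.cases ?_ (fun j => ?_) i
  · simp [dl]
  · simp [dl, Fin.tail]

lemma wstep {D : ℕ} (hQ : QQ p n D) {ι : Type} [Fintype ι] (f : ι → (Fin (n+1) → ℤ_[p]) → ℤ_[p])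
    (H : Set ((Fin n → ℤ_[p]) → ℤ_[p])) (hH : TF H) (F : ι → PowerSeries (TR p n))
    (hF : ∀ i, ∀ z : Fin (n + 1) → ℤ_[p], f i (Fin.cons (p * z 0) (Fin.tail z)) = evh z (F i)) (d : ι → ℕ)
    (h0 : ∀ i, ∀ j < d i, (PowerSeries.coeff j (F i)).1 (fun _ => 0) = 0)
    (hd : ∀ i, (PowerSeries.coeff (d i) (F i)).1 (fun _ => 0) ≠ 0) (hD : ∑ i, d i = D) :
    ∃ E : ℕ, 1 ≤ E ∧ Res ((fun g z => g (PR.dl (fun _ => E) z)) '' (lft H ∪ Set.range f)) := by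
  have hw := fun i => weier (F i) (hF i) (d i) (h0 i) (hd i)
  choose e0 he0 using hw
  set e := ∑ i, e0 i with he
  have hle : ∀ i, e ≥ e0 i := fun i => Finset.single_le_sum (f := e0) (fun _ _ => Nat.zero_le _) (Finset.mem_univ i)
  choose e10 he1 using fun i => he0 i e (hle i)
  set e1 := ∑ i, e10 i with he1'
  have hle1 : ∀ i, e1 ≥ e10 i := fun i => Finset.single_le_sum (f := e10) (fun _ _ => Nat.zero_le _) (Finset.mem_univ i)
  choose c u P hc hu hu1 hP hPd hfac using fun i => he1 i e1 (hle1 i)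
  set H' : Set ((Fin n → ℤ_[p]) → ℤ_[p]) := (fun h x => h (fun i => (p : ℤ_[p]) ^ e1 * x i)) '' H with hH'
  have hH'T : TF H' := by
    refine ⟨hH.1.image _, ?_⟩
    rintro _ ⟨h, hh, rfl⟩
    exact (hH.2 h hh).comp fun i => (Tate.const _).mul (Tate.coord i)
  have hR := hQ ι H' P hH'T hP (by simp only [hPd]; exact hD)
  have hR2 : Res ((fun g z => g (PR.dl (Fin.cons e fun _ => e1 : Fin (n+1) → ℕ) z)) '' (lft H ∪ Set.range f)) := by
    refine hR.of ?_
    rintro _ ⟨g, hg, rfl⟩ π hπ hm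
    simp only [dl_cons]
    rcases hg with ⟨h, hh, rfl⟩ | ⟨i, rfl⟩
    · refine MZ.congr (hm _ (Or.inl ⟨_, ⟨h, hh, rfl⟩, rfl⟩)) fun x => ?_
      simp
    · refine MZ.congr (((MZ.const (c i)).mul (MZ.unit ((hu i).comp hπ) 1 one_ne_zero
        (fun x => by rw [hu1, norm_one]))).mul (hm _ (Or.inr ⟨i, rfl⟩))) fun x => ?_
      exact hfac i (π x)
  refine ⟨e + e1 + 1, by omega, hR2.dl_le ?_⟩
  intro i
  refine Fin.cases ?_ (fun j => ?_) i
  · simp; omega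
  · simp; omega

end PR

namespace PR
variable {p : ℕ} [hp : Fact p.Prime] {n : ℕ}

lemma coeff_taylor_top {R : Type*} [CommRing R] (r : R) (Q : Polynomial R) (k : ℕ) (h : Q.natDegree ≤ k) :
    (Q.taylor r).coeff k = Q.coeff k := by
  rcases h.eq_or_lt with h | h
  · subst h
    exact Polynomial.coeff_taylor_natDegree ..
  · rw [Polynomial.coeff_eq_zero_of_natDegree_lt h, Polynomial.coeff_eq_zero_of_natDegree_lt (by
      rwa [Polynomial.natDegree_taylor])]

lemma nextCoeff_taylor {R : Type*} [CommRing R] [Nontrivial R] (r : R) (P : Polynomial R) (hP : P.Monic) :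
    (P.taylor r).nextCoeff = P.nextCoeff + P.natDegree * r := by
  rcases hk : P.natDegree with _ | k
  · rw [Polynomial.nextCoeff, Polynomial.nextCoeff, Polynomial.natDegree_taylor]
    simp [hk]
  · have hd : (P - Polynomial.X ^ (k+1)).natDegree ≤ k := by
      rw [Polynomial.natDegree_le_iff_coeff_eq_zero]
      intro N hN
      rw [Polynomial.coeff_sub, Polynomial.coeff_X_pow]
      split_ifs with h
      · subst h
        rw [← hk, hP.coeff_natDegree, sub_self]
      · rw [Polynomial.coeff_eq_zero_of_natDegree_lt (by omega), sub_self]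
    rw [Polynomial.nextCoeff, Polynomial.nextCoeff, Polynomial.natDegree_taylor, hk]
    simp only [Nat.add_eq_zero_iff, one_ne_zero, and_false, if_false, Nat.add_sub_cancel]
    have h1 := coeff_taylor_top r _ k hd
    rw [map_sub, Polynomial.coeff_sub, Polynomial.coeff_sub, Polynomial.taylor_X_pow,
      Polynomial.coeff_X_add_C_pow, Polynomial.coeff_X_pow] at h1
    simp at h1
    push_cast
    linear_combination h1

/-- translation of a polynomial -/
noncomputable def trP (t0 : ℤ_[p]) (x0 : Fin n → ℤ_[p]) (P : Polynomial (TR p n)) : Polynomial (TR p n) :=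
  (P.map (pull (fun x => x0 + x) (fun i => (Tate.const (x0 i)).add (Tate.coord i)))).taylor ⟨fun _ => t0, Tate.const t0⟩

lemma pev_trP (t0 : ℤ_[p]) (x0 : Fin n → ℤ_[p]) (P : Polynomial (TR p n)) (z : Fin (n+1) → ℤ_[p]) :
    pev (trP t0 x0 P) z = pev P (Fin.cons t0 x0 + z) := by
  rw [trP, pev_taylor, pev_map]
  congr 1
  ext1 i
  refine Fin.cases ?_ (fun j => ?_) i
  · simp [add_comm]
  · simp [Fin.tail]

lemma nontriv_TR : Nontrivial (TR p n) := ⟨⟨0, 1, fun h => by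
  have := congrFun (congrArg Subtype.val h) (fun _ => 0)
  simp at this⟩⟩

lemma trP_monic (t0 : ℤ_[p]) (x0 : Fin n → ℤ_[p]) {P : Polynomial (TR p n)} (hP : P.Monic) : (trP t0 x0 P).Monic := by
  have := nontriv_TR (p := p) (n := n)
  rw [Polynomial.Monic, trP, Polynomial.leadingCoeff_taylor]
  exact hP.map _

lemma trP_natDegree (t0 : ℤ_[p]) (x0 : Fin n → ℤ_[p]) {P : Polynomial (TR p n)} (hP : P.Monic) :
    (trP t0 x0 P).natDegree = P.natDegree := by
  have := nontriv_TR (p := p) (n := n)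
  rw [trP, Polynomial.natDegree_taylor, hP.natDegree_map]

lemma trP_eval (t0 : ℤ_[p]) (x0 : Fin n → ℤ_[p]) (P : Polynomial (TR p n)) :
    (trP t0 x0 P).map (evalAt fun _ => 0) = (P.map (evalAt x0)).taylor t0 := by
  rw [trP, Polynomial.map_taylor, Polynomial.map_map]
  have h : (evalAt (fun _ => 0)).comp (pull (fun x => x0 + x) (fun i => (Tate.const (x0 i)).add (Tate.coord i))) = evalAt (p := p) x0 := by
    ext1 f
    change f.1 (x0 + fun _ => 0) = f.1 x0
    exact congrArg f.1 (add_zero x0)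
  rw [h]
  rfl

lemma monic_eq_X_pow {R : Type*} [CommRing R] {P : Polynomial R} (hP : P.Monic) {d : ℕ} (hd : P.natDegree = d)
    (h : ∀ j < d, P.coeff j = 0) : P = Polynomial.X ^ d := by
  ext j
  rw [Polynomial.coeff_X_pow]
  split_ifs with hj
  · subst hj; subst hd; exact hP.coeff_natDegree
  · rcases lt_or_gt_of_ne hj with h1 | h1
    · exact h j h1
    · exact Polynomial.coeff_eq_zero_of_natDegree_lt (by omega)

lemma taylor_eq_X_pow {q : Polynomial ℤ_[p]} {t0 : ℤ_[p]} {d : ℕ} (h : q.taylor t0 = Polynomial.X ^ d) :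
    q = (Polynomial.X - Polynomial.C t0) ^ d := by
  apply Polynomial.taylor_injective t0
  rw [h, Polynomial.taylor_pow, map_sub, Polynomial.taylor_X, Polynomial.taylor_C, add_sub_cancel_right]

lemma caseII {D : ℕ} (hQ : ∀ D' < D, QQ p n D') {ι : Type} [Fintype ι] (H : Set ((Fin n → ℤ_[p]) → ℤ_[p]))
    (hH : TF H) (P : ι → Polynomial (TR p n)) (hP : ∀ i, (P i).Monic) (hD : ∑ i, (P i).natDegree = D)
    (t0 : ℤ_[p]) (x0 : Fin n → ℤ_[p])
    (hne : ¬ ∀ i, (P i).map (evalAt x0) = (Polynomial.X - Polynomial.C t0) ^ (P i).natDegree) :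
    ∃ E : ℕ, 1 ≤ E ∧ Res ((fun f z => f ((Fin.cons t0 x0 : Fin (n+1) → ℤ_[p]) + PR.dl (fun _ => E) z)) ''
      (lft H ∪ Set.range fun i => pev (P i))) := by
  classical
  set P' : ι → Polynomial (TR p n) := fun i => trP t0 x0 (P i) with hP'
  have htop : ∀ i, ((P' i).coeff (P i).natDegree).1 (fun _ => 0) = 1 := by
    intro i
    have := (trP_monic t0 x0 (hP i)).coeff_natDegree
    rw [trP_natDegree t0 x0 (hP i)] at this
    simp only [hP']
    rw [this]
    rfl
  have hex : ∀ i, ∃ d, ((P' i).coeff d).1 (fun _ => 0) ≠ 0 := fun i => ⟨_, by rw [htop i]; exact one_ne_zero⟩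
  have hle : ∀ i, Nat.find (hex i) ≤ (P i).natDegree := fun i => Nat.find_min' _ (by rw [htop i]; exact one_ne_zero)
  have hlt : ∑ i, Nat.find (hex i) < D := by
    rw [← hD]
    refine Finset.sum_lt_sum (fun i _ => hle i) ?_
    by_contra hc
    push Not at hc
    apply hne
    intro i
    have h1 : Nat.find (hex i) = (P i).natDegree := le_antisymm (hle i) (hc i (Finset.mem_univ i))
    apply taylor_eq_X_pow
    rw [← trP_eval]
    refine monic_eq_X_pow ((trP_monic t0 x0 (hP i)).map _) ?_ ?_
    · rw [(trP_monic t0 x0 (hP i)).natDegree_map, trP_natDegree t0 x0 (hP i)]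
    · intro j hj
      rw [Polynomial.coeff_map]
      have := Nat.find_min (hex i) (m := j) (by omega)
      exact not_not.1 this
  set H' : Set ((Fin n → ℤ_[p]) → ℤ_[p]) := (fun h x => h (x0 + x)) '' H with hH'
  have hH'T : TF H' := by
    refine ⟨hH.1.image _, ?_⟩
    rintro _ ⟨h, hh, rfl⟩
    exact (hH.2 h hh).comp fun i => (Tate.const _).add (Tate.coord i)
  obtain ⟨E, hE, hR⟩ := wstep (hQ _ hlt) (fun i => pev (P' i)) H' hH'T (fun i => (P' i : PowerSeries (TR p n)))
    (fun i z => pev_expansion _ z) (fun i => Nat.find (hex i))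
    (fun i j hj => by
      rw [Polynomial.coeff_coe]
      exact not_not.1 (Nat.find_min (hex i) hj))
    (fun i => by
      rw [Polynomial.coeff_coe]
      exact Nat.find_spec (hex i)) rfl
  refine ⟨E, hE, hR.mono ?_⟩
  rintro _ ⟨g, hg, rfl⟩
  rcases hg with ⟨h, hh, rfl⟩ | ⟨i, rfl⟩
  · refine ⟨_, Or.inl ⟨_, ⟨h, hh, rfl⟩, rfl⟩, ?_⟩
    funext z
    simp only []
    congr 1
  · refine ⟨_, Or.inr ⟨i, rfl⟩, ?_⟩
    funext z
    simp only [hP']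
    rw [pev_trP]

/-- monomial function -/
noncomputable def mon (β : Fin n → ℕ) : TR p n :=
  ⟨fun x => ∏ i, x i ^ β i, Tate.prod _ fun i _ => (Tate.coord i).pow _⟩

lemma blowB_eval {B : Polynomial (TR p n)} (hB : B.Monic) (s : TR p n) (x : Fin n → ℤ_[p]) (t w : ℤ_[p])
    (hs : s.1 x = p * t * w) :
    (B.scaleRoots s).eval₂ (evalAt x) t = t ^ B.natDegree * (1 + p * ∑ k ∈ Finset.range B.natDegree,
      (B.coeff k).1 x * (p : ℤ_[p]) ^ (B.natDegree - k - 1) * w ^ (B.natDegree - k)) := by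
  rw [Polynomial.eval₂_eq_sum_range, Polynomial.natDegree_scaleRoots, Finset.sum_range_succ, mul_add, mul_one, add_comm]
  congr 1
  · rw [Polynomial.coeff_scaleRoots, hB.coeff_natDegree]
    simp
  · rw [Finset.mul_sum, Finset.mul_sum]
    refine Finset.sum_congr rfl fun k hk => ?_
    have hk := Finset.mem_range.1 hk
    rw [Polynomial.coeff_scaleRoots, evalAt_apply]
    have : (B.coeff k * s ^ (B.natDegree - k)).1 x = (B.coeff k).1 x * (p * t * w) ^ (B.natDegree - k) := by
      rw [← hs]; rfl
    rw [this]
    obtain ⟨m, hm⟩ := Nat.exists_eq_add_of_lt hk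
    have h1 : B.natDegree - k = m + 1 := by omega
    rw [h1, hm]
    simp only [Nat.add_sub_cancel]
    ring

end PR

namespace PR
variable {p : ℕ} [hp : Fact p.Prime] {n : ℕ}

lemma mon_cancel (g : TR p n) (β : Fin n → ℕ) (h : g * mon β = 0) : g = 0 := by
  have hae : ∀ᵐ x : Fin n → ℤ_[p], ∀ i, x i ≠ 0 := by
    rw [ae_all_iff]
    intro i
    cases n with
    | zero => exact i.elim0
    | succ n => exact ae_coord i
  have hd := Measure.dense_of_ae hae
  have hc : Continuous g.1 := Tate.continuous g.2
  apply Subtype.ext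
  refine hc.ext_on hd continuous_zero ?_
  intro x hx
  have h1 : g.1 x * ∏ i, x i ^ β i = 0 := congrFun (congrArg Subtype.val h) x
  have h2 : ∏ i, x i ^ β i ≠ 0 := Finset.prod_ne_zero_iff.2 fun i _ => pow_ne_zero _ (hx i)
  exact (mul_eq_zero.1 h1).resolve_right h2

lemma prod_split (x : Fin n → ℤ_[p]) (β : Fin n → ℕ) (l : Fin n) (hl : 0 < β l) :
    ∏ i, x i ^ β i = x l * ∏ i, x i ^ (Function.update β l (β l - 1)) i := by
  classical
  rw [← Finset.mul_prod_erase Finset.univ (fun i => x i ^ β i) (Finset.mem_univ l),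
    ← Finset.mul_prod_erase Finset.univ (fun i => x i ^ (Function.update β l (β l - 1)) i) (Finset.mem_univ l)]
  rw [Function.update_self, ← mul_assoc, ← pow_succ', Nat.sub_add_cancel hl]
  congr 1
  refine Finset.prod_congr rfl fun i hi => ?_
  rw [Function.update_of_ne (Finset.ne_of_mem_erase hi)]

/-- coordinate as element of the ring -/
def crd (l : Fin n) : TR p n := ⟨fun x => x l, Tate.coord l⟩

lemma mon_split (β : Fin n → ℕ) (l : Fin n) (hl : 0 < β l) :
    (mon β : TR p n) = mon (Function.update β l (β l - 1)) * crd l := by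
  apply Subtype.ext
  funext x
  exact (prod_split x β l hl).trans (mul_comm _ _)

lemma sum_split (β : Fin n → ℕ) (l : Fin n) (hl : 0 < β l) :
    ∑ i, (Function.update β l (β l - 1)) i + 1 = ∑ i, β i := by
  classical
  rw [← Finset.add_sum_erase Finset.univ β (Finset.mem_univ l),
    ← Finset.add_sum_erase Finset.univ (Function.update β l (β l - 1)) (Finset.mem_univ l)]
  rw [Function.update_self]
  have : ∑ i ∈ Finset.univ.erase l, (Function.update β l (β l - 1)) i = ∑ i ∈ Finset.univ.erase l, β i :=
    Finset.sum_congr rfl fun i hi => by rw [Function.update_of_ne (Finset.ne_of_mem_erase hi)]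
  rw [this]
  omega

lemma q3_zero {D : ℕ} (hD0 : 0 < D) (hQ : ∀ D' < D, QQ p n D') {ι : Type} [Fintype ι]
    (B : ι → Polynomial (TR p n)) (hB : ∀ i, (B i).Monic) (hD : ∑ i, (B i).natDegree = D)
    (hnc : ∑ i, (B i).nextCoeff = 0) (i0 : ι) (k0 : ℕ) (hk0 : k0 < (B i0).natDegree)
    (hnz : ∀ x, ((B i0).coeff k0).1 x ≠ 0) (H : Set ((Fin n → ℤ_[p]) → ℤ_[p])) (hH : TF H) :
    Res (lft H ∪ Set.range fun i => pev (B i)) := by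
  refine Res.loc fun y => ?_
  have hy : y = Fin.cons (y 0) (Fin.tail y) := (Fin.cons_self_tail y).symm
  rw [hy]
  obtain ⟨E, -, hE⟩ := caseII hQ H hH B hB hD (y 0) (Fin.tail y) (by
    intro hall
    set x0 := Fin.tail y
    have h1 : ∀ i, evalAt x0 (B i).nextCoeff = - ((B i).natDegree : ℤ_[p]) * y 0 := by
      intro i
      rw [← Polynomial.nextCoeff_map_of_leadingCoeff_ne_zero (evalAt x0) (by
        rw [(hB i).leadingCoeff, map_one]; exact one_ne_zero), hall i,
        (Polynomial.monic_X_sub_C _).nextCoeff_pow, Polynomial.nextCoeff_X_sub_C]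
      simp
    have h2 : evalAt x0 (∑ i, (B i).nextCoeff) = - (D : ℤ_[p]) * y 0 := by
      rw [map_sum, Finset.sum_congr rfl fun i _ => h1 i, ← Finset.sum_mul, Finset.sum_neg_distrib, ← hD]
      push_cast
      rfl
    rw [hnc, map_zero] at h2
    have h3 : y 0 = 0 := by
      have hDne : (D : ℤ_[p]) ≠ 0 := by exact_mod_cast hD0.ne'
      have := (mul_eq_zero.1 h2.symm).resolve_left (neg_ne_zero.2 hDne)
      exact this
    have h4 := congrArg (fun q => Polynomial.coeff q k0) (hall i0)
    simp only [h3, Polynomial.coeff_map, map_zero, sub_zero, Polynomial.coeff_X_pow, if_neg hk0.ne] at h4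
    exact hnz x0 h4)
  exact ⟨E, hE⟩

lemma q3 {D : ℕ} (hD0 : 0 < D) (hQ : ∀ D' < D, QQ p n D') {ι : Type} [Fintype ι]
    (B : ι → Polynomial (TR p n)) (hB : ∀ i, (B i).Monic) (hD : ∑ i, (B i).natDegree = D)
    (hnc : ∑ i, (B i).nextCoeff = 0) (i0 : ι) (k0 : ℕ) (hk0 : k0 < (B i0).natDegree)
    (hnz : ∀ x, ((B i0).coeff k0).1 x ≠ 0) (N : ℕ) : ∀ (β : Fin n → ℕ) (_ : ∑ i, β i = N)
    (H : Set ((Fin n → ℤ_[p]) → ℤ_[p])) (_ : TF H) (_ : ∀ h ∈ H, MZ h),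
    Res (lft H ∪ Set.range fun i => pev ((B i).scaleRoots (mon β))) := by
  induction N with
  | zero =>
    intro β hβ H hH _
    have hβ0 : ∀ i, β i = 0 := fun i => (Finset.sum_eq_zero_iff.1 hβ) i (Finset.mem_univ i)
    have : (mon β : TR p n) = 1 := by
      apply Subtype.ext
      funext x
      change ∏ i, x i ^ β i = 1
      simp [hβ0]
    simp only [this, Polynomial.scaleRoots_one]
    exact q3_zero hD0 hQ B hB hD hnc i0 k0 hk0 hnz H hH
  | succ N ih =>
    intro β hβ H hH hHM
    obtain ⟨l, hl⟩ : ∃ l, 0 < β l := by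
      by_contra hc
      push Not at hc
      have : ∑ i, β i = 0 := Finset.sum_eq_zero fun i _ => Nat.le_zero.1 (hc i)
      omega
    set β' := Function.update β l (β l - 1) with hβ'
    have hs : ∑ i, β' i = N := by have := sum_split β l hl; rw [← hβ'] at this; omega
    refine Res.of_cover (cover_blow 0 l.succ (Fin.succ_ne_zero l).symm) ?_
    intro k hk
    simp only [List.mem_cons, List.not_mem_nil, or_false] at hk
    rcases hk with rfl | rfl
    · have hI := ih β' hs (insert (fun x => x l) H) ⟨hH.1.insert _, by
        rintro f (rfl | hf)
        · exact Tate.coord l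
        · exact hH.2 f hf⟩ (by
        rintro f (rfl | hf)
        · exact MZ.coord l
        · exact hHM f hf)
      refine hI.of ?_
      intro f hf π hπ hm
      have hml := hm _ (Or.inl ⟨_, Set.mem_insert _ _, rfl⟩)
      rcases hf with rfl | ⟨g, hg | ⟨i, rfl⟩, rfl⟩
      · refine MZ.congr hml fun x => ?_
        simp [blow, Fin.tail]
      · obtain ⟨h, hh, rfl⟩ := hg
        refine MZ.congr (hm _ (Or.inl ⟨_, Set.mem_insert_of_mem _ hh, rfl⟩)) fun x => ?_
        simp [blow, Fin.tail_update_zero]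
      · refine MZ.congr ((hml.pow (B i).natDegree).mul (hm _ (Or.inr ⟨i, rfl⟩))) fun x => ?_
        simp only [blow, pev, Fin.tail_update_zero, Function.update_self, one_mul]
        rw [mon_split β l hl, Polynomial.scaleRoots_mul]
        have := Polynomial.scaleRoots_eval₂_mul (p := (B i).scaleRoots (mon β')) (evalAt (Fin.tail (π x))) (π x 0) (crd l)
        rw [Polynomial.natDegree_scaleRoots] at this
        exact this
    · have hco : ∀ j, MZ (fun z : Fin (n+1) → ℤ_[p] => (blow l.succ 0 (p : ℤ_[p])).π z j) := by
        intro j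
        by_cases hj : j = l.succ
        · subst hj
          simp only [blow, Function.update_self]
          exact ((MZ.const _).mul (MZ.coord 0)).mul (MZ.coord _)
        · simp only [blow, Function.update_of_ne hj]
          exact MZ.coord j
      refine Res.trivial ?_
      rintro f (rfl | ⟨g, hg | ⟨i, rfl⟩, rfl⟩)
      · exact (MZ.const _).mul (MZ.coord 0)
      · obtain ⟨h, hh, rfl⟩ := hg
        exact (hHM h hh).tail.comp (blow l.succ 0 (p : ℤ_[p])).hπ hco
      · have hπ := (blow l.succ 0 (p : ℤ_[p])).hπ
        set π := (blow l.succ 0 (p : ℤ_[p])).π with hπdef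
        have hz0 : ∀ z, π z 0 = z 0 := fun z => by
          simp only [hπdef, blow]
          rw [Function.update_of_ne (Fin.succ_ne_zero l).symm]
        have htl : ∀ z, Fin.tail (π z) l = p * z 0 * z l.succ := fun z => by
          simp [hπdef, blow, Fin.tail]
        have hmon : ∀ z, (mon β : TR p n).1 (Fin.tail (π z)) = p * z 0 * (z l.succ * (mon β' : TR p n).1 (Fin.tail (π z))) := by
          intro z
          refine (prod_split (Fin.tail (π z)) β l hl).trans ?_
          rw [htl]
          simp only [mon, hβ']
          ring
        have htail : ∀ j, Tate p (n+1) (fun z => Fin.tail (π z) j) := fun j => hπ j.succ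
        have hcf : ∀ g : TR p n, Tate p (n+1) (fun z => g.1 (Fin.tail (π z))) := fun g => Tate.comp g.2 htail
        set r : (Fin (n+1) → ℤ_[p]) → ℤ_[p] := fun z => ∑ k ∈ Finset.range (B i).natDegree,
          ((B i).coeff k).1 (Fin.tail (π z)) * (p : ℤ_[p]) ^ ((B i).natDegree - k - 1) *
            (z l.succ * (mon β' : TR p n).1 (Fin.tail (π z))) ^ ((B i).natDegree - k) with hr
        have hrT : Tate p (n+1) r := Tate.sum _ fun k _ =>
          ((hcf _).mul (Tate.const _)).mul (((Tate.coord _).mul (hcf _)).pow _)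
        refine MZ.congr (((MZ.coord 0).pow (B i).natDegree).mul (MZ.unit ((Tate.const 1).add ((Tate.const (p : ℤ_[p])).mul hrT)) 1
          one_ne_zero fun z => by rw [norm_one]; exact norm_one_add _ (norm_p_mul_lt _))) fun z => ?_
        simp only [pev, hz0]
        exact blowB_eval (hB i) (mon β) _ _ _ (hmon z)

end PR

namespace PR
variable {p : ℕ} [hp : Fact p.Prime] {n : ℕ}

lemma descale {R : Type*} [CommRing R] [Nontrivial R] {P : Polynomial R} (hP : P.Monic) (s : R) (b : ℕ → R)
    (h : ∀ k < P.natDegree, P.coeff k = b k * s ^ (P.natDegree - k)) :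
    ∃ B : Polynomial R, B.Monic ∧ B.natDegree = P.natDegree ∧ (∀ k < P.natDegree, B.coeff k = b k) ∧
      B.scaleRoots s = P := by
  set d := P.natDegree with hd
  set S : Polynomial R := ∑ k ∈ Finset.range d, Polynomial.C (b k) * Polynomial.X ^ k with hS
  have hc : ∀ m, S.coeff m = if m < d then b m else 0 := by
    intro m
    rw [hS, Polynomial.finset_sum_coeff]
    simp only [Polynomial.coeff_C_mul_X_pow]
    rw [Finset.sum_ite_eq]
    simp
  have hdeg : S.degree < d := by
    rw [Polynomial.degree_lt_iff_coeff_zero]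
    intro m hm
    rw [hc, if_neg (by omega)]
  have hM : (Polynomial.X ^ d + S).Monic := Polynomial.monic_X_pow_add hdeg
  have hN : (Polynomial.X ^ d + S).natDegree = d := by
    rw [Polynomial.natDegree_add_eq_left_of_degree_lt, Polynomial.natDegree_X_pow]
    rwa [Polynomial.degree_X_pow]
  have hco : ∀ k < d, (Polynomial.X ^ d + S).coeff k = b k := by
    intro k hk
    rw [Polynomial.coeff_add, hc, if_pos hk, Polynomial.coeff_X_pow, if_neg hk.ne, zero_add]
  refine ⟨_, hM, hN, hco, ?_⟩
  ext k
  rw [Polynomial.coeff_scaleRoots, hN]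
  rcases lt_trichotomy k d with hk | hk | hk
  · rw [hco k hk, h k hk]
  · subst hk
    have h1 := hM.coeff_natDegree
    rw [hN] at h1
    rw [h1, hP.coeff_natDegree]
    simp
  · rw [Polynomial.coeff_eq_zero_of_natDegree_lt (by omega), Polynomial.coeff_eq_zero_of_natDegree_lt (by omega), zero_mul]

lemma nextCoeff_scale {R : Type*} [CommRing R] (B : Polynomial R) (s : R) :
    (B.scaleRoots s).nextCoeff = B.nextCoeff * s := by
  rw [Polynomial.nextCoeff, Polynomial.nextCoeff, Polynomial.natDegree_scaleRoots]
  split_ifs with h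
  · simp
  · rw [Polynomial.coeff_scaleRoots]
    have : B.natDegree - (B.natDegree - 1) = 1 := by omega
    rw [this, pow_one]

lemma nextCoeff_pull {g : (Fin n → ℤ_[p]) → (Fin n → ℤ_[p])}
    (hg : ∀ i, Tate p n (fun x => g x i)) {P : Polynomial (TR p n)} (hP : P.Monic) :
    (P.map (pull g hg)).nextCoeff = pull g hg P.nextCoeff := by
  have := nontriv_TR (p := p) (n := n)
  exact Polynomial.nextCoeff_map_of_leadingCoeff_ne_zero _ (by rw [hP.leadingCoeff, map_one]; exact one_ne_zero)

/-- reduction of a resolution problem along a lifted cover -/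
lemma res_lift_cover {ι : Type} {H : Set ((Fin n → ℤ_[p]) → ℤ_[p])} {P : ι → Polynomial (TR p n)}
    {C : List (Leaf p n)} (hC : IsCover C)
    (h : ∀ l ∈ C, Res (lft (insert l.J ((fun h x => h (l.π x)) '' H)) ∪
      Set.range fun i => pev ((P i).map (pull l.π l.hπ)))) :
    Res (lft H ∪ Set.range fun i => pev (P i)) := by
  refine Res.of_cover hC.lift ?_
  intro k hk
  rw [List.mem_map] at hk
  obtain ⟨l, hl, rfl⟩ := hk
  refine (h l hl).mono ?_
  rintro f (rfl | ⟨g, ⟨h, hh, rfl⟩ | ⟨i, rfl⟩, rfl⟩)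
  · exact Or.inl ⟨_, Set.mem_insert _ _, rfl⟩
  · refine Or.inl ⟨_, Set.mem_insert_of_mem _ ⟨h, hh, rfl⟩, ?_⟩
    funext z
    simp [Leaf.lift]
  · refine Or.inr ⟨i, ?_⟩
    funext z
    simp only []
    rw [pev_map]
    rfl

lemma tf_cover {H : Set ((Fin n → ℤ_[p]) → ℤ_[p])} (hH : TF H) (l : Leaf p n) :
    TF (insert l.J ((fun h x => h (l.π x)) '' H)) := by
  refine ⟨(hH.1.image _).insert _, ?_⟩
  rintro f (rfl | ⟨h, hh, rfl⟩)
  · exact l.hJ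
  · exact (hH.2 h hh).comp l.hπ

lemma q2 {D : ℕ} (hD0 : 0 < D) (hQ : ∀ D' < D, QQ p n D') {ι : Type} [Fintype ι]
    (H : Set ((Fin n → ℤ_[p]) → ℤ_[p])) (hH : TF H) (hHM : ∀ h ∈ H, MZ h)
    (P : ι → Polynomial (TR p n)) (hP : ∀ i, (P i).Monic) (hD : ∑ i, (P i).natDegree = D)
    (hnc : ∑ i, (P i).nextCoeff = 0)
    (hc : ∀ i, ∀ k < (P i).natDegree, MZ ((P i).coeff k).1)
    (hdf : ∀ i, ∀ k < (P i).natDegree, ∀ i', ∀ k' < (P i').natDegree,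
      MZ (fun x => ((P i).coeff k).1 x ^ (D.factorial / ((P i).natDegree - k)) -
        ((P i').coeff k').1 x ^ (D.factorial / ((P i').natDegree - k')))) :
    Res (lft H ∪ Set.range fun i => pev (P i)) := by
  classical
  by_cases hall : ∀ i, ∀ k < (P i).natDegree, ∀ x, ((P i).coeff k).1 x = 0
  · refine Res.trivial ?_
    rintro f (⟨h, hh, rfl⟩ | ⟨i, rfl⟩)
    · exact (hHM h hh).tail
    · have : P i = Polynomial.X ^ (P i).natDegree := monic_eq_X_pow (hP i) rfl fun j hj =>
        Subtype.ext (funext (hall i j hj))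
      refine MZ.congr ((MZ.coord 0).pow (P i).natDegree) fun z => ?_
      simp only []
      rw [this, pev]
      simp
  -- index type of the nonzero coefficients
  set N := D.factorial with hN
  have hN0 : 0 < N := Nat.factorial_pos _
  let A := {q : Σ i, Fin (P i).natDegree // ¬ ∀ x, ((P q.1).coeff q.2).1 x = 0}
  let jj : (Σ i, Fin (P i).natDegree) → ℕ := fun q => (P q.1).natDegree - q.2
  have hjj0 : ∀ q, 0 < jj q := fun q => by have := q.2.2; simp only [jj]; omega
  have hjd : ∀ q, jj q ∣ N := by
    intro q
    refine Nat.dvd_factorial (hjj0 q) ?_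
    have h1 : (P q.1).natDegree ≤ D := by
      rw [← hD]
      exact Finset.single_le_sum (f := fun i => (P i).natDegree) (fun _ _ => Nat.zero_le _) (Finset.mem_univ q.1)
    simp only [jj]
    omega
  have hA : Nonempty A := by
    push Not at hall
    obtain ⟨i, k, hk, x, hx⟩ := hall
    exact ⟨⟨⟨i, ⟨k, hk⟩⟩, fun h => hx (h x)⟩⟩
  have hex : ∀ q : A, ∃ (α : Fin n → ℕ) (u : (Fin n → ℤ_[p]) → ℤ_[p]) (c : ℤ_[p]),
      Tate p n u ∧ c ≠ 0 ∧ (∀ x, ‖u x‖ = ‖c‖) ∧ ∀ x, ((P q.1.1).coeff q.1.2).1 x = (∏ i, x i ^ α i) * u x :=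
    fun q => (hc q.1.1 q.1.2 q.1.2.2).resolve_left q.2
  choose α u c hu hcne hun hfac using hex
  obtain ⟨q0, hq0⟩ := Finite.exists_min (fun q : A => ∑ i, α q i * (N / jj q.1))
  have hcmp : ∀ q : A, ∀ i, α q0 i * (N / jj q0.1) ≤ α q i * (N / jj q.1) := by
    intro q
    have h1 := hdf q0.1.1 q0.1.2 q0.1.2.2 q.1.1 q.1.2 q.1.2.2
    have h2 := compare (α := fun i => α q0 i * (N / jj q0.1)) (β := fun i => α q i * (N / jj q.1))
      (u := fun x => u q0 x ^ (N / jj q0.1)) (v := fun x => u q x ^ (N / jj q.1))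
      (c := c q0 ^ (N / jj q0.1)) (d := c q ^ (N / jj q.1)) (pow_ne_zero _ (hcne q0)) (pow_ne_zero _ (hcne q))
      (fun x => by simp only [norm_pow, hun]) (fun x => by simp only [norm_pow, hun])
      (h1.congr fun x => by
        rw [hfac q0, hfac q, mul_pow, mul_pow, ← Finset.prod_pow, ← Finset.prod_pow]
        simp only [pow_mul]
        rfl)
    rcases h2 with h2 | h2
    · exact h2
    · have h3 := (Finset.sum_eq_sum_iff_of_le (fun i _ => h2 i)).1 (le_antisymm (Finset.sum_le_sum fun i _ => h2 i) (hq0 q))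
      intro i
      exact (h3 i (Finset.mem_univ i)).ge
  set β : Fin n → ℕ := fun i => α q0 i * (N / jj q0.1) with hβ
  obtain ⟨C, hC, hl⟩ := cover_pow (p := p) N hN0 (Finset.univ : Finset (Fin n))
  refine res_lift_cover hC ?_
  intro l hlC
  obtain ⟨⟨qc, hqc, δ, hJ⟩, hπ, -⟩ := hl l hlC
  choose a ha0 ha using fun i => hπ i (Finset.mem_univ i)
  have hb : ∀ q : (Σ i, Fin (P i).natDegree), ∃ b : TR p n,
      (pull l.π l.hπ ((P q.1).coeff q.2) = b * mon β ^ jj q) ∧ (q = q0.1 → ∀ x, b.1 x ≠ 0) := by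
    intro q
    by_cases hq : ∀ x, ((P q.1).coeff q.2).1 x = 0
    · refine ⟨0, ?_, fun h => absurd hq (h ▸ q0.2)⟩
      rw [zero_mul]
      exact Subtype.ext (funext fun x => hq _)
    · set q' : A := ⟨q, hq⟩ with hq'
      refine ⟨mon (fun i => N * α q' i - β i * jj q) * ⟨fun x => (∏ i, a i ^ α q' i) * u q' (l.π x),
        (Tate.const _).mul ((hu q').comp l.hπ)⟩, ?_, ?_⟩
      · apply Subtype.ext
        funext x
        change ((P q.1).coeff q.2).1 (l.π x) = (∏ i, x i ^ (N * α q' i - β i * jj q)) * ((∏ i, a i ^ α q' i) * u q' (l.π x)) *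
          (∏ i, x i ^ β i) ^ jj q
        refine (hfac q' (l.π x)).trans ?_
        have e1 : ∏ i, l.π x i ^ α q' i = (∏ i, a i ^ α q' i) * ((∏ i, x i ^ (N * α q' i - β i * jj q)) * (∏ i, x i ^ β i) ^ jj q) := by
          rw [← Finset.prod_pow, ← Finset.prod_mul_distrib, ← Finset.prod_mul_distrib]
          refine Finset.prod_congr rfl fun i _ => ?_
          rw [ha, mul_pow, ← pow_mul, ← pow_mul, ← pow_add]
          congr 2
          have h1 := hcmp q' i
          have h2 : β i * jj q ≤ N * α q' i := by
            calc β i * jj q ≤ α q' i * (N / jj q) * jj q := Nat.mul_le_mul_right _ h1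
              _ = N * α q' i := by rw [mul_assoc, Nat.div_mul_cancel (hjd q), mul_comm]
          omega
        rw [e1]
        ring
      · intro hqq x
        have hqq' : q' = q0 := Subtype.ext hqq
        have e2 : ∀ i, N * α q' i - β i * jj q = 0 := by
          intro i
          rw [hqq, hqq', hβ]
          simp only []
          rw [mul_assoc, Nat.div_mul_cancel (hjd _), mul_comm, Nat.sub_self]
        change (∏ i, x i ^ (N * α q' i - β i * jj q)) * ((∏ i, a i ^ α q' i) * u q' (l.π x)) ≠ 0
        simp only [e2, pow_zero, Finset.prod_const_one, one_mul]
        refine mul_ne_zero (Finset.prod_ne_zero_iff.2 fun i _ => pow_ne_zero _ (ha0 i)) ?_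
        rw [← norm_ne_zero_iff, hun, norm_ne_zero_iff]
        exact hcne _
  choose b hb1 hb2 using hb
  have hnt := nontriv_TR (p := p) (n := n)
  have hdeg : ∀ i, ((P i).map (pull l.π l.hπ)).natDegree = (P i).natDegree := fun i => (hP i).natDegree_map _
  have hB : ∀ i, ∃ B : Polynomial (TR p n), B.Monic ∧ B.natDegree = (P i).natDegree ∧
      (∀ k : Fin (P i).natDegree, B.coeff k = b ⟨i, k⟩) ∧ B.scaleRoots (mon β) = (P i).map (pull l.π l.hπ) := by
    intro i
    obtain ⟨B, h1, h2, h3, h4⟩ := descale ((hP i).map (pull l.π l.hπ)) (mon β)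
      (fun k => if h : k < (P i).natDegree then b ⟨i, ⟨k, h⟩⟩ else 0) (by
        intro k hk
        rw [hdeg] at hk ⊢
        rw [Polynomial.coeff_map, dif_pos hk]
        exact hb1 ⟨i, ⟨k, hk⟩⟩)
    refine ⟨B, h1, by rw [h2, hdeg], fun k => ?_, h4⟩
    rw [h3 k (by rw [hdeg]; exact k.2), dif_pos k.2]
  choose B hB1 hB2 hB3 hB4 using hB
  have hncB : ∑ i, (B i).nextCoeff = 0 := by
    apply mon_cancel _ β
    rw [Finset.sum_mul]
    have : ∀ i, (B i).nextCoeff * mon β = pull l.π l.hπ (P i).nextCoeff := by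
      intro i
      rw [← nextCoeff_scale, hB4, nextCoeff_pull _ (hP i)]
    rw [Finset.sum_congr rfl fun i _ => this i, ← map_sum, hnc, map_zero]
  have hfin := q3 hD0 hQ B hB1 (by simp only [hB2]; exact hD) hncB q0.1.1 q0.1.2 (by rw [hB2]; exact q0.1.2.2)
    (by rw [hB3]; exact hb2 _ rfl) _ β rfl _ (tf_cover hH l) (by
      rintro f (rfl | ⟨h, hh, rfl⟩)
      · exact ((MZ.const qc).mul (MZ.prod _ fun i _ => (MZ.coord i).pow (δ i))).congr hJ
      · exact (hHM h hh).comp l.hπ fun i => ((MZ.const (a i)).mul ((MZ.coord i).pow N)).congr (ha i))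
  simpa only [hB4] using hfin

lemma q1 {D : ℕ} (hD0 : 0 < D) (hM : MM p n) (hQ : ∀ D' < D, QQ p n D') {ι : Type} [Fintype ι]
    (H : Set ((Fin n → ℤ_[p]) → ℤ_[p])) (hH : TF H)
    (P : ι → Polynomial (TR p n)) (hP : ∀ i, (P i).Monic) (hD : ∑ i, (P i).natDegree = D)
    (hnc : ∑ i, (P i).nextCoeff = 0) :
    Res (lft H ∪ Set.range fun i => pev (P i)) := by
  have hnt := nontriv_TR (p := p) (n := n)
  set cf : (Σ i, Fin (P i).natDegree) → (Fin n → ℤ_[p]) → ℤ_[p] := fun q => ((P q.1).coeff q.2).1 with hcf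
  set df : (Σ i, Fin (P i).natDegree) × (Σ i, Fin (P i).natDegree) → (Fin n → ℤ_[p]) → ℤ_[p] :=
    fun q x => ((P q.1.1).coeff q.1.2).1 x ^ (D.factorial / ((P q.1.1).natDegree - q.1.2)) -
        ((P q.2.1).coeff q.2.2).1 x ^ (D.factorial / ((P q.2.1).natDegree - q.2.2)) with hdf
  obtain ⟨C, hC, hl⟩ := hM (H ∪ (Set.range cf ∪ Set.range df)) (by
    refine ⟨hH.1.union ((Set.finite_range _).union (Set.finite_range _)), ?_⟩
    rintro f (hf | ⟨q, rfl⟩ | ⟨q, rfl⟩)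
    · exact hH.2 f hf
    · exact ((P q.1).coeff q.2).2
    · exact ((Tate.pow ((P q.1.1).coeff q.1.2).2 _)).sub (Tate.pow ((P q.2.1).coeff q.2.2).2 _))
  refine res_lift_cover hC ?_
  intro l hlC
  have hdeg : ∀ i, ((P i).map (pull l.π l.hπ)).natDegree = (P i).natDegree := fun i => (hP i).natDegree_map _
  refine q2 hD0 hQ _ (tf_cover hH l) ?_ _ (fun i => (hP i).map _) (by simp only [hdeg]; exact hD) ?_ ?_ ?_
  · rintro f (rfl | ⟨h, hh, rfl⟩)
    · exact (hl l hlC).1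
    · exact (hl l hlC).2 h (Or.inl hh)
  · rw [Finset.sum_congr rfl fun i _ => nextCoeff_pull l.hπ (hP i), ← map_sum, hnc, map_zero]
  · intro i k hk
    rw [hdeg] at hk
    rw [Polynomial.coeff_map]
    exact (hl l hlC).2 _ (Or.inr (Or.inl ⟨⟨i, ⟨k, hk⟩⟩, rfl⟩))
  · intro i k hk i' k' hk'
    rw [hdeg] at hk hk'
    simp only [Polynomial.coeff_map, hdeg]
    exact (hl l hlC).2 _ (Or.inr (Or.inr ⟨⟨⟨i, ⟨k, hk⟩⟩, ⟨i', ⟨k', hk'⟩⟩⟩, rfl⟩))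

end PR

namespace PR
variable {p : ℕ} [hp : Fact p.Prime] {n : ℕ}

lemma trP_nextCoeff_zero {t0 : ℤ_[p]} {x0 : Fin n → ℤ_[p]} {P : Polynomial (TR p n)} (hP : P.Monic)
    (h : P.map (evalAt x0) = (Polynomial.X - Polynomial.C t0) ^ P.natDegree) :
    (trP t0 x0 P).nextCoeff.1 (fun _ => 0) = 0 := by
  have h1 : (trP t0 x0 P).map (evalAt fun _ => 0) = Polynomial.X ^ P.natDegree := by
    rw [trP_eval, h, Polynomial.taylor_pow, map_sub, Polynomial.taylor_X, Polynomial.taylor_C, add_sub_cancel_right]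
  rw [Polynomial.nextCoeff]
  split_ifs with h0
  · rfl
  · have h2 := congrArg (fun q => Polynomial.coeff q ((trP t0 x0 P).natDegree - 1)) h1
    simp only [Polynomial.coeff_map, Polynomial.coeff_X_pow] at h2
    rw [trP_natDegree t0 x0 hP] at h2 h0 ⊢
    rw [if_neg (by omega)] at h2
    exact h2

lemma shear_mp (σ : TR p n) (G : (Fin (n+1) → ℤ_[p]) → ℝ≥0∞) (hG : Measurable G) :
    ∫⁻ z : Fin (n+1) → ℤ_[p], G (Fin.cons (z 0 - σ.1 (Fin.tail z)) (Fin.tail z)) = ∫⁻ z, G z := by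
  have hm : Continuous fun z : Fin (n+1) → ℤ_[p] => (Fin.cons (z 0 - σ.1 (Fin.tail z)) (Fin.tail z) : Fin (n+1) → ℤ_[p]) := by
    refine continuous_pi fun i => ?_
    refine Fin.cases ?_ (fun j => ?_) i
    · simp only [Fin.cons_zero]
      have := σ.2.continuous
      refine (continuous_apply 0).sub (this.comp (continuous_pi fun i => continuous_apply _))
    · simp only [Fin.cons_succ, Fin.tail]
      exact continuous_apply _
  rw [fubini 0 _ hG, fubini 0 (fun z => G (Fin.cons (z 0 - σ.1 (Fin.tail z)) (Fin.tail z))) (hG.comp hm.measurable)]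
  refine lintegral_congr fun x => ?_
  simp only [Fin.insertNth_zero', Fin.cons_zero, Fin.tail_cons]
  simp only [sub_eq_add_neg]
  exact lintegral_add_right_eq_self (fun s => G (Fin.cons s x)) (-σ.1 x)

lemma caseI {D : ℕ} (hD0 : 0 < D) (hM : MM p n) (hQ : ∀ D' < D, QQ p n D') {ι : Type} [Fintype ι] (H : Set ((Fin n → ℤ_[p]) → ℤ_[p]))
    (hH : TF H) (P : ι → Polynomial (TR p n)) (hP : ∀ i, (P i).Monic) (hD : ∑ i, (P i).natDegree = D)
    (t0 : ℤ_[p]) (x0 : Fin n → ℤ_[p])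
    (hne : ∀ i, (P i).map (evalAt x0) = (Polynomial.X - Polynomial.C t0) ^ (P i).natDegree) :
    ∃ E : ℕ, Res ((fun f z => f ((Fin.cons t0 x0 : Fin (n+1) → ℤ_[p]) + PR.dl (fun _ => E) z)) ''
      (lft H ∪ Set.range fun i => pev (P i))) := by
  have hnt := nontriv_TR (p := p) (n := n)
  set v := (D : ℤ_[p]).valuation with hv
  obtain ⟨u, hu⟩ := pval_assoc (D : ℤ_[p]) (by exact_mod_cast hD0.ne')
  set P' : ι → Polynomial (TR p n) := fun i => trP t0 x0 (P i) with hP'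
  have hdl : ∀ i, Tate p n (fun x : Fin n → ℤ_[p] => (fun i => (p : ℤ_[p]) ^ v * x i) i) := fun i =>
    (Tate.const _).mul (Tate.coord i)
  set P'' : ι → Polynomial (TR p n) := fun i => (P' i).map (pull (fun x i => (p : ℤ_[p]) ^ v * x i) hdl) with hP''
  have hP'm : ∀ i, (P' i).Monic := fun i => trP_monic t0 x0 (hP i)
  have hP''m : ∀ i, (P'' i).Monic := fun i => (hP'm i).map _
  have hP''d : ∀ i, (P'' i).natDegree = (P i).natDegree := fun i => by
    simp only [hP'']
    rw [(hP'm i).natDegree_map, trP_natDegree t0 x0 (hP i)]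
  obtain ⟨g, hg, hgx⟩ := (∑ i, (P' i).nextCoeff : TR p n).2.diff (fun _ => 0) v
  have hS0 : (∑ i, (P' i).nextCoeff : TR p n).1 (fun _ => 0) = 0 := by
    change evalAt (fun _ => 0) _ = 0
    rw [map_sum]
    exact Finset.sum_eq_zero fun i _ => trP_nextCoeff_zero (hP i) (hne i)
  set σ : TR p n := ⟨fun x => u.1 * g x, (Tate.const _).mul hg⟩ with hσ
  have hS : ∑ i, (P'' i).nextCoeff = (D : TR p n) * σ := by
    have : ∀ i, (P'' i).nextCoeff = pull _ hdl (P' i).nextCoeff := fun i => nextCoeff_pull _ (hP'm i)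
    rw [Finset.sum_congr rfl fun i _ => this i, ← map_sum]
    apply Subtype.ext
    funext x
    have h1 := hgx x
    rw [hS0, zero_add, hu] at h1
    have h2 : ((D : TR p n) * σ).1 x = (D : ℤ_[p]) * (u * g x) := by
      change evalAt x ((D : TR p n) * σ) = _
      rw [map_mul, map_natCast]
      rfl
    rw [h2, ← mul_assoc, ← h1]
    change (∑ i, (P' i).nextCoeff : TR p n).1 _ = _
    refine congrArg (∑ i, (P' i).nextCoeff : TR p n).1 ?_
    ext1 i
    simp only [zero_add]
    rw [← hu]
  have hq := q1 hD0 hM hQ ((fun h x => h (x0 + PR.dl (fun _ => v) x)) '' H) (by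
      refine ⟨hH.1.image _, ?_⟩
      rintro _ ⟨h, hh, rfl⟩
      exact (hH.2 h hh).comp fun i => (Tate.const _).add ((Tate.const _).mul (Tate.coord i)))
    (fun i => (P'' i).taylor (-σ)) (fun i => by
      rw [Polynomial.Monic, Polynomial.leadingCoeff_taylor]; exact hP''m i)
    (by simp only [Polynomial.natDegree_taylor, hP''d]; exact hD) (by
      rw [Finset.sum_congr rfl fun i _ => nextCoeff_taylor (-σ) (P'' i) (hP''m i), Finset.sum_add_distrib,
        ← Finset.sum_mul, hS, ← Nat.cast_sum]
      simp only [hP''d]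
      rw [hD]; ring)
  have ht : ∀ i : Fin (n+1), Tate p (n+1) (fun z : Fin (n+1) → ℤ_[p] =>
      (Fin.cons (z 0 - σ.1 (Fin.tail z)) (Fin.tail z) : Fin (n+1) → ℤ_[p]) i) := by
    intro i
    refine Fin.cases ?_ (fun j => ?_) i
    · simp only [Fin.cons_zero]
      exact (Tate.coord 0).sub (σ.2.comp fun i => Tate.coord _)
    · simp only [Fin.cons_succ, Fin.tail]
      exact Tate.coord _
  have hq2 := hq.auto (fun z => Fin.cons (z 0 + σ.1 (Fin.tail z)) (Fin.tail z))
    (fun z => Fin.cons (z 0 - σ.1 (Fin.tail z)) (Fin.tail z)) ht (fun z => by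
      simp) (fun G hG => shear_mp σ G hG)
  refine ⟨v, ?_⟩
  have hq3 : Res ((fun f z => f (PR.dl (Fin.cons 0 fun _ => v) z)) ''
      ((fun f z => f ((Fin.cons t0 x0 : Fin (n+1) → ℤ_[p]) + z)) '' (lft H ∪ Set.range fun i => pev (P i)))) := by
    refine hq2.mono ?_
    rintro _ ⟨_, ⟨f, hf, rfl⟩, rfl⟩
    rcases hf with ⟨h, hh, rfl⟩ | ⟨i, rfl⟩
    · refine ⟨_, Or.inl ⟨_, ⟨h, hh, rfl⟩, rfl⟩, ?_⟩
      funext z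
      simp only [dl_cons]
      congr 1
    · refine ⟨_, Or.inr ⟨i, rfl⟩, ?_⟩
      funext z
      simp only [hP'', hP', dl_cons]
      rw [pev_taylor, pev_map, pev_trP]
      congr 2
      simp
  have hq4 := hq3.dl_le (k' := fun _ => v) (fun i => by
    refine Fin.cases ?_ (fun j => ?_) i <;> simp)
  refine hq4.mono ?_
  rintro _ ⟨f, hf, rfl⟩
  exact ⟨_, ⟨f, hf, rfl⟩, rfl⟩

theorem QQ_of_MM (hM : MM p n) (D : ℕ) : QQ p n D := by
  induction D using Nat.strong_induction_on with
  | _ D ih =>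
  intro ι _ H P hH hP hD
  rcases Nat.eq_zero_or_pos D with h0 | h0
  · have h1 : ∀ i, P i = 1 := by
      intro i
      apply (Polynomial.Monic.natDegree_eq_zero (hP i)).1
      rw [h0, Finset.sum_eq_zero_iff] at hD
      exact hD i (Finset.mem_univ i)
    refine ((hM H hH).lift.insert_const 1).mono ?_
    rintro f (hf | ⟨i, rfl⟩)
    · exact Or.inr hf
    · left
      funext z
      simp only [h1, pev, Polynomial.eval₂_one]
  · refine Res.loc fun y => ?_
    have hy : y = Fin.cons (y 0) (Fin.tail y) := (Fin.cons_self_tail y).symm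
    rw [hy]
    by_cases hne : ∀ i, (P i).map (evalAt (Fin.tail y)) = (Polynomial.X - Polynomial.C (y 0)) ^ (P i).natDegree
    · exact caseI h0 hM ih H hH P hP hD _ _ hne
    · obtain ⟨E, -, h⟩ := caseII ih H hH P hP hD _ _ hne
      exact ⟨E, h⟩

end PR

namespace PR
variable {p : ℕ} [hp : Fact p.Prime] {n : ℕ}

noncomputable def linT (l : Fin (n+1)) (w : Fin (n+1) → ℤ_[p]) (hw : w l = 1) :
    (Fin (n+1) → ℤ_[p]) ≃+ (Fin (n+1) → ℤ_[p]) where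
  toFun z i := z 0 * w i + (l.insertNth 0 (Fin.tail z) : Fin (n+1) → ℤ_[p]) i
  invFun y := Fin.cons (y l) (fun j => y (l.succAbove j) - y l * w (l.succAbove j))
  left_inv z := by
    ext1 i
    refine Fin.cases ?_ (fun j => ?_) i
    · simp [hw]
    · simp [hw, Fin.tail]
  right_inv y := by
    ext1 i
    refine Fin.succAboveCases l ?_ (fun j => ?_) i
    · simp [hw]
    · simp
  map_add' y z := by
    ext1 i
    refine Fin.succAboveCases l ?_ (fun j => ?_) i
    · simp [hw]
    · simp [Fin.tail]
      ring

lemma lin_exists (x : Fin (n+1) → ℤ_[p]) : ∃ T : (Fin (n+1) → ℤ_[p]) ≃+ (Fin (n+1) → ℤ_[p]),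
    (∀ i, Tate p (n+1) (fun z => T z i)) ∧ (∃ s, ∀ c, T (Fin.cons (c * s) fun _ => 0) = fun i => c * x i) ∧
    ∀ e z, T (dl (fun _ => e) z) = dl (fun _ => e) (T z) := by
  obtain ⟨l, hl⟩ := Finite.exists_max (fun i => ‖x i‖)
  have h1 : ∀ i, ∃ w, x l * w = x i := fun i => (mem_range_mul (x l) (x i)).2 (hl i)
  choose w hw using h1
  refine ⟨linT l (Function.update w l 1) (by simp), ?_, ⟨x l, ?_⟩, ?_⟩
  · intro i
    simp only [linT, AddEquiv.coe_mk, Equiv.coe_fn_mk]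
    refine (Tate.mul (Tate.coord 0) (Tate.const _)).add ?_
    refine Fin.succAboveCases l ?_ (fun j => ?_) i
    · simp only [Fin.insertNth_apply_same]
      exact Tate.const 0
    · simp only [Fin.insertNth_apply_succAbove]
      exact Tate.coord _
  · intro c
    ext1 i
    simp only [linT, AddEquiv.coe_mk, Equiv.coe_fn_mk]
    refine Fin.succAboveCases l ?_ (fun j => ?_) i
    · simp
    · simp only [Fin.insertNth_apply_succAbove, Fin.cons_zero, Fin.tail_cons, add_zero]
      rw [Function.update_of_ne (Fin.succAbove_ne l j), mul_assoc, hw]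
  · intro e z
    ext1 i
    simp only [linT, AddEquiv.coe_mk, Equiv.coe_fn_mk, dl]
    refine Fin.succAboveCases l ?_ (fun j => ?_) i
    · simp
    · simp [Fin.tail, dl]
      ring

theorem MM_all (n : ℕ) : MM p n := by
  induction n with
  | zero =>
    intro L hL
    refine Res.trivial fun f _ => ?_
    exact (MZ.const (f fun _ => 0)).congr fun x => congrArg f (Subsingleton.elim _ _)
  | succ n ih =>
    intro L hL
    refine Res.loc fun y0 => ?_
    let ι : Type := {f : (Fin (n+1) → ℤ_[p]) → ℤ_[p] // f ∈ L ∧ ∃ x : Fin (n+1) → ℤ_[p], f (y0 + fun i => p * x i) ≠ 0}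
    have hfin : Finite ι := (hL.1.subset (fun f hf => hf.1) :
      Set.Finite {f : (Fin (n+1) → ℤ_[p]) → ℤ_[p] | f ∈ L ∧ ∃ x : Fin (n+1) → ℤ_[p], f (y0 + fun i => p * x i) ≠ 0})
    have := Fintype.ofFinite ι
    obtain ⟨x, hx⟩ := nonvanish_prod (Finset.univ : Finset ι) (fun i z => i.1 (y0 + z))
      (fun i _ => (hL.2 i.1 i.2.1).comp fun j => (Tate.const _).add (Tate.coord j)) (fun i _ => i.2.2)
    obtain ⟨T, hT1, ⟨s, hs⟩, hT2⟩ := lin_exists x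
    have hft : ∀ i : ι, Tate p (n+1) (fun z => i.1 (y0 + T z)) := fun i =>
      (hL.2 i.1 i.2.1).comp fun j => (Tate.const _).add (hT1 j)
    choose F hF using fun i => expansion (hft i)
    have hd : ∀ i : ι, ∃ d, (∀ j < d, (PowerSeries.coeff j (F i)).1 (fun _ => 0) = 0) ∧
        (PowerSeries.coeff d (F i)).1 (fun _ => 0) ≠ 0 := by
      intro i
      refine coeff_zero_ne (f := fun z => i.1 (y0 + T z)) (F i) (hF i) s ?_
      beta_reduce
      rw [hs]
      exact hx i (Finset.mem_univ i)
    choose d hd0 hd1 using hd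
    obtain ⟨E, hE, hR⟩ := wstep (QQ_of_MM ih _) (fun i : ι => fun z => i.1 (y0 + T z)) ∅
      ⟨Set.finite_empty, fun f hf => absurd hf (Set.notMem_empty f)⟩ F hF d hd0 hd1 rfl
    refine ⟨E, ?_⟩
    have hR2 := hR.auto (fun x => T.symm x) (fun x => T x) hT1 (fun x => by simp)
      (fun G _ => lint_auto T (continuous_pi fun i => (hT1 i).continuous) G)
    refine (hR2.insert_const 0).mono ?_
    rintro _ ⟨f, hf, rfl⟩
    by_cases hc : ∃ x : Fin (n+1) → ℤ_[p], f (y0 + fun i => p * x i) ≠ 0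
    · right
      refine ⟨_, ⟨_, Or.inr ⟨⟨f, hf, hc⟩, rfl⟩, rfl⟩, ?_⟩
      funext z
      simp only [hT2, AddEquiv.apply_symm_apply]
    · left
      push Not at hc
      funext z
      have := hc (fun i => (p : ℤ_[p]) ^ (E - 1) * z i)
      simp only []
      rw [← this]
      congr 2
      ext1 i
      simp only [dl]
      rw [← mul_assoc, ← pow_succ', Nat.sub_add_cancel hE]

end PR

namespace PR
variable {p : ℕ} [hp : Fact p.Prime] {n : ℕ}

/-- rational generating function -/
def IsRat (a : ℕ → ℚ) : Prop :=
  ∃ g h : Polynomial ℚ, h ≠ 0 ∧ (h : PowerSeries ℚ) * PowerSeries.mk a = g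

lemma IsRat.add {a b : ℕ → ℚ} (ha : IsRat a) (hb : IsRat b) : IsRat (fun k => a k + b k) := by
  obtain ⟨g, h, h0, e⟩ := ha
  obtain ⟨g', h', h0', e'⟩ := hb
  refine ⟨h' * g + h * g', h * h', mul_ne_zero h0 h0', ?_⟩
  have : PowerSeries.mk (fun k => a k + b k) = PowerSeries.mk a + PowerSeries.mk b := by
    ext k; simp
  rw [this]
  push_cast
  rw [← e, ← e']
  ring

lemma IsRat.smul {a : ℕ → ℚ} (c : ℚ) (ha : IsRat a) : IsRat (fun k => c * a k) := by
  obtain ⟨g, h, h0, e⟩ := ha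
  refine ⟨Polynomial.C c * g, h, h0, ?_⟩
  have : PowerSeries.mk (fun k => c * a k) = PowerSeries.C c * PowerSeries.mk a := by
    ext k; simp
  rw [this]
  push_cast
  rw [← e]
  ring

lemma IsRat.poly (g : Polynomial ℚ) : IsRat (fun k => g.coeff k) := by
  refine ⟨g, 1, one_ne_zero, ?_⟩
  ext k; simp

lemma IsRat.of_mul {a b : ℕ → ℚ} (h : Polynomial ℚ) (h0 : h ≠ 0) (hb : IsRat b)
    (e : (h : PowerSeries ℚ) * PowerSeries.mk a = PowerSeries.mk b) : IsRat a := by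
  obtain ⟨g, h', h0', e'⟩ := hb
  refine ⟨g, h' * h, mul_ne_zero h0' h0, ?_⟩
  push_cast
  rw [mul_assoc, e, e']

lemma IsRat.X_pow {a : ℕ → ℚ} (α : ℕ) (ha : IsRat a) :
    IsRat (fun k => if α ≤ k then a (k - α) else 0) := by
  obtain ⟨g, h, h0, e⟩ := ha
  refine ⟨Polynomial.X ^ α * g, h, h0, ?_⟩
  have : PowerSeries.mk (fun k => if α ≤ k then a (k - α) else 0) = PowerSeries.X ^ α * PowerSeries.mk a := by
    ext k
    rw [PowerSeries.coeff_X_pow_mul']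
    simp
  rw [this]
  push_cast
  rw [← e]
  ring

lemma IsRat.lt (α : ℕ) (c : ℚ) : IsRat (fun k => if k < α then c else 0) := by
  convert IsRat.poly (∑ i ∈ Finset.range α, Polynomial.monomial i c) using 2 with k
  simp [Polynomial.coeff_monomial, Polynomial.finsetSum_coeff]

lemma IsRat.shift {a : ℕ → ℚ} (α : ℕ) (ha : IsRat a) : IsRat (fun k => a (k - α)) := by
  convert (ha.X_pow α).add (IsRat.lt α (a 0)) using 2 with k
  by_cases h : α ≤ k
  · simp [h, not_lt.2 h]
  · have : k - α = 0 := by omega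
    simp [h, not_le.1 h, this]

lemma IsRat.recur {a b : ℕ → ℚ} (α : ℕ) (q : ℚ) (hq : q ≠ 1) (hb : IsRat b)
    (h : ∀ k, a k = q * a (k - α) + b k) : IsRat a := by
  refine IsRat.of_mul (1 - Polynomial.C q * Polynomial.X ^ α) ?_
    (hb.add ((IsRat.lt α (a 0)).smul q)) ?_
  · intro h0
    have := congrArg (Polynomial.eval 1) h0
    simp [sub_eq_zero] at this
    exact hq this.symm
  · have h1 : ((1 - Polynomial.C q * Polynomial.X ^ α : Polynomial ℚ) : PowerSeries ℚ)
        = 1 - PowerSeries.C q * PowerSeries.X ^ α := by push_cast; rfl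
    rw [h1, sub_mul, one_mul, mul_assoc]
    ext k
    rw [map_sub, PowerSeries.coeff_C_mul, PowerSeries.coeff_X_pow_mul']
    simp only [PowerSeries.coeff_mk]
    by_cases hk : α ≤ k
    · rw [if_pos hk, if_neg (not_lt.2 hk)]
      linear_combination h k
    · have : k - α = 0 := by omega
      rw [if_neg hk, if_pos (not_le.1 hk)]
      have := h k
      rw [‹k - α = 0›] at this
      linear_combination this

/-- finite rational valued sequence with rational generating function -/
def RS (A : ℕ → ℝ≥0∞) : Prop :=
  (∀ k, A k ≠ ⊤) ∧ ∃ a : ℕ → ℚ, (∀ k, (A k).toReal = a k) ∧ IsRat a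

lemma RS.add {A B : ℕ → ℝ≥0∞} (hA : RS A) (hB : RS B) : RS (fun k => A k + B k) := by
  obtain ⟨h1, a, h2, h3⟩ := hA
  obtain ⟨h1', b, h2', h3'⟩ := hB
  refine ⟨fun k => ENNReal.add_ne_top.2 ⟨h1 k, h1' k⟩, _, fun k => ?_, h3.add h3'⟩
  rw [ENNReal.toReal_add (h1 k) (h1' k), h2, h2']
  push_cast; rfl

def RQ (w : ℝ≥0∞) : Prop := w ≠ ⊤ ∧ ∃ q : ℚ, w.toReal = q

lemma RatW.rq {w : ℝ≥0∞} (h : RatW w) : RQ w := by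
  refine ⟨h.ne_top, ?_⟩
  obtain ⟨a, b, hb, rfl⟩ := h
  exact ⟨a / b, by simp⟩

lemma RQ.mul {v w : ℝ≥0∞} (hv : RQ v) (hw : RQ w) : RQ (v * w) := by
  obtain ⟨h1, q, h2⟩ := hv
  obtain ⟨h1', q', h2'⟩ := hw
  refine ⟨ENNReal.mul_ne_top h1 h1', q * q', ?_⟩
  rw [ENNReal.toReal_mul, h2, h2']
  push_cast; rfl

lemma RS.smul {A : ℕ → ℝ≥0∞} {w : ℝ≥0∞} (hw : RQ w) (hA : RS A) : RS (fun k => w * A k) := by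
  obtain ⟨h1, a, h2, h3⟩ := hA
  obtain ⟨h1', q, h2'⟩ := hw
  refine ⟨fun k => ENNReal.mul_ne_top h1' (h1 k), _, fun k => ?_, h3.smul q⟩
  rw [ENNReal.toReal_mul, h2, h2']
  push_cast; rfl

lemma RS.rq {A : ℕ → ℝ≥0∞} (hA : RS A) (k : ℕ) : RQ (A k) := by
  obtain ⟨h1, a, h2, h3⟩ := hA
  exact ⟨h1 k, a k, h2 k⟩

lemma RS.shift {A : ℕ → ℝ≥0∞} (hA : RS A) (α : ℕ) : RS (fun k => A (k - α)) := by
  obtain ⟨h1, a, h2, h3⟩ := hA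
  exact ⟨fun k => h1 _, _, fun k => h2 _, h3.shift α⟩

lemma RS.const {w : ℝ≥0∞} (hw : RQ w) : RS (fun _ => w) := by
  obtain ⟨h1, q, h2⟩ := hw
  refine ⟨fun _ => h1, fun _ => q, fun k => h2, ?_⟩
  refine IsRat.of_mul (b := fun k => if k < 1 then q else 0) (1 - Polynomial.X) ?_ (IsRat.lt 1 q) ?_
  · intro h0
    have := congrArg (Polynomial.eval 0) h0
    simp at this
  · have h1 : ((1 - Polynomial.X : Polynomial ℚ) : PowerSeries ℚ) = 1 - PowerSeries.X := by push_cast; rfl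
    rw [h1, sub_mul, one_mul]
    ext k
    rcases k with _ | k
    · simp
    · rw [map_sub, PowerSeries.coeff_succ_X_mul]
      simp

lemma RS.le (e : ℕ) : RS (fun k => if k ≤ e then 1 else 0) := by
  refine ⟨fun k => by beta_reduce; split_ifs <;> simp, _, fun k => ?_, IsRat.lt (e+1) 1⟩
  by_cases h : k ≤ e
  · simp [h, Nat.lt_succ_of_le h]
  · simp [h, Nat.lt_succ_iff]

lemma RS.list {ι : Type*} (l : List ι) (A : ι → ℕ → ℝ≥0∞) (h : ∀ i ∈ l, RS (A i)) :
    RS (fun k => (l.map fun i => A i k).sum) := by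
  induction l with
  | nil => simpa using RS.const (w := 0) ⟨by simp, 0, by simp⟩
  | cons i l ih =>
    simp only [List.map_cons, List.sum_cons]
    exact (h i (by simp)).add (ih fun j hj => h j (by simp [hj]))

lemma RS.recur {A B : ℕ → ℝ≥0∞} {q : ℝ≥0∞} (α : ℕ) (hA : ∀ k, A k ≠ ⊤) (hq : RQ q) (hq1 : q ≠ 1)
    (hB : RS B) (h : ∀ k, A k = q * A (k - α) + B k) : RS A := by
  obtain ⟨h1, b, h2, h3⟩ := hB
  obtain ⟨h1', q', h2'⟩ := hq
  have hr : ∀ k, (A k).toReal = q' * (A (k - α)).toReal + b k := by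
    intro k
    conv_lhs => rw [h k]
    rw [ENNReal.toReal_add (ENNReal.mul_ne_top h1' (hA _)) (h1 k), ENNReal.toReal_mul, h2, h2']
  have hq1' : q' ≠ 1 := by
    rintro rfl
    apply hq1
    rw [← ENNReal.ofReal_toReal h1', h2']
    simp
  have hex : ∀ k, ∃ a : ℚ, (A k).toReal = a := by
    intro k
    induction k using Nat.strong_induction_on with
    | _ k ih =>
    by_cases hk : k - α < k
    · obtain ⟨a, ha⟩ := ih _ hk
      refine ⟨q' * a + b k, ?_⟩
      rw [hr, ha]
      push_cast; rfl
    · have hk' : k - α = k := by omega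
      have := hr k
      rw [hk'] at this
      refine ⟨b k / (1 - q'), ?_⟩
      have h0 : (1 - q' : ℝ) ≠ 0 := by
        rw [sub_ne_zero]
        exact_mod_cast hq1'.symm
      push_cast
      rw [eq_div_iff h0]
      linear_combination this
  choose a ha using hex
  refine ⟨hA, a, ha, h3.recur α q' hq1' ?_⟩
  intro k
  have := hr k
  rw [ha, ha] at this
  exact_mod_cast this

lemma RS.solve {A B : ℕ → ℝ≥0∞} {q v : ℝ≥0∞} (α : ℕ) (hB : ∀ k, B k ≠ ⊤) (hq : RQ q) (hv : RQ v) (hv0 : v ≠ 0)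
    (hA : RS A) (h : ∀ k, A k = q * A (k - α) + v * B k) : RS B := by
  obtain ⟨h1, a, h2, h3⟩ := hA
  obtain ⟨h1', q', h2'⟩ := hq
  obtain ⟨h1'', v', h2''⟩ := hv
  refine ⟨hB, _, fun k => ?_, ((h3.add ((h3.shift α).smul (-q'))).smul v'⁻¹)⟩
  have hv' : (v' : ℝ) ≠ 0 := by
    rw [← h2'']
    exact ENNReal.toReal_ne_zero.2 ⟨hv0, h1''⟩
  have hk := congrArg ENNReal.toReal (h k)
  rw [ENNReal.toReal_add (ENNReal.mul_ne_top h1' (h1 _)) (ENNReal.mul_ne_top h1'' (hB k)), ENNReal.toReal_mul,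
    ENNReal.toReal_mul, h2, h2, h2', h2''] at hk
  push_cast
  rw [eq_comm, inv_mul_eq_iff_eq_mul₀ hv']
  linear_combination hk

end PR

namespace PR
variable {p : ℕ} [hp : Fact p.Prime] {n : ℕ}

lemma lint_split (G : ℤ_[p] → ℝ≥0∞) :
    ∫⁻ s, G s = ‖(p : ℤ_[p])‖ₑ * (∫⁻ s, G (p * s)) + ∫⁻ s in UU p, G s := by
  rw [← lint_mul]
  have h1 : MeasurableSet {s : ℤ_[p] | ‖s‖ ≤ ‖(p : ℤ_[p])‖} := (isClosed_le (by fun_prop) (by fun_prop)).measurableSet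
  have h2 : UU p = {s : ℤ_[p] | ‖s‖ ≤ ‖(p : ℤ_[p])‖}ᶜ := by
    ext s
    simp only [UU, Set.mem_ofPred_eq, Set.mem_compl_iff, not_le]
    have h3 := PadicInt.norm_le_one s
    constructor
    · intro h; rw [h]; exact norm_p_lt_one'
    · intro h
      by_contra hc
      have h4 : ‖s‖ < 1 := lt_of_le_of_ne h3 hc
      have h5 := (PadicInt.norm_lt_one_iff_dvd s).1 h4
      obtain ⟨t, rfl⟩ := h5
      exact absurd h (not_lt.2 ((mem_range_mul _ _).1 ⟨t, rfl⟩))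
  rw [h2, lintegral_add_compl _ h1]

lemma vol_split : ‖(p : ℤ_[p])‖ₑ + volume (UU p) = 1 := by
  have := lint_split (p := p) (fun _ => 1)
  simp only [lintegral_const, measure_univ, mul_one, one_mul, Measure.restrict_apply MeasurableSet.univ, Set.univ_inter] at this
  exact this.symm

lemma enorm_p : ‖(p : ℤ_[p])‖ₑ = (p : ℝ≥0∞)⁻¹ := by
  have := enorm_p_pow (p := p) 1
  simpa using this

lemma enorm_p_lt : ‖(p : ℤ_[p])‖ₑ < 1 := by
  rw [enorm_p]
  exact ENNReal.inv_lt_one.2 (by exact_mod_cast hp.out.one_lt)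

lemma rq_p : RQ ‖(p : ℤ_[p])‖ₑ := by
  rw [enorm_p]
  exact (RatW.inv hp.out.pos).rq

lemma vol_UU_ne : volume (UU p) ≠ 0 := by
  intro h
  have := vol_split (p := p)
  rw [h, add_zero] at this
  exact absurd this enorm_p_lt.ne

lemma rq_UU : RQ (volume (UU p)) := by
  refine ⟨measure_ne_top _ _, ?_⟩
  obtain ⟨h, q, hq⟩ := rq_p (p := p)
  refine ⟨1 - q, ?_⟩
  have := congrArg ENNReal.toReal (vol_split (p := p))
  rw [ENNReal.toReal_add h (measure_ne_top _ _), hq] at this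
  push_cast
  simp at this
  linarith

/-- integral of characteristic function, unit part -/
lemma lint_unit_const (G : ℤ_[p] → ℝ≥0∞) (c : ℝ≥0∞) (h : ∀ s, ‖s‖ = 1 → G s = c) :
    ∫⁻ s in UU p, G s = volume (UU p) * c := by
  rw [setLIntegral_congr_fun (meas_UU) (g := fun _ => c) (fun s hs => h s hs)]
  simp [mul_comm]

open Classical in
/-- characteristic function of large order -/
noncomputable def ch (k : ℕ) (x : ℤ_[p]) : ℝ≥0∞ := if ‖x‖ ≤ ‖(p : ℤ_[p]) ^ k‖ then 1 else 0

lemma ch_congr (k : ℕ) {x y : ℤ_[p]} (h : ‖x‖ = ‖y‖) : ch k x = ch k y := by simp only [ch, h]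

lemma ch_le (k : ℕ) (x : ℤ_[p]) : ch k x ≤ 1 := by
  simp only [ch]; split_ifs <;> simp

lemma norm_p_pow_anti {j k : ℕ} : ‖(p : ℤ_[p]) ^ j‖ ≤ ‖(p : ℤ_[p]) ^ k‖ ↔ k ≤ j := by
  rw [norm_p_pow', norm_p_pow', zpow_le_zpow_iff_right₀ (by exact_mod_cast hp.out.one_lt)]
  omega

lemma ch_iff (k : ℕ) (x : ℤ_[p]) : ‖x‖ ≤ ‖(p : ℤ_[p]) ^ k‖ ↔ (p : ℤ_[p]) ^ k ∣ x := by
  rw [← mem_range_mul]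
  exact ⟨fun ⟨t, ht⟩ => ⟨t, ht.symm⟩, fun ⟨t, ht⟩ => ⟨t, ht.symm⟩⟩

lemma ch_p_pow_mul (k j : ℕ) (x : ℤ_[p]) : ch k ((p : ℤ_[p]) ^ j * x) = ch (k - j) x := by
  have : ‖(p : ℤ_[p]) ^ j * x‖ ≤ ‖(p : ℤ_[p]) ^ k‖ ↔ ‖x‖ ≤ ‖(p : ℤ_[p]) ^ (k - j)‖ := by
    rw [ch_iff, ch_iff]
    rcases le_total j k with h | h
    · obtain ⟨d, rfl⟩ := Nat.exists_eq_add_of_le h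
      rw [pow_add, mul_dvd_mul_iff_left (p_pow_ne_zero j)]
      simp
    · rw [Nat.sub_eq_zero_of_le h]
      simp only [pow_zero, isUnit_one, IsUnit.dvd, iff_true]
      exact (pow_dvd_pow _ h).mul_right x
  simp only [ch, this]

lemma ch_meas (k : ℕ) : Measurable (ch k : ℤ_[p] → ℝ≥0∞) := by
  unfold ch
  refine Measurable.ite ?_ measurable_const measurable_const
  exact (isClosed_le (by fun_prop) (by fun_prop)).measurableSet

lemma RS.mono (α γ : Fin n → ℕ) (e : ℕ) :
    RS (fun k => ∫⁻ x : Fin n → ℤ_[p], ch k ((p : ℤ_[p]) ^ e * ∏ i, x i ^ α i) * ‖∏ i, x i ^ γ i‖ₑ) := by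
  induction n with
  | zero =>
    simp only [Finset.univ_eq_empty, Finset.prod_empty, mul_one]
    convert RS.le e using 2 with k
    rw [lintegral_const, measure_univ, mul_one]
    simp [ch, norm_p_pow_anti, -norm_pow]
  | succ n ih =>
    have hm : ∀ k, Measurable fun x : Fin (n+1) → ℤ_[p] => ch k ((p : ℤ_[p]) ^ e * ∏ i, x i ^ α i) * ‖∏ i, x i ^ γ i‖ₑ := by
      intro k
      refine ((ch_meas k).comp ?_).mul ?_
      · exact Continuous.measurable (by fun_prop)
      · exact (Continuous.enorm (by fun_prop)).measurable
    set B : ℕ → ℝ≥0∞ := fun k => ∫⁻ x : Fin n → ℤ_[p], ch k ((p : ℤ_[p]) ^ e * ∏ i, x i ^ Fin.tail α i) *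
      ‖∏ i, x i ^ Fin.tail γ i‖ₑ with hB
    set A : ℕ → ℝ≥0∞ := fun k => ∫⁻ x : Fin (n+1) → ℤ_[p], ch k ((p : ℤ_[p]) ^ e * ∏ i, x i ^ α i) *
      ‖∏ i, x i ^ γ i‖ₑ with hA
    refine RS.recur (A := A) (B := fun k => volume (UU p) * B k) (q := ‖(p : ℤ_[p])‖ₑ * ‖(p : ℤ_[p])‖ₑ ^ γ 0)
      (α 0) ?_ ?_ ?_ ?_ ?_
    · intro k
      refine ne_top_of_le_ne_top ENNReal.one_ne_top (b := 1) ?_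
      calc A k ≤ ∫⁻ x : Fin (n+1) → ℤ_[p], 1 := by
            refine lintegral_mono fun x => ?_
            refine mul_le_one' (ch_le _ _) ?_
            rw [← ofReal_norm]
            exact ENNReal.ofReal_le_one.2 (PadicInt.norm_le_one _)
        _ = 1 := by simp
    · refine rq_p.mul ?_
      have : ‖(p : ℤ_[p])‖ₑ ^ γ 0 = ((p ^ γ 0 : ℕ) : ℝ≥0∞)⁻¹ := by rw [← enorm_p_pow, enorm_pow]
      rw [this]
      exact (RatW.inv (pow_pos hp.out.pos _)).rq
    · refine ne_of_lt ?_
      calc ‖(p : ℤ_[p])‖ₑ * ‖(p : ℤ_[p])‖ₑ ^ γ 0 ≤ ‖(p : ℤ_[p])‖ₑ * 1 := by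
            gcongr
            exact pow_le_one' enorm_p_lt.le _
        _ < 1 := by rw [mul_one]; exact enorm_p_lt
    · exact (ih (Fin.tail α) (Fin.tail γ)).smul rq_UU
    · intro k
      simp only [hA]
      rw [fubini 0 _ (hm k), fubini 0 _ (hm (k - α 0))]
      simp only [Fin.insertNth_zero', Fin.prod_univ_succ, Fin.cons_zero, Fin.cons_succ]
      have key : ∀ x : Fin n → ℤ_[p],
          ∫⁻ s : ℤ_[p], ch k ((p : ℤ_[p]) ^ e * (s ^ α 0 * ∏ i, x i ^ α i.succ)) * ‖s ^ γ 0 * ∏ i, x i ^ γ i.succ‖ₑ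
          = ‖(p : ℤ_[p])‖ₑ * ‖(p : ℤ_[p])‖ₑ ^ γ 0 *
            (∫⁻ s : ℤ_[p], ch (k - α 0) ((p : ℤ_[p]) ^ e * (s ^ α 0 * ∏ i, x i ^ α i.succ)) * ‖s ^ γ 0 * ∏ i, x i ^ γ i.succ‖ₑ)
            + volume (UU p) * (ch k ((p : ℤ_[p]) ^ e * ∏ i, x i ^ Fin.tail α i) * ‖∏ i, x i ^ Fin.tail γ i‖ₑ) := by
        intro x
        rw [lint_split, lint_unit_const _ (ch k ((p : ℤ_[p]) ^ e * ∏ i, x i ^ Fin.tail α i) * ‖∏ i, x i ^ Fin.tail γ i‖ₑ)]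
        · congr 1
          rw [mul_assoc]
          congr 1
          rw [← lintegral_const_mul']
          · refine lintegral_congr fun s => ?_
            have e1 : (p : ℤ_[p]) ^ e * ((p * s) ^ α 0 * ∏ i, x i ^ α i.succ) =
              p ^ α 0 * ((p : ℤ_[p]) ^ e * (s ^ α 0 * ∏ i, x i ^ α i.succ)) := by ring
            have e2 : ‖(p * s) ^ γ 0 * ∏ i, x i ^ γ i.succ‖ₑ = ‖(p : ℤ_[p])‖ₑ ^ γ 0 * ‖s ^ γ 0 * ∏ i, x i ^ γ i.succ‖ₑ := by
              rw [mul_pow, mul_assoc, enorm_mul, enorm_pow]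
            rw [e1, ch_p_pow_mul, e2]
            ring
          · exact ENNReal.pow_ne_top rq_p.1
        · intro s hs
          congr 1
          · apply ch_congr
            simp [norm_mul, hs, Fin.tail]
          · have : ‖s ^ γ 0 * ∏ i, x i ^ γ i.succ‖ = ‖∏ i, x i ^ Fin.tail γ i‖ := by
              simp [norm_mul, hs, Fin.tail]
            rw [← ofReal_norm, this, ofReal_norm]
      rw [lintegral_congr key, lintegral_add_right, lintegral_const_mul', lintegral_const_mul']
      · exact measure_ne_top _ _
      · exact (rq_p.1 |> fun h => ENNReal.mul_ne_top h (ENNReal.pow_ne_top h))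
      · refine Measurable.const_mul (((ch_meas k).comp ?_).mul ?_) _
        · exact Continuous.measurable (by fun_prop)
        · exact (Continuous.enorm (by fun_prop)).measurable

end PR

namespace PR
variable {p : ℕ} [hp : Fact p.Prime] {n : ℕ}

lemma norm_val {c : ℤ_[p]} (hc : c ≠ 0) : ‖c‖ = ‖(p : ℤ_[p]) ^ c.valuation‖ := by
  rw [PadicInt.norm_eq_zpow_neg_valuation hc, norm_p_pow']

lemma leaf_rs {f J : (Fin n → ℤ_[p]) → ℤ_[p]} (hf : MZ f) (hJ : MZ J) :
    RS (fun k => ∫⁻ x, ch k (f x) * ‖J x‖ₑ) := by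
  rcases hJ with hJ | ⟨γ, v, d, hv, hd, hvd, hJ⟩
  · simp only [hJ, enorm_zero, mul_zero, lintegral_zero]
    exact RS.const ⟨by simp, 0, by simp⟩
  have hJn : ∀ x, ‖J x‖ₑ = ‖d‖ₑ * ‖∏ i, x i ^ γ i‖ₑ := by
    intro x
    rw [hJ, enorm_mul, mul_comm]
    congr 1
    rw [← ofReal_norm, hvd, ofReal_norm]
  have hdq : RQ ‖d‖ₑ := by
    rw [enorm_eq d hd]
    exact (RatW.inv (pow_pos hp.out.pos _)).rq
  have hpull : ∀ g : ℕ → (Fin n → ℤ_[p]) → ℤ_[p], RS (fun k => ∫⁻ x, ch k (g k x) * ‖∏ i, x i ^ γ i‖ₑ) →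
      RS (fun k => ∫⁻ x, ch k (g k x) * ‖J x‖ₑ) := by
    intro g hg
    convert hg.smul hdq using 2 with k
    rw [← lintegral_const_mul' _ _ hdq.1]
    refine lintegral_congr fun x => ?_
    rw [hJn]
    ring
  rcases hf with hf | ⟨α, u, c, hu, hc, huc, hf⟩
  · refine hpull (fun _ => f) ?_
    have h0 := (RS.mono (p := p) (fun _ => 0) γ 0).rq 0
    convert RS.const h0 using 2 with k
    refine lintegral_congr fun x => ?_
    simp [hf, ch]
  · refine hpull (fun _ => f) ?_
    convert RS.mono (p := p) α γ c.valuation using 2 with k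
    refine lintegral_congr fun x => ?_
    congr 1
    apply ch_congr
    rw [hf, norm_mul, norm_mul, huc, norm_val hc, mul_comm]

lemma tate_rs {f : (Fin n → ℤ_[p]) → ℤ_[p]} (hf : Tate p n f) : RS (fun k => ∫⁻ x, ch k (f x)) := by
  obtain ⟨C, hC, hl⟩ := MM_all n {f} ⟨Set.finite_singleton f, fun g hg => by rw [Set.mem_singleton_iff.1 hg]; exact hf⟩
  have : (fun k => ∫⁻ x, ch k (f x)) = fun k => (C.map fun l => l.int (fun x => ch k (f x))).sum := by
    funext k
    exact hC _ ((ch_meas k).comp hf.continuous.measurable)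
  rw [this]
  refine RS.list C (fun l k => l.int (fun x => ch k (f x))) fun l hlC => ?_
  exact (leaf_rs ((hl l hlC).2 f rfl) (hl l hlC).1).smul l.hw.rq

open Classical in
lemma lin_form {r : ℕ} (c : Fin (r+1) → ℤ_[p]) (k : ℕ) :
    ∫⁻ z : Fin (r+1) → ℤ_[p], ch k (∑ i, z i * c i) =
      ‖(p : ℤ_[p])‖ₑ * (∫⁻ z : Fin (r+1) → ℤ_[p], ch (k - 1) (∑ i, z i * c i)) +
      volume (UU p) * (if ∀ i, ‖c i‖ ≤ ‖(p : ℤ_[p]) ^ k‖ then 1 else 0) := by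
  obtain ⟨l, hl⟩ := Finite.exists_max (fun i => ‖c i‖)
  have h1 : ∀ i, ∃ w, c l * w = c i := fun i => (mem_range_mul (c l) (c i)).2 (hl i)
  choose w hw using h1
  have h2 : ∀ k, ∫⁻ z : Fin (r+1) → ℤ_[p], ch k (∑ i, z i * c i) = ∫⁻ s : ℤ_[p], ch k (c l * s) := by
    intro k
    rw [fubini l (fun z => ch k (∑ i, z i * c i)) ((ch_meas k).comp (Continuous.measurable (by fun_prop)))]
    have : ∀ x : Fin r → ℤ_[p], ∫⁻ s : ℤ_[p], ch k (∑ i, (l.insertNth s x : Fin (r+1) → ℤ_[p]) i * c i) = ∫⁻ s : ℤ_[p], ch k (c l * s) := by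
      intro x
      rw [← lintegral_add_right_eq_self (fun s => ch k (c l * s)) (∑ j, x j * w (l.succAbove j))]
      refine lintegral_congr fun s => ?_
      congr 1
      rw [Fin.sum_univ_succAbove _ l]
      simp only [Fin.insertNth_apply_same, Fin.insertNth_apply_succAbove]
      rw [mul_add, mul_comm, Finset.mul_sum]
      congr 1
      refine Finset.sum_congr rfl fun j _ => ?_
      rw [← hw (l.succAbove j)]
      ring
    rw [lintegral_congr this]
    simp
  rw [h2, h2, lint_split, lint_unit_const _ (if ∀ i, ‖c i‖ ≤ ‖(p : ℤ_[p]) ^ k‖ then 1 else 0)]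
  · congr 2
    refine lintegral_congr fun s => ?_
    have e1 : c l * (p * s) = (p : ℤ_[p]) ^ 1 * (c l * s) := by ring
    rw [e1, ch_p_pow_mul]
  · intro s hs
    have : (∀ i, ‖c i‖ ≤ ‖(p : ℤ_[p]) ^ k‖) ↔ ‖c l * s‖ ≤ ‖(p : ℤ_[p]) ^ k‖ := by
      rw [norm_mul, hs, mul_one]
      exact ⟨fun h => h l, fun h i => (hl i).trans h⟩
    simp only [ch, this]

lemma fubini_append {m r : ℕ} (H : (Fin (m + r) → ℤ_[p]) → ℝ≥0∞) (hH : Measurable H) :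
    ∫⁻ x, H x = ∫⁻ y : Fin m → ℤ_[p], ∫⁻ z : Fin r → ℤ_[p], H (Fin.append y z) := by
  have h1 := (volume_measurePreserving_sumPiEquivProdPi_symm (fun _ : Fin m ⊕ Fin r => ℤ_[p]))
  have h2 := volume_measurePreserving_piCongrLeft (fun _ : Fin (m + r) => ℤ_[p]) finSumFinEquiv
  have h3 := h2.comp h1
  rw [← h3.lintegral_comp hH]
  rw [Measure.volume_eq_prod, lintegral_prod _ (by exact (hH.comp h3.measurable).aemeasurable)]
  refine lintegral_congr fun y => lintegral_congr fun z => ?_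
  congr 1
  ext1 i
  obtain ⟨j, rfl⟩ := finSumFinEquiv.surjective i
  simp only [Function.comp_apply, MeasurableEquiv.coe_piCongrLeft, Equiv.piCongrLeft_apply_apply,
    MeasurableEquiv.coe_sumPiEquivProdPi_symm]
  rcases j with j | j
  · simp [Equiv.sumPiEquivProdPi]
  · simp [Equiv.sumPiEquivProdPi]

open Classical in
lemma rs_main {m r : ℕ} (f : Fin r → (Fin m → ℤ_[p]) → ℤ_[p]) (hf : ∀ i, Tate p m (f i)) :
    RS (fun k => ∫⁻ y : Fin m → ℤ_[p], if ∀ i, ‖f i y‖ ≤ ‖(p : ℤ_[p]) ^ k‖ then 1 else 0) := by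
  set c : Fin (r+1) → (Fin m → ℤ_[p]) → ℤ_[p] := Fin.cons (fun _ => 0) f with hc
  have hcT : ∀ i, Tate p m (c i) := by
    intro i
    refine Fin.cases ?_ (fun j => ?_) i
    · exact Tate.const 0
    · simp only [hc, Fin.cons_succ]; exact hf j
  have hciff : ∀ k y, (∀ i, ‖f i y‖ ≤ ‖(p : ℤ_[p]) ^ k‖) ↔ ∀ i, ‖c i y‖ ≤ ‖(p : ℤ_[p]) ^ k‖ := by
    intro k y
    rw [Fin.forall_fin_succ]
    simp only [hc, Fin.cons_zero, Fin.cons_succ, norm_zero, norm_nonneg, true_and]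
  set Φ : (Fin (m + (r+1)) → ℤ_[p]) → ℤ_[p] := fun x => ∑ i, x (Fin.natAdd m i) * c i (fun j => x (Fin.castAdd (r+1) j)) with hΦ
  have hΦT : Tate p (m + (r+1)) Φ := Tate.sum _ fun i _ =>
    (Tate.coord _).mul ((hcT i).comp fun j => Tate.coord _)
  have hmeas : ∀ k, MeasurableSet {y | ∀ i, ‖f i y‖ ≤ ‖(p : ℤ_[p]) ^ k‖} := by
    intro k
    rw [Set.ofPred_forall]
    exact MeasurableSet.iInter fun i => (isClosed_le ((hf i).continuous.norm) continuous_const).measurableSet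
  have hA : ∀ k, ∫⁻ x, ch k (Φ x) = ∫⁻ y : Fin m → ℤ_[p], ∫⁻ z : Fin (r+1) → ℤ_[p], ch k (∑ i, z i * c i y) := by
    intro k
    rw [fubini_append (fun x => ch k (Φ x)) ((ch_meas k).comp hΦT.continuous.measurable)]
    simp only [hΦ, Fin.append_left, Fin.append_right]
  refine RS.solve (q := ‖(p : ℤ_[p])‖ₑ) (v := volume (UU p)) 1 ?_ rq_p rq_UU vol_UU_ne (tate_rs hΦT) ?_
  · intro k
    refine ne_top_of_le_ne_top ENNReal.one_ne_top (b := 1) ?_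
    calc _ ≤ ∫⁻ y : Fin m → ℤ_[p], 1 := by
          refine lintegral_mono fun x => ?_
          beta_reduce
          split_ifs <;> simp
      _ = 1 := by simp
  · intro k
    rw [hA, hA]
    simp only [lin_form (fun i => c i _) k, ← hciff]
    rw [lintegral_add_right, lintegral_const_mul' _ _ rq_p.1, lintegral_const_mul' _ _ rq_UU.1]
    exact (Measurable.ite (hmeas k) measurable_const measurable_const).const_mul _

open Classical in
lemma count {m r : ℕ} (f : Fin r → (Fin m → ℤ_[p]) → ℤ_[p]) (hf : ∀ i, Tate p m (f i)) (k : ℕ) :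
    ∫⁻ y : Fin m → ℤ_[p], (if ∀ i, ‖f i y‖ ≤ ‖(p : ℤ_[p]) ^ k‖ then 1 else 0) =
      ((p ^ (k * m) : ℕ) : ℝ≥0∞)⁻¹ * (Nat.card {x : Fin m → ZMod (p^k) // ∃ y : Fin m → ℤ_[p],
        (∀ j, PadicInt.toZModPow k (y j) = x j) ∧ ∀ i, PadicInt.toZModPow k (f i y) = 0} : ℕ) := by
  have hz : ∀ v : ℤ_[p], PadicInt.toZModPow k v = 0 ↔ (p : ℤ_[p]) ^ k ∣ v := by
    intro v
    rw [← RingHom.mem_ker, PadicInt.ker_toZModPow, Ideal.mem_span_singleton]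
  have hz2 : ∀ v w : ℤ_[p], PadicInt.toZModPow k v = PadicInt.toZModPow k w ↔ (p : ℤ_[p]) ^ k ∣ v - w := by
    intro v w
    rw [← hz, map_sub, sub_eq_zero]
  have hlip : ∀ y y' : Fin m → ℤ_[p], (∀ j, (p : ℤ_[p]) ^ k ∣ y' j - y j) →
      (∀ i, (p : ℤ_[p]) ^ k ∣ f i y) → ∀ i, (p : ℤ_[p]) ^ k ∣ f i y' := by
    intro y y' h h1 i
    have := dvd_add ((hf i).lipschitz y y' k h) (h1 i)
    simpa using this
  rw [(lint_dl (p := p) (n := m) (fun _ => k)).2]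
  have hconst : ∀ b : (i : Fin m) → Fin (p ^ k), ∀ x : Fin m → ℤ_[p],
      (∀ i, ‖f i (rp (k := fun _ => k) b + dl (fun _ => k) x)‖ ≤ ‖(p : ℤ_[p]) ^ k‖) ↔
      ∀ i, (p : ℤ_[p]) ^ k ∣ f i (rp (k := fun _ => k) b) := by
    intro b x
    simp only [ch_iff]
    exact ⟨hlip _ _ fun j => by simp [dl], hlip _ _ fun j => by simp [dl]⟩
  simp only [hconst, lintegral_const, measure_univ, mul_one]
  rw [← Finset.mul_sum, Finset.sum_boole]
  congr 2
  · simp [mul_comm]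
  · rw [← Fintype.card_subtype, ← Nat.card_eq_fintype_card]
    refine Nat.card_eq_of_bijective (fun b => ⟨fun j => PadicInt.toZModPow k (rp (k := fun _ => k) b.1 j),
      rp (k := fun _ => k) b.1, fun j => rfl, fun i => (hz _).2 (b.2 i)⟩) ⟨?_, ?_⟩
    · rintro ⟨b, hb⟩ ⟨b', hb'⟩ h
      simp only [Subtype.mk.injEq] at h ⊢
      funext j
      exact rep_unique k _ _ ((hz2 _ _).1 (congrFun h j))
    · rintro ⟨x, y, hy, hfy⟩
      choose b hb using fun j => exists_rep k (y j)
      refine ⟨⟨b, ?_⟩, ?_⟩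
      · refine hlip y _ (fun j => ?_) fun i => (hz _).1 (hfy i)
        rw [← dvd_neg, neg_sub]
        exact hb j
      · simp only [Subtype.mk.injEq]
        funext j
        rw [← hy j, eq_comm, hz2]
        exact hb j

theorem final {m r : ℕ} (a : Fin r → (Fin m → ℕ) → ℤ_[p]) (ha : ∀ i, Tendsto (a i) cofinite (nhds 0)) (N : ℕ → ℕ)
    (hN : ∀ k, N k = Nat.card {x : Fin m → ZMod (p^k) // ∃ y : Fin m → ℤ_[p], (∀ j, PadicInt.toZModPow k (y j) = x j) ∧
      ∀ i, PadicInt.toZModPow k (∑' ι, a i ι * ∏ j, y j ^ ι j) = 0}) :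
    ∃ g h : Polynomial ℚ, h ≠ 0 ∧
      (h : PowerSeries ℚ) * PowerSeries.mk (fun k => (N k : ℚ) * (p : ℚ) ^ (-(k * m : ℤ))) = g := by
  have hT : ∀ i, Tate p m (fun y => ∑' ι, a i ι * ∏ j, y j ^ ι j) := fun i => tate_restricted (a i) (ha i)
  obtain ⟨-, b, hb, hrat⟩ := rs_main (fun i y => ∑' ι, a i ι * ∏ j, y j ^ ι j) hT
  have : b = fun k => (N k : ℚ) * (p : ℚ) ^ (-(k * m : ℤ)) := by
    funext k
    have h1 := hb k
    beta_reduce at h1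
    rw [count _ hT k, ← hN k] at h1
    have h2 : (b k : ℝ) = (N k : ℝ) * (p : ℝ) ^ (-(k * m : ℤ)) := by
      rw [← h1]
      simp only [ENNReal.toReal_mul, ENNReal.toReal_inv, ENNReal.toReal_natCast]
      rw [mul_comm, zpow_neg]
      congr 2
      push_cast
      norm_cast
    apply Rat.cast_injective (α := ℝ)
    rw [h2]
    push_cast
    rfl
  rw [this] at hrat
  exact hrat

end PR

open PadicSub in
/-- Rationality of the analytic `p`-adic Poincaré series (corollary of Theorem 1 of the
paper, conjectured by Serre and Oesterlé, proven by Denef and van den Dries).  For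
restricted power series `f₁, …, f_r` over `ℤ_p` in `m` variables, let `N_k` be the number
of `x ∈ (ℤ/p^kℤ)^m` such that `f_i(y) ≡ 0 (mod p^k)` for all `i` and some lift `y` of `x`.
Then `P(T) = ∑_k N_k p^{-km} T^k` is a rational power series. -/
theorem poincare_series_rational
    (p : ℕ) [Fact p.Prime] (m r : ℕ) (a : Fin r → (Fin m → ℕ) → ℤ_[p])
    (ha : ∀ i, Filter.Tendsto (a i) Filter.cofinite (nhds 0))
    (N : ℕ → ℕ)
    (hN : ∀ k, N k = Nat.card {x : Fin m → ZMod (p ^ k) //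
      ∃ y : Fin m → ℤ_[p], (∀ j, PadicInt.toZModPow k (y j) = x j) ∧
        ∀ i, PadicInt.toZModPow k (∑' ι : Fin m → ℕ, a i ι * ∏ j, y j ^ ι j) = 0}) :
    ∃ g h : Polynomial ℚ, h ≠ 0 ∧
      (h : PowerSeries ℚ) *
        PowerSeries.mk (fun k => (N k : ℚ) * (p : ℚ) ^ (-(k * m : ℤ))) = g := by
  exact PR.final a ha N hN
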